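/- arXiv:2510.04505 — 3 statements merged into one kernel-verified Lean document; each statement's English description precedes it below -/
import Mathlib

section
/- Assume condition (H). Let u : [−1,∞) → ℝ be a solution of (E_h) on [−1,∞) such that ξ₋ < u(s) < ξ₊ for all s ∈ [−1,0] and the set {t ≥ −1 : u(t) = 0} is not bounded above. Let v : [−1,∞) → ℝ be a solution of (E_h) on [−1,∞) with ξ₋ < v(s) < ξ₊ for all s ∈ [−1,0]. Then: (i) if v(s) > u(s) for all s ∈ [−1,0], then v(t) → ξ₊ as t → ∞; (ii) if v(s) < u(s) for all s ∈ [−1,0], then v(t) → ξ₋ as t → ∞. -/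
open Real Set Filter Topology MeasureTheory

noncomputable section

/-- Condition `(C_g)(a)`: `g` maps `[0,∞)` into `[0,1]`, the restriction of `g` to `[0,1]`
is `C¹` with derivative `g'` (one-sided at the endpoints), `g = 0` on `(1,∞)`,
`g 0 = g' 0 = 0`, `g 1 = 1`, and `g' ξ > g ξ / ξ` for all `ξ ∈ (0,1]`. -/
structure CgA (g g' : ℝ → ℝ) : Prop where
  maps_to : ∀ ξ : ℝ, 0 ≤ ξ → g ξ ∈ Icc (0:ℝ) 1
  hasDeriv : ∀ ξ ∈ Icc (0:ℝ) 1, HasDerivWithinAt g (g' ξ) (Icc (0:ℝ) 1) ξ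
  derivCont : ContinuousOn g' (Icc (0:ℝ) 1)
  eq_zero : ∀ ξ : ℝ, 1 < ξ → g ξ = 0
  g_zero : g 0 = 0
  g'_zero : g' 0 = 0
  g_one : g 1 = 1
  slope : ∀ ξ : ℝ, 0 < ξ → ξ ≤ 1 → g ξ / ξ < g' ξ

/-- `x` is a (nonnegative, continuous) solution on `ℝ` of the delay equation
`x'(t) = -a·x(t) + b·F(x(t-1))`, in integral form. -/
def IsSolR (a b : ℝ) (F x : ℝ → ℝ) : Prop :=
  Continuous x ∧ (∀ t : ℝ, 0 ≤ x t) ∧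
    ∀ τ t : ℝ, τ < t →
      IntervalIntegrable (fun s => Real.exp (-a * (t - s)) * F (x (s - 1))) volume τ t ∧
      x t = Real.exp (-a * (t - τ)) * x τ
          + b * ∫ s in τ..t, Real.exp (-a * (t - s)) * F (x (s - 1))

/-- `x` is a (nonnegative, continuous) solution on `[T₁ - 1, ∞)` of the delay equation
`x'(t) = -a·x(t) + b·F(x(t-1))`, in integral form (identity for `T₁ ≤ τ < t`). -/
def IsSolOn (a b : ℝ) (F : ℝ → ℝ) (T₁ : ℝ) (x : ℝ → ℝ) : Prop :=
  ContinuousOn x (Ici (T₁ - 1)) ∧ (∀ t : ℝ, T₁ - 1 ≤ t → 0 ≤ x t) ∧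
    ∀ τ t : ℝ, T₁ ≤ τ → τ < t →
      IntervalIntegrable (fun s => Real.exp (-a * (t - s)) * F (x (s - 1))) volume τ t ∧
      x t = Real.exp (-a * (t - τ)) * x τ
          + b * ∫ s in τ..t, Real.exp (-a * (t - s)) * F (x (s - 1))

/-- `z` is the solution of `(E_g)` on `[0,∞)` with initial segment `z t = e^{-c t}` on `[0,1]`. -/
def IsZSol (c d : ℝ) (g z : ℝ → ℝ) : Prop :=
  IsSolOn c d g 1 z ∧ ∀ t ∈ Icc (0:ℝ) 1, z t = Real.exp (-c * t)

/-- Condition `(C_{f_n})(a)(b)`: `a n → c`, `b n → d`, each `f n : [0,∞) → [0,1)` is `C¹`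
with derivative `f' n`, `f n 0 = 0`, `f' n > 0` on `(0,1/2]`, the uniform closeness of
`(f n, f' n)` to `(g, g')` away from `1`, and the smallness of
`sup_{[1+κ,∞)}|f' n| · (sup_{[0,∞)}|f' n|)^m`. -/
structure Cfn (c d : ℝ) (g g' : ℝ → ℝ) (a b : ℕ → ℝ) (f f' : ℕ → ℝ → ℝ) : Prop where
  a_pos : ∀ n, 0 < a n
  b_pos : ∀ n, 0 < b n
  a_lim : Tendsto a atTop (nhds c)
  b_lim : Tendsto b atTop (nhds d)
  maps_to : ∀ n, ∀ ξ : ℝ, 0 ≤ ξ → f n ξ ∈ Ico (0:ℝ) 1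
  hasDeriv : ∀ n, ∀ ξ : ℝ, 0 ≤ ξ → HasDerivWithinAt (f n) (f' n ξ) (Ici (0:ℝ)) ξ
  derivCont : ∀ n, ContinuousOn (f' n) (Ici (0:ℝ))
  f_zero : ∀ n, f n 0 = 0
  f'_pos : ∀ n, ∀ ξ : ℝ, 0 < ξ → ξ ≤ 1/2 → 0 < f' n ξ
  close : ∀ κ : ℝ, 0 < κ → κ < 1 → ∀ ε : ℝ, 0 < ε → ∃ N : ℕ, ∀ n ≥ N,
      ∀ ξ : ℝ, (ξ ∈ Icc (0:ℝ) (1 - κ) ∨ 1 + κ ≤ ξ) →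
        |f n ξ - g ξ| + |f' n ξ - g' ξ| < ε
  small : ∀ κ : ℝ, 0 < κ → κ < 1 → ∀ m : ℕ, ∃ A B : ℕ → ℝ,
      (∀ n, ∀ ξ : ℝ, 1 + κ ≤ ξ → |f' n ξ| ≤ A n) ∧
      (∀ n, ∀ ξ : ℝ, 0 ≤ ξ → |f' n ξ| ≤ B n) ∧
      Tendsto (fun n => A n * (B n) ^ m) atTop (nhds 0)

/-- Condition `(H)`. -/
structure CondH (a b ξm ξp : ℝ) (h : ℝ → ℝ) : Prop where
  a_pos : 0 < a
  b_pos : 0 < b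
  ξm_neg : ξm < 0
  ξp_pos : 0 < ξp
  bdd : ∃ M : ℝ, ∀ ξ : ℝ, |h ξ| ≤ M
  smooth : ContDiff ℝ 1 h
  h_zero : h 0 = 0
  slope_zero : a < b * deriv h 0
  zero_m : -a * ξm + b * h ξm = 0
  zero_p : -a * ξp + b * h ξp = 0
  ratio : ∀ ξ : ℝ, ξm < ξ → ξ < ξp → ξ ≠ 0 → a / b < h ξ / ξ
  deriv_pos : ∀ ξ : ℝ, ξ ≠ ξm → ξ ≠ ξp → 0 < deriv h ξ

/-- Solution of `(E_h)`: `u'(t) = -a·u(t) + b·h(u(t-1))` on all of `ℝ`. -/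
def IsSolH (a b : ℝ) (h u : ℝ → ℝ) : Prop :=
  ∀ t : ℝ, HasDerivAt u (-a * u t + b * h (u (t - 1))) t

/-- Solution of `(E_h)` on `[-1,∞)`: continuous there, differentiable on `(0,∞)`
and satisfying the equation for `t > 0`. -/
def IsSolHOn (a b : ℝ) (h u : ℝ → ℝ) : Prop :=
  ContinuousOn u (Ici (-1:ℝ)) ∧
    ∀ t : ℝ, 0 < t → HasDerivAt u (-a * u t + b * h (u (t - 1))) t

/-- Solution of `(E_h)` on `(-∞,0]`. -/
def IsSolHIic (a b : ℝ) (h u : ℝ → ℝ) : Prop :=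
  ContinuousOn u (Iic (0:ℝ)) ∧
    ∀ t : ℝ, t ≤ 0 → HasDerivWithinAt u (-a * u t + b * h (u (t - 1))) (Iic (0:ℝ)) t

lemma core_mono {a p q : ℝ} {f f' : ℝ → ℝ} (hpq : p ≤ q) (hc : ContinuousOn f (Icc p q))
    (hd : ∀ s ∈ Ioo p q, HasDerivAt f (f' s) s) (hle : ∀ s ∈ Ioo p q, -a * f s ≤ f' s) :
    exp (a * p) * f p ≤ exp (a * q) * f q := by
  have hD : ∀ s ∈ Ioo p q, HasDerivAt (fun s => exp (a * s) * f s)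
      (exp (a * s) * a * f s + exp (a * s) * f' s) s := by
    intro s hs
    have h1 : HasDerivAt (fun s : ℝ => exp (a * s)) (exp (a * s) * a) s := by
      have := ((hasDerivAt_id s).const_mul a).exp
      simpa using this
    exact h1.mul (hd s hs)
  have : MonotoneOn (fun s => exp (a * s) * f s) (Icc p q) := by
    apply monotoneOn_of_deriv_nonneg (convex_Icc p q)
    · exact ContinuousOn.mul (by fun_prop) hc
    · rw [interior_Icc]
      exact fun s hs => (hD s hs).differentiableAt.differentiableWithinAt
    · rw [interior_Icc]
      intro s hs
      rw [(hD s hs).deriv]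
      have := hle s hs
      have h2 : 0 ≤ exp (a * s) * (a * f s + f' s) := mul_nonneg (exp_pos _).le (by linarith)
      linarith
  exact this (left_mem_Icc.2 hpq) (right_mem_Icc.2 hpq) hpq

lemma core_delay {a t : ℝ} {f f' : ℝ → ℝ} (hc : ContinuousOn f (Ici (t - 1)))
    (hd : ∀ s, t < s → HasDerivAt f (f' s) s)
    (hle : ∀ s, t < s → 0 ≤ f (s - 1) → -a * f s ≤ f' s)
    (h0 : ∀ s ∈ Icc (t - 1) t, 0 ≤ f s) : ∀ s, t - 1 ≤ s → 0 ≤ f s := by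
  have key : ∀ n : ℕ, ∀ s ∈ Icc (t - 1) (t + n), 0 ≤ f s := by
    intro n
    induction n with
    | zero => simpa using h0
    | succ n ih =>
      intro s hs
      push_cast at hs
      rcases le_or_gt s t with h | h
      · exact h0 s ⟨hs.1, h⟩
      · have := core_mono (a := a) (f' := f') h.le
          (hc.mono (fun x hx => by simp only [mem_Ici]; linarith [hx.1]))
          (fun x hx => hd x hx.1)
          (fun x hx => hle x hx.1 (ih _ ⟨by linarith [hx.1], by linarith [hx.2, hs.2]⟩))
        have h2 : 0 ≤ f t := h0 t ⟨by linarith, le_rfl⟩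
        have h3 : 0 ≤ exp (a * s) * f s := le_trans (by positivity) this
        exact nonneg_of_mul_nonneg_right h3 (exp_pos _)
  intro s hs
  obtain ⟨n, hn⟩ := exists_nat_ge (s - t)
  exact key n s ⟨hs, by linarith⟩

lemma CondH.mono {a b ξm ξp : ℝ} {h : ℝ → ℝ} (hH : CondH a b ξm ξp h) : Monotone h := by
  have hcl : IsClosed {x | 0 ≤ deriv h x} :=
    isClosed_le continuous_const (hH.smooth.continuous_deriv le_rfl)
  have hdense : Dense (({ξm, ξp} : Set ℝ)ᶜ) := (Set.toFinite _).countable.dense_compl ℝ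
  have hall : ∀ x, 0 ≤ deriv h x := by
    intro x
    have hsub : (({ξm, ξp} : Set ℝ)ᶜ) ⊆ {x | 0 ≤ deriv h x} := by
      intro y hy
      simp only [mem_compl_iff, mem_insert_iff, mem_singleton_iff, not_or] at hy
      exact (hH.deriv_pos y hy.1 hy.2).le
    exact hcl.closure_subset_iff.2 hsub (hdense x)
  exact monotone_of_deriv_nonneg (hH.smooth.differentiable one_ne_zero) hall

lemma sol_const {a b c : ℝ} {h : ℝ → ℝ} (hc : -a * c + b * h c = 0) :
    IsSolHOn a b h (fun _ => c) :=
  ⟨continuousOn_const, fun t _ => by simp only [hc]; exact hasDerivAt_const t c⟩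

lemma IsSolHOn.shift {a b σ : ℝ} {h u : ℝ → ℝ} (hu : IsSolHOn a b h u) (hσ : 0 ≤ σ) :
    IsSolHOn a b h (fun s => u (s + σ)) := by
  refine ⟨?_, ?_⟩
  · refine hu.1.comp (by fun_prop) ?_
    intro x hx
    simp only [mem_Ici] at *
    linarith
  · intro t ht
    have := (hu.2 (t + σ) (by linarith)).comp_add_const t σ
    have e : t - 1 + σ = t + σ - 1 := by ring
    simp only [e]
    exact this

lemma cmp_mono {a b p q : ℝ} {h x y : ℝ → ℝ} (hb : 0 < b) (hm : Monotone h)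
    (hx : IsSolHOn a b h x) (hy : IsSolHOn a b h y) (hp : 0 ≤ p) (hpq : p ≤ q)
    (hle : ∀ s, p - 1 ≤ s → x s ≤ y s) :
    exp (a * p) * (y p - x p) ≤ exp (a * q) * (y q - x q) := by
  apply core_mono (f := fun s => y s - x s) (a := a)
    (f' := fun s => (-a * y s + b * h (y (s - 1))) - (-a * x s + b * h (x (s - 1)))) hpq
  · exact (hy.1.sub hx.1).mono (fun s hs => by simp only [mem_Ici]; linarith [hs.1])
  · exact fun s hs => (hy.2 s (by linarith [hs.1])).sub (hx.2 s (by linarith [hs.1]))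
  · intro s hs
    have := mul_le_mul_of_nonneg_left (hm (hle (s - 1) (by linarith [hs.1]))) hb.le
    linarith

lemma cmp_le {a b t : ℝ} {h x y : ℝ → ℝ} (hb : 0 < b) (hm : Monotone h)
    (hx : IsSolHOn a b h x) (hy : IsSolHOn a b h y) (ht : 0 ≤ t)
    (hle : ∀ s ∈ Icc (t - 1) t, x s ≤ y s) : ∀ s, t - 1 ≤ s → x s ≤ y s := by
  intro s hs
  have := core_delay (f := fun s => y s - x s) (a := a) (t := t)
    (f' := fun s => (-a * y s + b * h (y (s - 1))) - (-a * x s + b * h (x (s - 1))))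
    ((hy.1.sub hx.1).mono (fun s hs => by simp only [mem_Ici] at *; linarith [hs]))
    (fun s hs => (hy.2 s (by linarith)).sub (hx.2 s (by linarith)))
    (by
      intro s hs h0
      have := mul_le_mul_of_nonneg_left (hm (show x (s-1) ≤ y (s-1) by linarith)) hb.le
      linarith)
    (fun s hs => by simpa using hle s hs) s hs
  linarith

lemma cmp_lt {a b t : ℝ} {h x y : ℝ → ℝ} (hb : 0 < b) (hm : Monotone h)
    (hx : IsSolHOn a b h x) (hy : IsSolHOn a b h y) (ht : 0 ≤ t)
    (hlt : ∀ s ∈ Icc (t - 1) t, x s < y s) : ∀ s, t - 1 ≤ s → x s < y s := by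
  intro s hs
  rcases le_or_gt s t with h1 | h1
  · exact hlt s ⟨hs, h1⟩
  have hle := cmp_le hb hm hx hy ht (fun s hs => (hlt s hs).le)
  have := cmp_mono (a := a) hb hm hx hy ht h1.le hle
  have h2 := hlt t ⟨by linarith, le_rfl⟩
  have h3 : 0 < exp (a * s) * (y s - x s) :=
    lt_of_lt_of_le (mul_pos (exp_pos _) (by linarith)) this
  have := pos_of_mul_pos_right h3 (exp_pos _).le
  linarith

lemma pos_conv {a b ξm ξp t : ℝ} {h v : ℝ → ℝ} (hH : CondH a b ξm ξp h)
    (hv : IsSolHOn a b h v) (hbd : ∀ s, -1 ≤ s → v s < ξp) (ht : 0 ≤ t)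
    (hpos : ∀ s ∈ Icc (t - 1) t, 0 < v s) : Tendsto v atTop (nhds ξp) := by
  have ha := hH.a_pos
  have hb := hH.b_pos
  have hm := hH.mono
  have hhc : Continuous h := hH.smooth.continuous
  have hrat : ∀ m, 0 < m → m < ξp → a * m < b * h m := by
    intro m h1 h2
    have := hH.ratio m (by linarith [hH.ξm_neg]) h2 h1.ne'
    rw [div_lt_div_iff₀ hb h1] at this
    linarith
  obtain ⟨s0, hs0, hmin⟩ := (isCompact_Icc (a := t - 1) (b := t)).exists_isMinOn
    ⟨t, by constructor <;> linarith⟩ (hv.1.mono (fun s hs => by simp only [mem_Ici]; linarith [hs.1]))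
  have hm0 := hpos s0 hs0
  have hm1 := hbd s0 (by linarith [hs0.1])
  have hge : ∀ s, t - 1 ≤ s → v s0 ≤ v s := by
    intro s hs
    have := core_delay (f := fun s => v s - v s0) (a := a) (t := t)
      (f' := fun s => (-a * v s + b * h (v (s - 1))))
      ((hv.1.sub continuousOn_const).mono (fun s hs => by simp only [mem_Ici] at *; linarith [hs]))
      (fun s hs => by simpa using (hv.2 s (by linarith)).sub_const (v s0))
      (by
        intro s hs h0
        have h1 := mul_le_mul_of_nonneg_left (hm (show v s0 ≤ v (s-1) by linarith)) hb.le
        have h2 := hrat _ hm0 hm1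
        linarith)
      (fun s hs => by simpa using hmin hs) s hs
    linarith
  set S : Set ℝ := {m | ∀ᶠ s in atTop, m ≤ v s} with hS
  have hmS : v s0 ∈ S := by
    filter_upwards [eventually_ge_atTop (t - 1)] with s hs using hge s hs
  have hSb : ∀ m ∈ S, m ≤ ξp := by
    intro m hmm
    obtain ⟨s, h1, h2⟩ := (Filter.Eventually.and hmm (eventually_ge_atTop (-1))).exists
    linarith [hbd s h2]
  have hbdd : BddAbove S := ⟨ξp, hSb⟩
  have hMle : sSup S ≤ ξp := csSup_le ⟨_, hmS⟩ hSb
  have hM0 : 0 < sSup S := lt_of_lt_of_le hm0 (le_csSup hbdd hmS)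
  have hlev : ∀ m < sSup S, ∀ᶠ s in atTop, m ≤ v s := by
    intro m hlt
    obtain ⟨m', hm', h1⟩ := exists_lt_of_lt_csSup ⟨_, hmS⟩ hlt
    filter_upwards [hm'] with s hs using h1.le.trans hs
  have hMeq : sSup S = ξp := by
    by_contra hne
    have hlt : sSup S < ξp := lt_of_le_of_ne hMle hne
    set M := sSup S with hMdef
    have h1 : a * M < b * h M := hrat M hM0 hlt
    have h2 : ∀ᶠ m in nhds M, a * M < b * h m :=
      (continuous_const.mul hhc).continuousAt.eventually (lt_mem_nhds h1)
    obtain ⟨m, hmM, hmm⟩ : ∃ m < M, a * M < b * h m := by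
      have := (h2.filter_mono nhdsWithin_le_nhds : ∀ᶠ m in 𝓝[<] M, a * M < b * h m)
      obtain ⟨m, h3, h4⟩ := (this.and self_mem_nhdsWithin).exists
      exact ⟨m, h4, h3⟩
    obtain ⟨t1, ht1⟩ := eventually_atTop.1 (hlev m hmM)
    set c := b * h m / a with hc
    have hcM : M < c := by rw [hc, lt_div_iff₀ ha]; linarith
    have hac : a * c = b * h m := by rw [hc]; field_simp
    set p := max t1 0 + 1 with hp
    have hp1 : t1 ≤ p - 1 := by rw [hp]; linarith [le_max_left t1 0]
    have hp0 : 1 ≤ p := by rw [hp]; linarith [le_max_right t1 0]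
    have hf : ∀ s, p ≤ s → exp (a * p) * (v p - c) ≤ exp (a * s) * (v s - c) := by
      intro s hs
      apply core_mono (f := fun s => v s - c) (a := a)
        (f' := fun s => (-a * v s + b * h (v (s - 1)))) hs
      · exact (hv.1.sub continuousOn_const).mono
          (fun s hs => by simp only [mem_Ici]; linarith [hs.1])
      · exact fun s hs => by simpa using (hv.2 s (by linarith [hs.1])).sub_const c
      · intro s hs
        have := mul_le_mul_of_nonneg_left (hm (ht1 (s - 1) (by linarith [hs.1]))) hb.le
        linarith
    have hMS : (M + c) / 2 ∈ S := by
      have hlim : Tendsto (fun s => exp (-(a * s)) * (exp (a * p) * (v p - c))) atTop (nhds 0) := by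
        have : Tendsto (fun s => exp (-(a * s))) atTop (nhds 0) :=
          tendsto_exp_neg_atTop_nhds_zero.comp (tendsto_id.const_mul_atTop ha)
        simpa using this.mul_const (exp (a * p) * (v p - c))
      filter_upwards [hlim.eventually (lt_mem_nhds (show -((c - M) / 2) < 0 by linarith)),
        eventually_ge_atTop p] with s h3 h4
      have h5 := mul_le_mul_of_nonneg_left (hf s h4) (exp_pos (-(a * s))).le
      rw [← mul_assoc (exp (-(a * s))) (exp (a * s)), ← Real.exp_add] at h5
      simp at h5
      linarith
    have := le_csSup hbdd hMS
    linarith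
  rw [tendsto_order]
  refine ⟨fun m hmlt => ?_, fun m hmlt => ?_⟩
  · filter_upwards [hlev ((m + ξp) / 2) (by rw [hMeq]; linarith)] with s hs
    linarith
  · filter_upwards [eventually_ge_atTop (-1)] with s hs
    linarith [hbd s hs]

lemma chain_le {f : ℝ → ℝ} {A B θ η : ℝ} (hθ : 0 ≤ θ) (hη : 0 ≤ η)
    (hf : ∀ q ρ, A ≤ q → q + ρ ≤ B → 0 ≤ ρ → ρ ≤ θ → f (q + ρ) ≤ f q + η) :
    ∀ n : ℕ, ∀ q ρ, A ≤ q → q + ρ ≤ B → 0 ≤ ρ → ρ ≤ n * θ → f (q + ρ) ≤ f q + n * η := by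
  intro n
  induction n with
  | zero =>
    intro q ρ _ _ h1 h2
    have : ρ = 0 := le_antisymm (by simpa using h2) h1
    simp [this]
  | succ n ih =>
    intro q ρ hA hB h1 h2
    push_cast at h2 ⊢
    rcases le_or_gt ρ θ with h | h
    · have := hf q ρ hA hB h1 h
      have : 0 ≤ n * η := by positivity
      linarith
    · have e1 := ih q (ρ - θ) hA (by linarith) (by linarith) (by linarith)
      have e2 := hf (q + (ρ - θ)) θ (by linarith) (by linarith) hθ le_rfl
      have e3 : q + (ρ - θ) + θ = q + ρ := by ring
      rw [e3] at e2
      linarith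

lemma osc_small {a b L : ℝ} {h u v : ℝ → ℝ} (ha : 0 < a) (hb : 0 < b) (hm : Monotone h)
    (h0 : h 0 = 0)
    (hu : IsSolHOn a b h u) (hv : IsSolHOn a b h v) (hL : 0 < L)
    (hlip : ∀ s σ, 0 ≤ s → 0 ≤ σ → u (s + σ) ≤ u s + L * σ)
    (hlt : ∀ s, -1 ≤ s → u s < v s)
    (zu : ∀ t, 0 ≤ t → ∃ s ∈ Icc (t - 1) t, u s = 0)
    (zv : ∀ t, 0 ≤ t → ∃ s ∈ Icc (t - 1) t, v s ≤ 0) :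
    ∀ ε > 0, ∃ t0, ∀ t ≥ t0, |u t| < ε ∧ |v t| < ε := by
  set S : Set ℝ := {τ | 0 ≤ τ ∧ ∃ t0, 0 ≤ t0 ∧ ∀ s, t0 ≤ s → ∀ σ, 0 ≤ σ → σ ≤ τ → u (s + σ) ≤ v s}
    with hS
  -- base
  obtain ⟨τ0, hτ0, hτS⟩ : ∃ τ0, 0 < τ0 ∧ τ0 ∈ S := by
    obtain ⟨s0, hs0, hmin⟩ := (isCompact_Icc (a := (0:ℝ)) (b := 1)).exists_isMinOn
      ⟨0, by simp⟩ ((hv.1.sub hu.1).mono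
        (fun s hs => by simp only [mem_Ici]; linarith [hs.1]))
    have hpos : 0 < v s0 - u s0 := by linarith [hlt s0 (by linarith [hs0.1])]
    refine ⟨(v s0 - u s0) / L, by positivity, by positivity, 0, le_rfl, ?_⟩
    intro s hs σ h1 h2
    refine cmp_le (t := 1) hb hm (hu.shift h1) hv zero_le_one ?_ s (by simpa using hs)
    intro s hs
    have hs' : s ∈ Icc (0:ℝ) 1 := by simpa using hs
    have e1 := hlip s σ hs'.1 h1
    have e2 : v s0 - u s0 ≤ v s - u s := hmin hs'
    rw [le_div_iff₀ hL] at h2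
    linarith
  have hSb : ∀ τ ∈ S, τ ≤ 2 := by
    rintro τ ⟨_, t0, ht0, hP⟩
    by_contra! hτ
    obtain ⟨s0, hs0, hv0⟩ := zv (t0 + 1) (by linarith)
    have hs0' : t0 ≤ s0 := by linarith [hs0.1]
    have hneg : ∀ s ∈ Icc s0 (s0 + 2), u s ≤ 0 := by
      intro s hs
      have := hP s0 hs0' (s - s0) (by linarith [hs.1]) (by linarith [hs.2])
      rw [show s0 + (s - s0) = s by ring] at this
      linarith
    have hzero : IsSolHOn a b h (fun _ => (0:ℝ)) := sol_const (by simp [h0])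
    have hneg' : ∀ s, s0 ≤ s → u s ≤ 0 := by
      intro s hs
      refine cmp_le (t := s0 + 1) hb hm hu hzero (by linarith) ?_ s (by linarith)
      intro s hs
      exact hneg s ⟨by linarith [hs.1], by linarith [hs.2]⟩
    obtain ⟨r, hr, hr0⟩ := zu (s0 + 4) (by linarith)
    have hz : ∀ s ∈ Icc (s0 + 1) (s0 + 2), 0 ≤ u s := by
      intro s hs
      have := cmp_mono (a := a) (p := s) (q := r) hb hm hu hzero (by linarith [hs.1])
        (by linarith [hs.2, hr.1]) (fun x hx => hneg' x (by linarith [hs.1]))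
      rw [hr0] at this
      simp only [sub_zero, mul_zero] at this
      have := nonpos_of_mul_nonpos_right this (exp_pos _)
      linarith
    obtain ⟨s, hs, hvs⟩ := zv (s0 + 2) (by linarith)
    have := hz s ⟨by linarith [hs.1], hs.2⟩
    linarith [hlt s (by linarith [hs.1])]
  have hbdd : BddAbove S := ⟨2, hSb⟩
  set T := sSup S with hT
  have hT2 : T ≤ 2 := csSup_le ⟨_, hτS⟩ hSb
  have hT0 : 0 < T := lt_of_lt_of_le hτ0 (le_csSup hbdd hτS)
  -- main estimate
  have main : ∀ δ, 0 < δ → δ ≤ T / 6 → ∃ t0, 0 ≤ t0 ∧ ∀ r, t0 + 4 ≤ r →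
      ∃ σ', 0 ≤ σ' ∧ σ' ≤ T - δ ∧ ∀ s, r - 3 ≤ s → s ≤ r + 1 →
        (∀ σ, 0 ≤ σ → σ ≤ T - δ → u (s + σ) ≤ v s) ∧
        v s ≤ u (s + σ') + 2 * δ * L * exp (a * 5) := by
    intro δ hδ hδT
    obtain ⟨τ, ⟨_, t0, ht0, hP⟩, hτ⟩ := exists_lt_of_lt_csSup ⟨_, hτS⟩ (show T - δ < T by linarith)
    refine ⟨t0, ht0, ?_⟩
    intro r hr
    have hnot : T + δ ∉ S := fun hmem => by linarith [le_csSup hbdd hmem]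
    obtain ⟨s1, hs1, σ, hσ0, hσ1, hgt⟩ : ∃ s ∈ Icc (r + 2 - 1) (r + 2), ∃ σ, 0 ≤ σ ∧ σ ≤ T + δ ∧
        v s < u (s + σ) := by
      by_contra! hcon
      apply hnot
      refine ⟨by linarith, r + 1, by linarith, ?_⟩
      intro s hs σ h1 h2
      refine cmp_le (t := r + 2) hb hm (hu.shift h1) hv (by linarith) ?_ s (by linarith)
      intro s hs
      exact hcon s hs σ h1 h2
    refine ⟨min σ (T - δ), le_min hσ0 (by linarith), min_le_right _ _, ?_⟩
    set σ' := min σ (T - δ) with hσ'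
    have hσ'0 : 0 ≤ σ' := le_min hσ0 (by linarith)
    have hσ'1 : σ' ≤ T - δ := min_le_right _ _
    have hσ'2 : σ' ≤ σ := min_le_left _ _
    have hσ'3 : σ - σ' ≤ 2 * δ := by
      rcases min_choice σ (T - δ) with h | h <;> rw [hσ', h] <;> linarith
    intro s hs hs2
    refine ⟨fun σ h1 h2 => hP s (by linarith) σ h1 (by linarith), ?_⟩
    have e1 := cmp_mono (a := a) (p := s) (q := s1) hb hm (hu.shift hσ'0) hv (by linarith)
      (by linarith [hs1.1]) (fun x hx => hP x (by linarith) σ' hσ'0 (by linarith))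
    have e2 := hlip (s1 + σ') (σ - σ') (by linarith [hs1.1]) (by linarith)
    rw [show s1 + σ' + (σ - σ') = s1 + σ by ring] at e2
    have e3 : v s1 - u (s1 + σ') ≤ 2 * δ * L := by nlinarith
    have e4 : v s - u (s + σ') ≤ exp (a * (s1 - s)) * (v s1 - u (s1 + σ')) := by
      have := mul_le_mul_of_nonneg_left e1 (exp_pos (-(a * s))).le
      rw [← mul_assoc, ← mul_assoc, ← Real.exp_add, ← Real.exp_add] at this
      rw [show -(a * s) + a * s = 0 by ring, show -(a * s) + a * s1 = a * (s1 - s) by ring] at this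
      simpa using this
    have e5 : exp (a * (s1 - s)) * (v s1 - u (s1 + σ')) ≤ exp (a * 5) * (2 * δ * L) := by
      apply mul_le_mul
      · apply exp_le_exp.2
        apply mul_le_mul_of_nonneg_left _ ha.le
        linarith [hs1.2]
      · exact e3
      · linarith [hP s1 (by linarith [hs1.1]) σ' hσ'0 (by linarith)]
      · exact (exp_pos _).le
    linarith
  obtain ⟨N, hN⟩ := exists_nat_ge (1 / (T / 3))
  have hN1 : 1 ≤ N * (T / 3) := by rwa [div_le_iff₀ (by positivity)] at hN
  have est : ∀ δ, 0 < δ → δ ≤ T / 6 → ∃ t0, 0 ≤ t0 ∧ ∀ r, t0 + 4 ≤ r →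
      |u r| ≤ N * (2 * δ * L * exp (a * 5)) := by
    intro δ hδ hδT
    obtain ⟨t0, ht0, H⟩ := main δ hδ hδT
    refine ⟨t0, ht0, ?_⟩
    intro r hr
    obtain ⟨σ', h1, h2, H⟩ := H r hr
    set η := 2 * δ * L * exp (a * 5) with hη
    have hη0 : 0 ≤ η := by positivity
    obtain ⟨r1, hr1, z1⟩ := zu r (by linarith)
    obtain ⟨r2, hr2, z2⟩ := zu (r + 1) (by linarith)
    rw [show r + 1 - 1 = r by ring] at hr2
    have both : (∀ q ρ, r - 1 ≤ q → q + ρ ≤ r + 1 → 0 ≤ ρ → ρ ≤ T / 3 → -u (q + ρ) ≤ -u q + η) ∨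
        (∀ q ρ, r - 1 ≤ q → q + ρ ≤ r + 1 → 0 ≤ ρ → ρ ≤ T / 3 → u (q + ρ) ≤ u q + η) := by
      rcases le_total (T / 2) σ' with hc | hc
      · left
        intro q ρ hq hqρ hρ0 hρ1
        obtain ⟨H1, H2⟩ := H (q + ρ - σ') (by linarith) (by linarith)
        have := H1 (σ' - ρ) (by linarith) (by linarith)
        rw [show q + ρ - σ' + (σ' - ρ) = q by ring] at this
        rw [show q + ρ - σ' + σ' = q + ρ by ring] at H2
        linarith
      · right
        intro q ρ hq hqρ hρ0 hρ1
        obtain ⟨H1, H2⟩ := H (q - σ') (by linarith) (by linarith)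
        have := H1 (σ' + ρ) (by linarith) (by linarith)
        rw [show q - σ' + (σ' + ρ) = q + ρ by ring] at this
        rw [show q - σ' + σ' = q by ring] at H2
        linarith
    rcases both with hf | hf
    · have c := chain_le (f := fun x => -u x) (by positivity) hη0 hf N
      have c1 := c r1 (r - r1) (by linarith [hr1.1]) (by linarith) (by linarith [hr1.2])
        (by linarith [hr1.1])
      have c2 := c r (r2 - r) (by linarith) (by linarith [hr2.2]) (by linarith [hr2.1])
        (by linarith [hr2.2])
      rw [show r1 + (r - r1) = r by ring] at c1
      rw [show r + (r2 - r) = r2 by ring] at c2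
      rw [abs_le]
      constructor <;> linarith
    · have c := chain_le (f := u) (by positivity) hη0 hf N
      have c1 := c r1 (r - r1) (by linarith [hr1.1]) (by linarith) (by linarith [hr1.2])
        (by linarith [hr1.1])
      have c2 := c r (r2 - r) (by linarith) (by linarith [hr2.2]) (by linarith [hr2.1])
        (by linarith [hr2.2])
      rw [show r1 + (r - r1) = r by ring] at c1
      rw [show r + (r2 - r) = r2 by ring] at c2
      rw [abs_le]
      constructor <;> linarith
  intro ε hε
  set C := (N + 1) * (2 * L * exp (a * 5)) with hC
  have hC0 : 0 < C := by positivity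
  set δ := min (T / 6) (ε / (2 * C)) with hδ
  have hδ0 : 0 < δ := lt_min (by positivity) (by positivity)
  have hδC : δ * C < ε := by
    have : δ ≤ ε / (2 * C) := min_le_right _ _
    rw [le_div_iff₀ (by positivity)] at this
    linarith
  obtain ⟨t1, ht1, E⟩ := est δ hδ0 (min_le_left _ _)
  obtain ⟨t2, ht2, H⟩ := main δ hδ0 (min_le_left _ _)
  have hη0 : 0 < 2 * δ * L * exp (a * 5) := by positivity
  have hδC' : N * (2 * δ * L * exp (a * 5)) + 2 * δ * L * exp (a * 5) < ε := by
    rw [hC] at hδC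
    linarith
  refine ⟨t1 + t2 + 4, fun t ht => ?_⟩
  have hu1 := E t (by linarith)
  refine ⟨by linarith, ?_⟩
  obtain ⟨σ', h1, h2, H⟩ := H t (by linarith)
  have h3 := (H t (by linarith) (by linarith)).2
  have h4 := E (t + σ') (by linarith)
  have h5 := hlt t (by linarith)
  rw [abs_le] at hu1 h4
  rw [abs_lt]
  constructor <;> linarith [hu1.1, h4.2]

lemma no_small {a b ξm ξp : ℝ} {h u v : ℝ → ℝ} (hH : CondH a b ξm ξp h)
    (hu : IsSolHOn a b h u) (hv : IsSolHOn a b h v)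
    (hlt : ∀ s, -1 ≤ s → u s < v s)
    (hs : ∀ ε > 0, ∃ t0, ∀ t ≥ t0, |u t| < ε ∧ |v t| < ε) : False := by
  have hcd : Continuous (deriv h) := hH.smooth.continuous_deriv le_rfl
  have hdf : Differentiable ℝ h := hH.smooth.differentiable one_ne_zero
  have hev : ∀ᶠ x in nhds (0:ℝ), a < b * deriv h x :=
    (continuous_const.mul hcd).continuousAt.eventually (lt_mem_nhds hH.slope_zero)
  obtain ⟨ε, hε, hball⟩ := Metric.eventually_nhds_iff.1 hev
  have hmon : MonotoneOn (fun x => b * h x - a * x) (Ioo (-ε) ε) := by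
    have hD : ∀ x, HasDerivAt (fun x => b * h x - a * x) (b * deriv h x - a) x := by
      intro x
      have := ((hdf x).hasDerivAt.const_mul b).fun_sub ((hasDerivAt_id' x).const_mul a)
      rw [mul_one] at this
      exact this
    apply monotoneOn_of_deriv_nonneg (convex_Ioo _ _)
    · exact fun x _ => (hD x).continuousAt.continuousWithinAt
    · exact fun x _ => (hD x).differentiableAt.differentiableWithinAt
    · intro x hx
      rw [interior_Ioo] at hx
      rw [(hD x).deriv]
      have := hball (y := x) (by rw [Real.dist_eq, sub_zero, abs_lt]; exact hx)
      linarith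
  obtain ⟨t0, ht0⟩ := hs ε hε
  set t := max t0 0 + 1 with ht
  have ht1 : t0 ≤ t - 1 := by rw [ht]; linarith [le_max_left t0 0]
  have ht2 : 1 ≤ t := by rw [ht]; linarith [le_max_right t0 0]
  obtain ⟨s0, hs0, hmin⟩ := (isCompact_Icc (a := t - 1) (b := t)).exists_isMinOn
    ⟨t, by constructor <;> linarith⟩ ((hv.1.sub hu.1).mono
      (fun s hs => by simp only [mem_Ici]; linarith [hs.1]))
  set m := v s0 - u s0 with hmdef
  have hm : 0 < m := by rw [hmdef]; linarith [hlt s0 (by linarith [hs0.1])]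
  have key : ∀ s, t - 1 ≤ s → 0 ≤ v s - u s - m := by
    apply core_delay (f := fun s => v s - u s - m) (a := a) (t := t)
      (f' := fun s => (-a * v s + b * h (v (s - 1))) - (-a * u s + b * h (u (s - 1))))
    · exact ((hv.1.sub hu.1).sub continuousOn_const).mono
        (fun s hs => by simp only [mem_Ici] at *; linarith [hs])
    · exact fun s hs => ((hv.2 s (by linarith)).sub (hu.2 s (by linarith))).sub_const m
    · intro s hs h0
      obtain ⟨e1, e2⟩ := ht0 (s - 1) (by linarith)
      rw [abs_lt] at e1 e2
      have := hmon e1 e2 (hlt (s - 1) (by linarith)).le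
      have h3 := mul_le_mul_of_nonneg_left h0 hH.a_pos.le
      simp only at this
      linarith
    · intro s hs
      have : m ≤ v s - u s := hmin hs
      linarith
  obtain ⟨t1, h1⟩ := hs (m / 2) (by linarith)
  obtain ⟨e1, e2⟩ := h1 (max t1 t) (le_max_left _ _)
  have := key (max t1 t) (by linarith [le_max_right t1 t])
  rw [abs_lt] at e1 e2
  linarith [e1.1, e2.2]

lemma part_one {a b ξm ξp : ℝ} {h : ℝ → ℝ} (hH : CondH a b ξm ξp h)
    {u v : ℝ → ℝ} (hu : IsSolHOn a b h u) (hv : IsSolHOn a b h v)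
    (hubd : ∀ s ∈ Icc (-1:ℝ) 0, ξm < u s ∧ u s < ξp)
    (hvbd : ∀ s ∈ Icc (-1:ℝ) 0, ξm < v s ∧ v s < ξp)
    (hosc : ¬ BddAbove {t : ℝ | -1 ≤ t ∧ u t = 0})
    (huv : ∀ s ∈ Icc (-1:ℝ) 0, u s < v s) : Tendsto v atTop (nhds ξp) := by
  have ha := hH.a_pos
  have hb := hH.b_pos
  have hm := hH.mono
  have hsp := sol_const hH.zero_p
  have hsm := sol_const hH.zero_m
  have hs0 : IsSolHOn a b h (fun _ => (0:ℝ)) := sol_const (by simp [hH.h_zero])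
  have hlt : ∀ s, -1 ≤ s → u s < v s := fun s hs =>
    cmp_lt (t := 0) hb hm hu hv le_rfl (by simpa using huv) s (by simpa using hs)
  have hvp : ∀ s, -1 ≤ s → v s < ξp := fun s hs =>
    cmp_lt (t := 0) hb hm hv hsp le_rfl
      (fun x hx => (hvbd x (by simpa using hx)).2) s (by simpa using hs)
  have hum : ∀ s, -1 ≤ s → ξm < u s := fun s hs =>
    cmp_lt (t := 0) hb hm hsm hu le_rfl
      (fun x hx => (hubd x (by simpa using hx)).1) s (by simpa using hs)
  have zu : ∀ t, 0 ≤ t → ∃ s ∈ Icc (t - 1) t, u s = 0 := by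
    intro t ht
    by_contra! hcon
    have hc : ContinuousOn u (Icc (t - 1) t) :=
      hu.1.mono (fun s hs => by simp only [mem_Ici]; linarith [hs.1])
    have hpre : IsPreconnected (Icc (t - 1) t) := isPreconnected_Icc
    have hsign : (∀ s ∈ Icc (t - 1) t, u s < 0) ∨ (∀ s ∈ Icc (t - 1) t, 0 < u s) := by
      by_contra! hh
      obtain ⟨⟨x, hx, hx0⟩, y, hy, hy0⟩ := hh
      obtain ⟨z, hz, hz0⟩ := hpre.intermediate_value hy hx hc (show (0:ℝ) ∈ _ from ⟨hy0, hx0⟩)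
      exact hcon z hz hz0
    apply hosc
    refine ⟨t, ?_⟩
    rintro s ⟨_, hs0'⟩
    by_contra! hst
    rcases hsign with hneg | hpos
    · have := cmp_lt (t := t) hb hm hu hs0 ht hneg s (by linarith)
      linarith
    · have := cmp_lt (t := t) hb hm hs0 hu ht hpos s (by linarith)
      linarith
  by_contra hno
  have zv : ∀ t, 0 ≤ t → ∃ s ∈ Icc (t - 1) t, v s ≤ 0 := by
    intro t ht
    by_contra! hcon
    exact hno (pos_conv hH hv hvp ht hcon)
  obtain ⟨M, hM⟩ := hH.bdd
  have hM0 : 0 ≤ M := (abs_nonneg _).trans (hM 0)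
  set L := -a * ξm + b * M with hL
  have hL0 : 0 < L := by
    have := mul_pos ha (neg_pos.2 hH.ξm_neg)
    have : 0 ≤ b * M := by positivity
    rw [hL]; linarith
  have hlip : ∀ s σ, 0 ≤ s → 0 ≤ σ → u (s + σ) ≤ u s + L * σ := by
    intro s σ h1 h2
    have := (convex_Ici (0:ℝ)).image_sub_le_mul_sub_of_deriv_le (f := u) (C := L)
      (hu.1.mono (fun s hs => by simp only [mem_Ici] at *; linarith))
      (by
        rw [interior_Ici]
        exact fun x hx => (hu.2 x hx).differentiableAt.differentiableWithinAt)
      (by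
        rw [interior_Ici]
        intro x hx
        rw [(hu.2 x hx).deriv]
        have e1 := mul_le_mul_of_nonneg_left (hum x (by linarith [mem_Ioi.1 hx])).le ha.le
        have e2 := mul_le_mul_of_nonneg_left ((le_abs_self _).trans (hM (u (x - 1)))) hb.le
        rw [hL]
        linarith)
      s h1 (s + σ) (by simp only [mem_Ici]; linarith) (by linarith)
    rw [show s + σ - s = σ by ring] at this
    linarith
  exact no_small hH hu hv hlt (osc_small ha hb hm hH.h_zero hu hv hL0 hlip hlt zu zv)

lemma CondH.reflect {a b ξm ξp : ℝ} {h : ℝ → ℝ} (hH : CondH a b ξm ξp h) :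
    CondH a b (-ξp) (-ξm) (fun x => -h (-x)) := by
  have hdf : Differentiable ℝ h := hH.smooth.differentiable one_ne_zero
  have hD : ∀ x, deriv (fun x => -h (-x)) x = deriv h (-x) := by
    intro x
    have h1 : HasDerivAt (fun x => -h (-x)) (-(deriv h (-x) * (-1))) x :=
      ((hdf (-x)).hasDerivAt.comp x (hasDerivAt_neg x)).neg
    rw [h1.deriv]; ring
  obtain ⟨M, hM⟩ := hH.bdd
  refine ⟨hH.a_pos, hH.b_pos, by linarith [hH.ξp_pos], by linarith [hH.ξm_neg],
    ⟨M, fun ξ => by simpa using hM (-ξ)⟩, (hH.smooth.comp contDiff_neg).neg, by simp [hH.h_zero],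
    ?_, ?_, ?_, ?_, ?_⟩
  · rw [hD]; simpa using hH.slope_zero
  · have := hH.zero_p
    rw [neg_neg]; linarith
  · have := hH.zero_m
    rw [neg_neg]; linarith
  · intro ξ h1 h2 h3
    have := hH.ratio (-ξ) (by linarith) (by linarith) (by simpa using h3)
    rwa [div_neg, ← neg_div] at this
  · intro ξ h1 h2
    rw [hD]
    exact hH.deriv_pos _ (fun e => h2 (by linarith)) (fun e => h1 (by linarith))

lemma IsSolHOn.reflect {a b : ℝ} {h u : ℝ → ℝ} (hu : IsSolHOn a b h u) :
    IsSolHOn a b (fun x => -h (-x)) (fun s => -u s) := by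
  refine ⟨hu.1.neg, fun t ht => ?_⟩
  have := (hu.2 t ht).fun_neg
  have e : -a * -u t + b * -h (- -u (t - 1)) = -(-a * u t + b * h (u (t - 1))) := by
    rw [neg_neg]; ring
  simp only [e]
  exact this

/-- under `(H)`, if the zero set of a solution `u` with initial segment in
`(ξ₋,ξ₊)` is unbounded above, then any solution `v` with initial segment strictly above
(resp. below) that of `u` converges to `ξ₊` (resp. `ξ₋`). -/
theorem stmt_6 (a b ξm ξp : ℝ) (h : ℝ → ℝ) (hH : CondH a b ξm ξp h)
    (u v : ℝ → ℝ) (hu : IsSolHOn a b h u) (hv : IsSolHOn a b h v)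
    (hubd : ∀ s ∈ Icc (-1:ℝ) 0, ξm < u s ∧ u s < ξp)
    (hvbd : ∀ s ∈ Icc (-1:ℝ) 0, ξm < v s ∧ v s < ξp)
    (hosc : ¬ BddAbove {t : ℝ | -1 ≤ t ∧ u t = 0}) :
    ((∀ s ∈ Icc (-1:ℝ) 0, u s < v s) → Tendsto v atTop (nhds ξp)) ∧
    ((∀ s ∈ Icc (-1:ℝ) 0, v s < u s) → Tendsto v atTop (nhds ξm)) := by
  refine ⟨part_one hH hu hv hubd hvbd hosc, fun hvu => ?_⟩
  have := part_one hH.reflect hu.reflect hv.reflect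
    (fun s hs => ⟨by linarith [(hubd s hs).2], by linarith [(hubd s hs).1]⟩)
    (fun s hs => ⟨by linarith [(hvbd s hs).2], by linarith [(hvbd s hs).1]⟩)
    (by simpa using hosc)
    (fun s hs => by linarith [hvu s hs])
  simpa using this.neg
end
end

section
/- Assume a, b, h satisfy condition (H); fix κ⁺ ∈ (0, ξ₊) and κ⁻ ∈ (ξ₋, 0), and let u⁺ : ℝ → ℝ (resp. u⁻) be the unique solution of (E_h) on ℝ with u⁺(t) ∈ [0,κ⁺] for all t ≤ 0 and u⁺(0) = κ⁺ (resp. u⁻(t) ∈ [κ⁻,0] for all t ≤ 0 and u⁻(0) = κ⁻). Let (a_n), (b_n) be sequences of positive reals with a_n → a, b_n → b, and let (h_n) be C¹ functions ℝ → ℝ with sup_{ξ∈[κ⁻,κ⁺]}(|h_n(ξ)−h(ξ)| + |h_n'(ξ)−h'(ξ)|) → 0 as n → ∞. (i) If for each n, u^n : (−∞,0] → ℝ is a solution on (−∞,0] of u'(t) = −a_n·u(t) + b_n·h_n(u(t−1)) with κ⁻ ≤ u^n(t) ≤ u^n(0) = κ⁺ for all t ≤ 0, and inf_{t≤0} u^n(t)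 → 0 as n → ∞, then u^n(t) → u⁺(t) as n → ∞ uniformly on compact subsets of (−∞,0]. (ii) If instead κ⁻ = u^n(0) ≤ u^n(t) ≤ κ⁺ for all t ≤ 0 and all n, and sup_{t≤0} u^n(t) → 0 as n → ∞, then u^n(t) → u⁻(t) as n → ∞ uniformly on compact subsets of (−∞,0]. -/
open Real Set Filter Topology MeasureTheory

noncomputable section

lemma compar (a : ℝ) (f f' : ℝ → ℝ) (s t : ℝ) (hst : s ≤ t) (hc : ContinuousOn f (Icc s t))
    (hd : ∀ x ∈ Ioo s t, HasDerivAt f (f' x) x) (hge : ∀ x ∈ Ioo s t, -a * f x ≤ f' x) :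
    Real.exp (-a * (t - s)) * f s ≤ f t := by
  have hm : MonotoneOn (fun x => Real.exp (a * x) * f x) (Icc s t) := by
    have hdd : ∀ x ∈ Ioo s t, HasDerivAt (fun x => Real.exp (a * x) * f x)
        (Real.exp (a * x) * (a * 1) * f x + Real.exp (a * x) * f' x) x := fun x hx =>
      (((hasDerivAt_id x).const_mul a).exp).mul (hd x hx)
    apply monotoneOn_of_deriv_nonneg (convex_Icc s t)
    · exact ContinuousOn.mul (by fun_prop) hc
    · rw [interior_Icc]
      intro x hx
      exact (hdd x hx).differentiableAt.differentiableWithinAt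
    · rw [interior_Icc]
      intro x hx
      rw [(hdd x hx).deriv]
      have := hge x hx
      have h1 := Real.exp_pos (a * x)
      nlinarith
  have h1 := hm (left_mem_Icc.2 hst) (right_mem_Icc.2 hst) hst
  simp only at h1
  have e1 : Real.exp (-a * (t - s)) = Real.exp (a * s) * Real.exp (-(a * t)) := by
    rw [← Real.exp_add]; ring_nf
  have e2 : Real.exp (a * t) * Real.exp (-(a * t)) = 1 := by
    rw [← Real.exp_add]; simp
  rw [e1]
  have h3 := mul_le_mul_of_nonneg_right h1 (Real.exp_pos (-(a * t))).le
  calc _ = Real.exp (a * s) * f s * Real.exp (-(a * t)) := by ring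
    _ ≤ _ := h3
    _ = Real.exp (a * t) * Real.exp (-(a * t)) * f t := by ring
    _ = f t := by rw [e2, one_mul]

lemma persist (a : ℝ) (w w' : ℝ → ℝ) (hc : ContinuousOn w (Iic 0))
    (hd : ∀ t < 0, HasDerivAt w (w' t) t)
    (hge : ∀ t < 0, 0 ≤ w (t - 1) → -a * w t ≤ w' t)
    (s : ℝ) (h0 : ∀ t ∈ Icc (s - 1) s, 0 ≤ w t) :
    ∀ t, s ≤ t → t ≤ 0 → Real.exp (-a * (t - s)) * w s ≤ w t := by
  have key : ∀ n : ℕ, ∀ t, s - 1 ≤ t → t ≤ s + n → t ≤ 0 → 0 ≤ w t := by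
    intro n
    induction n with
    | zero => intro t h1 h2 _; exact h0 t ⟨h1, by simpa using h2⟩
    | succ n ih =>
      intro t h1 h2 h3
      push_cast at h2
      by_cases hs : t ≤ s + n
      · exact ih t h1 hs h3
      push Not at hs
      have hsn : s ≤ s + n := by simp
      have := compar a w w' (s + n) t hs.le
        (hc.mono (fun x hx => hx.2.trans h3)) (fun x hx => hd x (hx.2.trans_le h3))
        (fun x hx => hge x (hx.2.trans_le h3)
          (ih _ (by linarith [hx.1]) (by linarith [hx.2]) (by linarith [hx.2])))
      refine le_trans (mul_nonneg (Real.exp_pos _).le ?_) this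
      exact ih _ (by linarith) le_rfl (by linarith)
  intro t hst ht
  apply compar a w w' s t hst
    (hc.mono (fun x hx => hx.2.trans ht)) (fun x hx => hd x (hx.2.trans_le ht))
  intro x hx
  apply hge x (hx.2.trans_le ht)
  obtain ⟨n, hn⟩ := exists_nat_gt (x - 1 - s)
  exact key n _ (by linarith [hx.1]) (by linarith) (by linarith [hx.2])

lemma near_zero (h : ℝ → ℝ) (H : ContDiff ℝ 1 h) (ε : ℝ) (hε : 0 < ε) :
    ∃ δ > 0, ∀ x y, |x| < δ → |y| < δ → |h x - h y - (x - y) * deriv h 0| ≤ ε * |x - y| := by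
  have := H.contDiffAt (x := 0) |>.hasStrictDerivAt (by norm_num)
  have h2 := this.hasStrictFDerivAt.isLittleO.def hε
  obtain ⟨δ, hδ, hb⟩ := Metric.eventually_nhds_iff.1 h2
  refine ⟨δ, hδ, fun x y hx hy => ?_⟩
  have := @hb (x, y) (by rw [Prod.dist_eq]; simp [hx, hy])
  simpa [Real.norm_eq_abs] using this

structure Hyp7 (a b κ : ℝ) (h : ℝ → ℝ) : Prop where
  a_pos : 0 < a
  b_pos : 0 < b
  κ_pos : 0 < κ
  smooth : ContDiff ℝ 1 h
  h0 : h 0 = 0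
  ratio : ∀ ξ, 0 < ξ → ξ ≤ κ → a * ξ < b * h ξ
  dpos : 0 < deriv h 0
  mono : MonotoneOn h (Icc 0 κ)

structure Sol7 (a b κ : ℝ) (h u : ℝ → ℝ) : Prop where
  cont : ContinuousOn u (Iic 0)
  der : ∀ t < 0, HasDerivAt u (-a * u t + b * h (u (t - 1))) t
  mem : ∀ t ≤ 0, u t ∈ Icc 0 κ
  end0 : u 0 = κ

section uniq
variable {a b κ : ℝ} {h : ℝ → ℝ}

lemma Hyp7.nonneg (H : Hyp7 a b κ h) : ∀ ξ ∈ Icc 0 κ, 0 ≤ h ξ := by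
  intro ξ hξ
  have := H.mono ⟨le_rfl, H.κ_pos.le⟩ hξ hξ.1
  rwa [H.h0] at this

lemma Hyp7.lip (H : Hyp7 a b κ h) : ∃ L : ℝ, 0 ≤ L ∧ ∀ ξ ∈ Icc 0 κ, h ξ ≤ L * ξ := by
  obtain ⟨K, hK⟩ := H.smooth.contDiffOn.exists_lipschitzOnWith (by norm_num) (convex_Icc 0 κ)
    isCompact_Icc
  refine ⟨K, K.2, fun ξ hξ => ?_⟩
  have := hK.dist_le_mul ξ hξ 0 ⟨le_rfl, H.κ_pos.le⟩
  rw [Real.dist_eq, Real.dist_eq, H.h0, sub_zero, sub_zero, abs_of_nonneg hξ.1] at this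
  exact (le_abs_self _).trans this

lemma Sol7.low (H : Hyp7 a b κ h) {u : ℝ → ℝ} (S : Sol7 a b κ h u) :
    ∀ s t, s ≤ t → t ≤ 0 → Real.exp (-a * (t - s)) * u s ≤ u t := by
  intro s t hst ht
  apply compar a u _ s t hst (S.cont.mono (fun x hx => hx.2.trans ht))
    (fun x hx => S.der x (hx.2.trans_le ht))
  intro x hx
  have := H.nonneg _ (S.mem (x - 1) (by linarith [hx.2]))
  nlinarith [H.b_pos]

lemma Sol7.low1 (H : Hyp7 a b κ h) {u : ℝ → ℝ} (S : Sol7 a b κ h u) :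
    ∀ s t, s ≤ t → t ≤ s + 1 → t ≤ 0 → u s ≤ Real.exp a * u t := by
  intro s t hst h1 ht
  have h2 := S.low H s t hst ht
  have h3 : Real.exp (-a) * u s ≤ Real.exp (-a * (t - s)) * u s := by
    apply mul_le_mul_of_nonneg_right _ (S.mem s (hst.trans ht)).1
    apply Real.exp_le_exp.2
    nlinarith [H.a_pos]
  have h4 := mul_le_mul_of_nonneg_left (h3.trans h2) (Real.exp_pos a).le
  rwa [← mul_assoc, ← Real.exp_add, add_neg_cancel, Real.exp_zero, one_mul] at h4

lemma harn (H : Hyp7 a b κ h) : ∃ C : ℝ, 1 ≤ C ∧ ∀ u, Sol7 a b κ h u →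
    ∀ s t, s ≤ t → t ≤ s + 1 → t ≤ 0 → u t ≤ C * u s := by
  obtain ⟨L, hL, hl⟩ := H.lip
  have hB : 0 ≤ b * L * Real.exp a :=
    mul_nonneg (mul_nonneg H.b_pos.le hL) (Real.exp_pos a).le
  refine ⟨1 + b * L * Real.exp a, by linarith, fun u S s t hst h1 ht => ?_⟩
  have us := (S.mem s (hst.trans ht)).1
  set B := b * L * Real.exp a * u s with hBd
  have hB' : 0 ≤ B := mul_nonneg hB us
  have := compar 0 (fun x => B * x - u x) (fun x => B * 1 - (-a * u x + b * h (u (x - 1)))) s t hst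
    (ContinuousOn.sub (by fun_prop) (S.cont.mono (fun x hx => hx.2.trans ht)))
    (fun x hx => ((hasDerivAt_id x).const_mul B).sub (S.der x (hx.2.trans_le ht))) ?_
  · simp at this
    nlinarith
  · intro x hx
    have h2 := hl _ (S.mem (x - 1) (by linarith [hx.2]))
    have h3 := S.low1 H (x - 1) s (by linarith [hx.2]) (by linarith [hx.1]) (by linarith)
    have h4 : b * h (u (x - 1)) ≤ B := by
      calc b * h (u (x - 1)) ≤ b * (L * (Real.exp a * u s)) := by
            apply mul_le_mul_of_nonneg_left _ H.b_pos.le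
            exact h2.trans (mul_le_mul_of_nonneg_left h3 hL)
        _ = B := by rw [hBd]; ring
    have h5 := mul_nonneg H.a_pos.le (S.mem x (by linarith [hx.2])).1
    linarith

lemma Sol7.pos (H : Hyp7 a b κ h) {u : ℝ → ℝ} (S : Sol7 a b κ h u) : ∀ t ≤ 0, 0 < u t := by
  obtain ⟨C, hC, hc⟩ := harn H
  have key : ∀ n : ℕ, ∀ t, -(n : ℝ) ≤ t → t ≤ 0 → 0 < u t := by
    intro n
    induction n with
    | zero =>
      intro t h1 h2
      have : t = 0 := le_antisymm h2 (by simpa using h1)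
      rw [this, S.end0]; exact H.κ_pos
    | succ n ih =>
      intro t h1 h2
      push_cast at h1
      have hle : t ≤ min (t + 1) 0 := le_min (by linarith) h2
      have h3 := hc u S t (min (t + 1) 0) hle (min_le_left _ _) (min_le_right _ _)
      have h4 := ih (min (t + 1) 0) (le_min (by linarith) (by simp)) (min_le_right _ _)
      have h5 : 0 < C * u t := h4.trans_le h3
      exact pos_of_mul_pos_right h5 (by linarith)
  intro t ht
  obtain ⟨n, hn⟩ := exists_nat_gt (-t)
  exact key n t (by linarith) ht

lemma Sol7.noLower (H : Hyp7 a b κ h) {u : ℝ → ℝ} (S : Sol7 a b κ h u) (m : ℝ) (hm : 0 < m) :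
    ∃ t ≤ 0, u t < m := by
  by_contra hcon
  push Not at hcon
  set I := sInf (u '' Iic 0) with hI
  have hne : (u '' Iic 0).Nonempty := ⟨u 0, 0, by simp, rfl⟩
  have hbd : BddBelow (u '' Iic 0) := ⟨m, by rintro _ ⟨t, ht, rfl⟩; exact hcon t ht⟩
  have hmI : m ≤ I := le_csInf hne (by rintro _ ⟨t, ht, rfl⟩; exact hcon t ht)
  have hIu : ∀ t ≤ 0, I ≤ u t := fun t ht => csInf_le hbd ⟨t, ht, rfl⟩
  have hIκ : I ≤ κ := by have := hIu 0 le_rfl; rwa [S.end0] at this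
  have hI0 : 0 < I := hm.trans_le hmI
  have hr := H.ratio I hI0 hIκ
  set δ := (b * h I - a * I) / a with hδ
  have hδ0 : 0 < δ := div_pos (by linarith) H.a_pos
  have haδ : a * δ = b * h I - a * I := by rw [hδ]; field_simp [H.a_pos.ne']
  have key : ∀ t ≤ 0, I + δ ≤ u t := by
    intro t ht
    have h1 : ∀ s ≤ t, Real.exp (-a * (t - s)) * (-δ) ≤ u t - (I + δ) := by
      intro s hs
      have := compar a (fun x => u x - (I + δ)) (fun x => -a * u x + b * h (u (x - 1))) s t hs
        ((S.cont.mono (fun x hx => hx.2.trans ht)).sub continuousOn_const)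
        (fun x hx => (S.der x (hx.2.trans_le ht)).sub_const _) ?_
      · refine le_trans ?_ this
        apply mul_le_mul_of_nonneg_left _ (Real.exp_pos _).le
        linarith [hIu s (hs.trans ht)]
      · intro x hx
        have hx0 : x - 1 ≤ 0 := by linarith [hx.2]
        have := H.mono ⟨hI0.le, hIκ⟩ (S.mem _ hx0) (hIu _ hx0)
        have := mul_le_mul_of_nonneg_left this H.b_pos.le
        nlinarith
    have hlim : Tendsto (fun s => Real.exp (-a * (t - s)) * (-δ)) atBot (𝓝 (0 * (-δ))) := by
      apply Tendsto.mul_const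
      apply Real.tendsto_exp_atBot.comp
      have : (fun s => -a * (t - s)) = fun s => a * s + (-a * t) := by ext; ring
      rw [this]
      exact tendsto_atBot_add_const_right _ _ (tendsto_id.const_mul_atBot H.a_pos)
    have := le_of_tendsto hlim ((eventually_le_atBot t).mono h1)
    linarith
  have : I + δ ≤ I := le_csInf hne (by rintro _ ⟨t, ht, rfl⟩; exact key t ht)
  linarith

lemma Sol7.lim0 (H : Hyp7 a b κ h) {u : ℝ → ℝ} (S : Sol7 a b κ h u) (ε : ℝ) (hε : 0 < ε) :
    ∃ T ≤ 0, ∀ t ≤ T, u t < ε := by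
  have key : ∀ s t, s + 1 ≤ t → t ≤ 0 → Real.exp (-a) * u s ≤ u t := by
    intro s t hst ht
    set m := Real.exp (-a) * u s with hm
    have hm0 : 0 ≤ m := mul_nonneg (Real.exp_pos _).le (S.mem s (by linarith)).1
    have hmle : ∀ x ∈ Icc (s + 1 - 1) (s + 1), 0 ≤ u x - m := by
      intro x hx
      have h1 := S.low1 H s x (by linarith [hx.1]) hx.2 (by linarith [hx.2])
      have := mul_le_mul_of_nonneg_left h1 (Real.exp_pos (-a)).le
      rw [← mul_assoc, ← Real.exp_add, neg_add_cancel, Real.exp_zero, one_mul] at this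
      linarith
    have := persist a (fun x => u x - m) _ (S.cont.sub continuousOn_const)
      (fun t ht => (S.der t ht).sub_const m) ?_ (s + 1) hmle t hst ht
    · have h2 := hmle (s + 1) ⟨by linarith, le_rfl⟩
      have h3 := mul_nonneg (Real.exp_pos (-a * (t - (s + 1)))).le h2
      linarith
    · intro x hx hx1
      have hx0 : x - 1 ≤ 0 := by linarith
      have hp := S.pos H _ hx0
      have hr := H.ratio _ hp (S.mem _ hx0).2
      have := mul_le_mul_of_nonneg_left hx1 H.a_pos.le
      nlinarith
  obtain ⟨T, hT, hTu⟩ := S.noLower H (Real.exp (-a) * ε) (mul_pos (Real.exp_pos _) hε)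
  refine ⟨T - 1, by linarith, fun t ht => ?_⟩
  have := key t T (by linarith) hT
  exact lt_of_mul_lt_mul_left (this.trans_lt hTu) (Real.exp_pos _).le

lemma Sol7.ordered (H : Hyp7 a b κ h) {u v : ℝ → ℝ} (U : Sol7 a b κ h u) (V : Sol7 a b κ h v)
    (s : ℝ) (h0 : ∀ t ∈ Icc (s - 1) s, u t ≤ v t) :
    ∀ t, s ≤ t → t ≤ 0 → Real.exp (-a * (t - s)) * (v s - u s) ≤ v t - u t := by
  apply persist a (fun x => v x - u x) _ (V.cont.sub U.cont)
    (fun t ht => (V.der t ht).sub (U.der t ht)) ?_ s (fun t ht => sub_nonneg.2 (h0 t ht))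
  intro t ht h1
  have ht0 : t - 1 ≤ 0 := by linarith
  have := H.mono (U.mem _ ht0) (V.mem _ ht0) (sub_nonneg.1 h1)
  have := mul_le_mul_of_nonneg_left this H.b_pos.le
  linarith

lemma Sol7.zero (H : Hyp7 a b κ h) {u v : ℝ → ℝ} (U : Sol7 a b κ h u) (V : Sol7 a b κ h v)
    (t : ℝ) (ht : t ≤ 0) : ∃ s ∈ Icc (t - 1) t, v s = u s := by
  have aux : ∀ {u v : ℝ → ℝ} (_ : Sol7 a b κ h u) (_ : Sol7 a b κ h v),
      ∃ s ∈ Icc (t - 1) t, v s ≤ u s := by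
    intro u v U V
    by_contra hc
    push Not at hc
    have := U.ordered H V t (fun x hx => (hc x hx).le) 0 ht le_rfl
    rw [U.end0, V.end0, sub_self] at this
    have h1 := hc t ⟨by linarith, le_rfl⟩
    have := mul_pos (Real.exp_pos (-a * (0 - t))) (sub_pos.2 h1)
    linarith
  obtain ⟨x, hx, hxx⟩ := aux U V
  obtain ⟨y, hy, hyy⟩ := aux V U
  have hsub : Icc (t - 1) t ⊆ Iic 0 := fun z hz => hz.2.trans ht
  exact isPreconnected_Icc.intermediate_value₂ hx hy (V.cont.mono hsub) (U.cont.mono hsub) hxx hyy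

lemma contr7 (y k p : ℝ → ℝ) (T k1 ρ B : ℝ) (hc : ContinuousOn y (Iic T))
    (hd : ∀ x < T, HasDerivAt y (k x * (p x - y x)) x)
    (hk : ∀ x < T, 0 ≤ k x ∧ k x ≤ k1) (hk1 : 0 ≤ k1)
    (hp : ∀ x < T, |p x| ≤ ρ * |y (x - 1)|) (hB : ∀ x ≤ T, |y x| ≤ B)
    (hz : ∀ t ≤ T, ∃ s ∈ Icc (t - 1) t, y s = 0) (hρ : 1 ≤ ρ)
    (hq : ρ * (1 - Real.exp (-k1)) < 1) : ∀ t ≤ T, y t = 0 := by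
  set Y := sSup ((fun x => |y x|) '' Iic T) with hY
  have hne : ((fun x => |y x|) '' Iic T).Nonempty := ⟨|y T|, T, by simp, rfl⟩
  have hbd : BddAbove ((fun x => |y x|) '' Iic T) :=
    ⟨B, by rintro _ ⟨t, ht, rfl⟩; exact hB t ht⟩
  have hyY : ∀ t ≤ T, |y t| ≤ Y := fun t ht => le_csSup hbd ⟨t, ht, rfl⟩
  have hY0 : 0 ≤ Y := (abs_nonneg _).trans (hyY T le_rfl)
  have hP0 : 0 ≤ ρ * Y := by positivity
  have hYP : Y ≤ ρ * Y := le_mul_of_one_le_left hY0 hρ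
  have hpP : ∀ x < T, |p x| ≤ ρ * Y := fun x hx => (hp x hx).trans
    (mul_le_mul_of_nonneg_left (hyY _ (by linarith)) (by linarith))
  have key : ∀ t ≤ T, |y t| ≤ ρ * (1 - Real.exp (-k1)) * Y := by
    intro t ht
    obtain ⟨s, hs, hs0⟩ := hz t ht
    have hsub : ContinuousOn y (Icc s t) := hc.mono (fun x hx => hx.2.trans ht)
    have he : Real.exp (-k1) ≤ Real.exp (-k1 * (t - s)) := by
      apply Real.exp_le_exp.2
      nlinarith [hs.1, hs.2]
    have he' := mul_le_mul_of_nonneg_right he hP0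
    have h1 := compar k1 (fun x => ρ * Y - y x) (fun x => -(k x * (p x - y x))) s t hs.2
      (continuousOn_const.sub hsub) (fun x hx => (hd x (hx.2.trans_le ht)).const_sub _) (by
        intro x hx
        have hx' := hx.2.trans_le ht
        obtain ⟨ka, kb⟩ := hk x hx'
        have e1 := abs_le.1 (hpP x hx')
        have e2 := abs_le.1 (hyY x hx'.le)
        have e3 : 0 ≤ ρ * Y - y x := by linarith
        have e4 := mul_le_mul_of_nonneg_right kb e3
        have e5 := mul_nonneg ka (sub_nonneg.2 e1.2)
        nlinarith)
    have h2 := compar k1 (fun x => ρ * Y + y x) (fun x => (k x * (p x - y x))) s t hs.2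
      (continuousOn_const.add hsub) (fun x hx => (hd x (hx.2.trans_le ht)).const_add _) (by
        intro x hx
        have hx' := hx.2.trans_le ht
        obtain ⟨ka, kb⟩ := hk x hx'
        have e1 := abs_le.1 (hpP x hx')
        have e2 := abs_le.1 (hyY x hx'.le)
        have e3 : 0 ≤ ρ * Y + y x := by linarith
        have e4 := mul_le_mul_of_nonneg_right kb e3
        have e5 := mul_nonneg ka (by linarith [e1.1] : 0 ≤ ρ * Y + p x)
        nlinarith)
    simp only [hs0, sub_zero, add_zero] at h1 h2
    rw [abs_le]
    constructor <;> nlinarith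
  have hle : Y ≤ ρ * (1 - Real.exp (-k1)) * Y :=
    csSup_le hne (by rintro _ ⟨t, ht, rfl⟩; exact key t ht)
  have hY00 : Y ≤ 0 := by
    by_contra hc'
    push Not at hc'
    nlinarith
  intro t ht
  exact abs_eq_zero.1 (le_antisymm ((hyY t ht).trans hY00) (abs_nonneg _))

lemma Sol7.uniq (H : Hyp7 a b κ h) {u v : ℝ → ℝ} (U : Sol7 a b κ h u) (V : Sol7 a b κ h v) :
    ∀ t ≤ 0, v t = u t := by
  obtain ⟨C, hC, hc⟩ := harn H
  obtain ⟨L, hL, hl⟩ := H.lip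
  set k1 := b * L * Real.exp a with hk1d
  have hk1 : 0 ≤ k1 := mul_nonneg (mul_nonneg H.b_pos.le hL) (Real.exp_pos a).le
  set c := deriv h 0 with hcd
  have hc0 : 0 < c := H.dpos
  set E := Real.exp (-k1) with hE
  have hE0 : 0 < E := Real.exp_pos _
  have hE1 : E ≤ 1 := Real.exp_le_one_iff.2 (by linarith)
  set ε := c * E / 4 with hεd
  have hε : 0 < ε := by positivity
  have hεc : ε < c := by rw [hεd]; nlinarith
  obtain ⟨δ, hδ, hnear⟩ := near_zero h H.smooth ε hε
  obtain ⟨T1, hT1, hu⟩ := U.lim0 H δ hδ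
  obtain ⟨T2, hT2, hv⟩ := V.lim0 H δ hδ
  set T := min T1 T2 with hT
  have hT0 : T ≤ 0 := (min_le_left _ _).trans hT1
  have hyz : ∀ t ≤ T, v t / u t - 1 = 0 := by
    apply contr7 (fun x => v x / u x - 1) (fun x => b * h (u (x - 1)) / u x)
      (fun x => (h (v (x - 1)) - h (u (x - 1))) / h (u (x - 1))) T k1 ((c + ε) / (c - ε))
      (C * Real.exp a + 1)
    · refine ContinuousOn.sub (ContinuousOn.div ?_ ?_ ?_) continuousOn_const
      · exact V.cont.mono (Iic_subset_Iic.2 hT0)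
      · exact U.cont.mono (Iic_subset_Iic.2 hT0)
      · intro x hx
        exact (U.pos H x (le_trans hx hT0)).ne'
    · intro x hx
      have hx0 : x < 0 := hx.trans_le hT0
      have hup := U.pos H x hx0.le
      have hup1 := U.pos H (x - 1) (by linarith)
      have hh : 0 < h (u (x - 1)) := by
        have := H.ratio _ hup1 (U.mem (x - 1) (by linarith)).2
        have h2 := mul_pos H.a_pos hup1
        exact pos_of_mul_pos_right (h2.trans this) H.b_pos.le
      have := ((V.der x hx0).div (U.der x hx0) hup.ne').sub_const 1
      refine this.congr_deriv ?_
      field_simp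
      ring
    · intro x hx
      have hx0 : x < 0 := hx.trans_le hT0
      have hup := U.pos H x hx0.le
      have hm := U.mem (x - 1) (by linarith)
      refine ⟨div_nonneg (mul_nonneg H.b_pos.le (H.nonneg _ hm)) hup.le, ?_⟩
      rw [div_le_iff₀ hup]
      calc b * h (u (x - 1)) ≤ b * (L * (Real.exp a * u x)) := by
            apply mul_le_mul_of_nonneg_left _ H.b_pos.le
            exact (hl _ hm).trans (mul_le_mul_of_nonneg_left
              (U.low1 H _ _ (by linarith) (by linarith) hx0.le) hL)
        _ = k1 * u x := by rw [hk1d]; ring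
    · exact hk1
    · intro x hx
      have hx0 : x < 0 := hx.trans_le hT0
      have hup1 := U.pos H (x - 1) (by linarith)
      have hvp1 := V.pos H (x - 1) (by linarith)
      have hu1 := hu (x - 1) (by linarith [min_le_left T1 T2])
      have hv1 := hv (x - 1) (by linarith [min_le_right T1 T2])
      have au : |u (x - 1)| < δ := by rwa [abs_of_pos hup1]
      have av : |v (x - 1)| < δ := by rwa [abs_of_pos hvp1]
      have n1 := hnear _ _ av au
      have n2 := hnear _ 0 au (by simpa using hδ)
      rw [H.h0, sub_zero, sub_zero, abs_of_pos hup1] at n2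
      have n3 := (abs_le.1 n2).1
      have hlow : (c - ε) * u (x - 1) ≤ h (u (x - 1)) := by linarith
      have hce : 0 < c - ε := by linarith
      have hhp : 0 < h (u (x - 1)) := (mul_pos hce hup1).trans_le hlow
      have n4 : |h (v (x - 1)) - h (u (x - 1))| ≤ (c + ε) * |v (x - 1) - u (x - 1)| := by
        have e : h (v (x - 1)) - h (u (x - 1)) = (h (v (x - 1)) - h (u (x - 1))
          - (v (x - 1) - u (x - 1)) * c) + (v (x - 1) - u (x - 1)) * c := by ring
        rw [e]
        refine (abs_add_le _ _).trans ?_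
        rw [abs_mul _ c, abs_of_pos hc0]
        linarith
      have e2 : v (x - 1) / u (x - 1) - 1 = (v (x - 1) - u (x - 1)) / u (x - 1) := by
        field_simp
      rw [e2, abs_div, abs_div, abs_of_pos hhp, abs_of_pos hup1, div_mul_div_comm]
      exact div_le_div₀ (by positivity) n4 (mul_pos hce hup1) hlow
    · intro x hx
      have hx0 : x ≤ 0 := hx.trans hT0
      obtain ⟨s, hs, hs0⟩ := U.zero H V x hx0
      have hup := U.pos H x hx0
      have hvp := V.pos H x hx0
      have h1 := hc v V s x hs.2 (by linarith [hs.1]) hx0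
      have h2 := U.low1 H s x hs.2 (by linarith [hs.1]) hx0
      have h3 : v x / u x ≤ C * Real.exp a := by
        rw [div_le_iff₀ hup]
        rw [hs0] at h1
        have := mul_le_mul_of_nonneg_left h2 (by linarith : 0 ≤ C)
        linarith
      have h4 := div_pos hvp hup
      rw [abs_le]
      constructor <;> linarith
    · intro t ht
      obtain ⟨s, hs, hs0⟩ := U.zero H V t (ht.trans hT0)
      refine ⟨s, hs, ?_⟩
      rw [hs0, div_self (U.pos H s (hs.2.trans (ht.trans hT0))).ne', sub_self]
    · rw [le_div_iff₀ (by linarith)]; linarith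
    · rw [div_mul_eq_mul_div, div_lt_one (by linarith)]
      rw [hεd]
      nlinarith [mul_pos hc0 hE0]
  have heq : ∀ t ≤ T, v t = u t := by
    intro t ht
    have h1 := hyz t ht
    have hup := U.pos H t (ht.trans hT0)
    rw [sub_eq_zero, div_eq_one_iff_eq hup.ne'] at h1
    exact h1
  intro t ht
  by_cases htT : t ≤ T
  · exact heq t htT
  push Not at htT
  have h1 := U.ordered H V T (fun x hx => (heq x hx.2).ge) t htT.le ht
  have h2 := V.ordered H U T (fun x hx => (heq x hx.2).le) t htT.le ht
  rw [heq T le_rfl, sub_self, mul_zero] at h1 h2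
  linarith

end uniq

lemma main7 (a b κ κm M : ℝ) (h : ℝ → ℝ) (H : Hyp7 a b κ h) (hκm : κm < 0)
    (up : ℝ → ℝ) (hup : Sol7 a b κ h up)
    (an bn : ℕ → ℝ)
    (hal : Tendsto an atTop (nhds a)) (hbl : Tendsto bn atTop (nhds b))
    (hn : ℕ → ℝ → ℝ) (hM : ∀ ξ, |h ξ| ≤ M)
    (hconv : ∀ ε : ℝ, 0 < ε → ∃ N : ℕ, ∀ n ≥ N, ∀ ξ ∈ Icc κm κ, |hn n ξ - h ξ| < ε)
    (un : ℕ → ℝ → ℝ)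
    (hs : ∀ n, IsSolHIic (an n) (bn n) (hn n) (un n))
    (hr : ∀ n, ∀ t : ℝ, t ≤ 0 → κm ≤ un n t ∧ un n t ≤ κ)
    (hk : ∀ n, un n 0 = κ)
    (hi : ∀ ε : ℝ, 0 < ε → ∃ N : ℕ, ∀ n ≥ N, (∀ t : ℝ, t ≤ 0 → -ε < un n t))
    (K : Set ℝ) (hK : IsCompact K) (hK0 : K ⊆ Iic 0) :
    TendstoUniformlyOn (fun n => un n) up atTop K := by
  rw [Metric.tendstoUniformlyOn_iff]
  intro ε0 hε0
  refine Filter.mem_iff_ultrafilter.2 fun 𝒰 h𝒰 => ?_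
  have hA : Tendsto an 𝒰 (𝓝 a) := hal.mono_left h𝒰
  have hB : Tendsto bn 𝒰 (𝓝 b) := hbl.mono_left h𝒰
  have hcv : ∀ ε : ℝ, 0 < ε → ∀ᶠ n in (𝒰 : Filter ℕ), ∀ ξ ∈ Icc κm κ, |hn n ξ - h ξ| < ε := by
    intro ε hε
    obtain ⟨N, hN⟩ := hconv ε hε
    exact h𝒰 (eventually_atTop.2 ⟨N, hN⟩)
  have hM0 : 0 ≤ M := (abs_nonneg _).trans (hM 0)
  set R := κ - κm with hR
  have hR0 : 0 < R := by linarith [H.κ_pos]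
  have hkR : ∀ ξ ∈ Icc κm κ, |ξ| ≤ R := by
    intro ξ hξ
    rw [abs_le]; constructor <;> linarith [hξ.1, hξ.2, H.κ_pos]
  have hex : ∀ t : ℝ, ∃ x : ℝ, t ≤ 0 → x ∈ Icc κm κ ∧ Tendsto (fun n => un n t) 𝒰 (𝓝 x) := by
    intro t
    by_cases ht : t ≤ 0
    · obtain ⟨x, hx, hxx⟩ := isCompact_Icc.ultrafilter_le_nhds' (s := Icc κm κ)
        (𝒰.map (fun n => un n t)) (by
          rw [Ultrafilter.mem_map]
          exact Filter.univ_mem' (fun n => hr n t ht))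
      exact ⟨x, fun _ => ⟨hx, hxx⟩⟩
    · exact ⟨0, fun h => absurd h ht⟩
  choose u hu using hex
  set Λ := (a + 1) * R + (b + 1) * (M + 1) with hΛ
  have ha := H.a_pos
  have hb := H.b_pos
  have hΛ0 : 0 < Λ := by positivity
  have hlip : ∀ᶠ n in (𝒰 : Filter ℕ), ∀ s ≤ 0, ∀ t ≤ 0, |un n s - un n t| ≤ Λ * |s - t| := by
    have e1 : ∀ᶠ n in (𝒰 : Filter ℕ), |an n| < a + 1 :=
      hA.abs.eventually_lt_const (by rw [abs_of_pos ha]; linarith)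
    have e2 : ∀ᶠ n in (𝒰 : Filter ℕ), |bn n| < b + 1 :=
      hB.abs.eventually_lt_const (by rw [abs_of_pos hb]; linarith)
    filter_upwards [e1, e2, hcv 1 one_pos] with n h1 h2 h3 s hs0 t ht0
    refine Convex.norm_image_sub_le_of_norm_hasDerivWithin_le (s := Iic (0:ℝ)) (x := t) (y := s)
      (fun x hx => (hs n).2 x hx) ?_ (convex_Iic 0) ht0 hs0
    intro x hx
    have hx : x ≤ 0 := hx
    have m1 := hkR _ (hr n x hx)
    have hm := hr n (x - 1) (by linarith)
    have m2 := h3 _ hm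
    have m3 : |hn n (un n (x - 1))| ≤ M + 1 := by
      have := abs_sub_abs_le_abs_sub (hn n (un n (x - 1))) (h (un n (x - 1)))
      linarith [hM (un n (x - 1))]
    rw [Real.norm_eq_abs]
    refine (abs_add_le _ _).trans ?_
    rw [abs_mul, abs_mul, abs_neg]
    exact add_le_add (mul_le_mul h1.le m1 (abs_nonneg _) (by linarith))
      (mul_le_mul h2.le m3 (abs_nonneg _) (by linarith))
  have hulip : ∀ s ≤ 0, ∀ t ≤ 0, |u s - u t| ≤ Λ * |s - t| := by
    intro s hs0 t ht0
    have := (((hu s hs0).2.sub (hu t ht0).2).abs)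
    exact le_of_tendsto this (hlip.mono fun n hn => hn s hs0 t ht0)
  have hunif : ∀ K : Set ℝ, IsCompact K → K ⊆ Iic 0 →
      TendstoUniformlyOn (fun n => un n) u 𝒰 K := by
    intro K hK hK0
    rw [← tendstoLocallyUniformlyOn_iff_tendstoUniformlyOn_of_compact hK,
      Metric.tendstoLocallyUniformlyOn_iff]
    intro ε hε x hx
    have hx0 : x ≤ 0 := hK0 hx
    refine ⟨K ∩ Metric.ball x (ε / (4 * Λ)), inter_mem_nhdsWithin _
      (Metric.ball_mem_nhds _ (by positivity)), ?_⟩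
    have := Metric.tendsto_nhds.1 (hu x hx0).2 (ε / 4) (by positivity)
    filter_upwards [this, hlip] with n h1 h2 y hy
    have hy0 : y ≤ 0 := hK0 hy.1
    have hd : |y - x| < ε / (4 * Λ) := by simpa [Real.dist_eq] using hy.2
    have hd' : Λ * |y - x| < ε / 4 := by
      rw [lt_div_iff₀ (by positivity)] at hd
      linarith
    have l1 := h2 y hy0 x hx0
    have l2 := hulip y hy0 x hx0
    rw [Real.dist_eq] at h1 ⊢
    rw [abs_lt] at h1 ⊢
    have l1' := abs_le.1 l1
    have l2' := abs_le.1 l2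
    constructor <;> linarith [h1.1, h1.2, l1'.1, l1'.2, l2'.1, l2'.2, hd']
  obtain ⟨L, hL⟩ := H.smooth.contDiffOn.exists_lipschitzOnWith (by norm_num) (convex_Icc κm κ)
    isCompact_Icc
  have hu0 : u 0 = κ := by
    have h1 := (hu 0 le_rfl).2
    simp only [hk] at h1
    exact tendsto_nhds_unique h1 tendsto_const_nhds
  have hSol : Sol7 a b κ h u := by
    refine ⟨?_, ?_, ?_, hu0⟩
    · have : LipschitzOnWith Λ.toNNReal u (Iic 0) := by
        apply LipschitzOnWith.of_dist_le_mul
        intro x hx y hy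
        rw [Real.coe_toNNReal _ hΛ0.le]
        exact hulip x hx y hy
      exact this.continuousOn
    · intro t ht
      have hIcc : ∀ x ∈ Icc (t - 2) 0, x ≤ 0 := fun x hx => hx.2
      have hU := Metric.tendstoUniformlyOn_iff.1 (hunif (Icc (t - 2) 0) isCompact_Icc (fun x hx => hx.2))
      refine hasDerivAt_of_tendstoUniformlyOn (l := (𝒰 : Filter ℕ)) (s := Ioo (t - 1) 0) (f := un)
        (f' := fun n x => -an n * un n x + bn n * hn n (un n (x - 1)))
        (g' := fun x => -a * u x + b * h (u (x - 1))) isOpen_Ioo ?_ ?_ ?_ ⟨by linarith, ht⟩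
      · rw [Metric.tendstoUniformlyOn_iff]
        intro ε hε
        set Q := R + a + (M + 1) + b * (1 + L) with hQ
        have hQ0 : 0 < Q := by positivity
        set η := min 1 (ε / (2 * Q)) with hη
        have hη0 : 0 < η := lt_min one_pos (by positivity)
        have hη1 : η ≤ 1 := min_le_left _ _
        have hηQ : η * Q < ε := by
          have : η ≤ ε / (2 * Q) := min_le_right _ _
          rw [le_div_iff₀ (by positivity)] at this
          linarith
        filter_upwards [hU η hη0, hcv η hη0, Metric.tendsto_nhds.1 hA η hη0,
          Metric.tendsto_nhds.1 hB η hη0] with n c1 c2 c3 c4 x hx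
        have hx0 : x ≤ 0 := hx.2.le
        have hx1 : x - 1 ≤ 0 := by linarith
        have d1 := c1 x ⟨by linarith [hx.1], hx0⟩
        have d2 := c1 (x - 1) ⟨by linarith [hx.1], hx1⟩
        have d3 := c2 _ (hr n (x - 1) hx1)
        have d4 := hL.dist_le_mul _ (hu (x - 1) hx1).1 _ (hr n (x - 1) hx1)
        have d5 := hkR _ (hr n x hx0)
        rw [Real.dist_eq] at c3 c4 d1 d2
        rw [Real.dist_eq, Real.dist_eq] at d4
        rw [Real.dist_eq]
        have d6 : |hn n (un n (x - 1))| ≤ M + 1 := by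
          have := abs_sub_abs_le_abs_sub (hn n (un n (x - 1))) (h (un n (x - 1)))
          linarith [hM (un n (x - 1))]
        have e : -a * u x + b * h (u (x - 1)) - (-an n * un n x + bn n * hn n (un n (x - 1)))
          = (an n - a) * un n x + (-a) * (u x - un n x)
            + (-(bn n - b)) * hn n (un n (x - 1)) + b * ((h (u (x - 1)) - h (un n (x - 1)))
              - (hn n (un n (x - 1)) - h (un n (x - 1)))) := by ring
        rw [e]
        have f1 : |(an n - a) * un n x| ≤ η * R := by
          rw [abs_mul]; exact mul_le_mul c3.le d5 (abs_nonneg _) hη0.le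
        have f2 : |(-a) * (u x - un n x)| ≤ a * η := by
          rw [abs_mul, abs_neg, abs_of_pos ha]; exact mul_le_mul_of_nonneg_left d1.le ha.le
        have f3 : |(-(bn n - b)) * hn n (un n (x - 1))| ≤ η * (M + 1) := by
          rw [abs_mul, abs_neg]; exact mul_le_mul c4.le d6 (abs_nonneg _) hη0.le
        have f4 : |b * ((h (u (x - 1)) - h (un n (x - 1)))
              - (hn n (un n (x - 1)) - h (un n (x - 1))))| ≤ b * (L * η + η) := by
          rw [abs_mul, abs_of_pos hb]
          apply mul_le_mul_of_nonneg_left _ hb.le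
          refine (abs_sub _ _).trans (add_le_add (d4.trans ?_) d3.le)
          exact mul_le_mul_of_nonneg_left d2.le L.2
        refine lt_of_le_of_lt ((abs_add_le _ _).trans (add_le_add ((abs_add_le _ _).trans
          (add_le_add ((abs_add_le _ _).trans (add_le_add f1 f2)) f3)) f4)) ?_
        refine lt_of_le_of_lt (le_of_eq ?_) hηQ
        rw [hQ]; ring
      · refine Eventually.of_forall fun n x hx => ?_
        exact ((hs n).2 x hx.2.le).hasDerivAt (Iic_mem_nhds hx.2)
      · intro x hx
        exact (hu x hx.2.le).2
    · intro t ht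
      refine ⟨?_, (hu t ht).1.2⟩
      apply le_of_forall_pos_le_add
      intro ε hε
      obtain ⟨N, hN⟩ := hi ε hε
      have := ge_of_tendsto (hu t ht).2
        (h𝒰 (eventually_atTop.2 ⟨N, fun n hn => (hN n hn t ht).le⟩))
      linarith
  have heq := hup.uniq H hSol
  have := Metric.tendstoUniformlyOn_iff.1 (hunif K hK hK0) ε0 hε0
  filter_upwards [this] with n hn x hx
  rw [← heq x (hK0 hx)]
  exact hn x hx


lemma hyp7_of (a b ξm ξp : ℝ) (h : ℝ → ℝ) (hH : CondH a b ξm ξp h) (κ : ℝ) (hκ : κ ∈ Ioo 0 ξp) :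
    Hyp7 a b κ h where
  a_pos := hH.a_pos
  b_pos := hH.b_pos
  κ_pos := hκ.1
  smooth := hH.smooth
  h0 := hH.h_zero
  ratio := by
    intro ξ h1 h2
    have := hH.ratio ξ (hH.ξm_neg.trans h1) (h2.trans_lt hκ.2) h1.ne'
    rw [div_lt_div_iff₀ hH.b_pos h1] at this
    linarith
  dpos := hH.deriv_pos 0 hH.ξm_neg.ne' hH.ξp_pos.ne
  mono := by
    apply StrictMonoOn.monotoneOn
    apply strictMonoOn_of_deriv_pos (convex_Icc 0 κ) hH.smooth.continuous.continuousOn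
    rw [interior_Icc]
    intro x hx
    exact hH.deriv_pos x (hH.ξm_neg.trans hx.1).ne' (hx.2.trans hκ.2).ne

lemma condH_neg (a b ξm ξp : ℝ) (h : ℝ → ℝ) (hH : CondH a b ξm ξp h) :
    CondH a b (-ξp) (-ξm) (fun x => -h (-x)) := by
  have hd : ∀ x, deriv (fun x => -h (-x)) x = deriv h (-x) := by
    intro x
    rw [deriv.fun_neg, deriv_comp_neg, neg_neg]
  refine ⟨hH.a_pos, hH.b_pos, by linarith [hH.ξp_pos], by linarith [hH.ξm_neg], ?_, ?_, ?_, ?_, ?_,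
    ?_, ?_, ?_⟩
  · obtain ⟨M, hM⟩ := hH.bdd
    exact ⟨M, fun ξ => by rw [abs_neg]; exact hM _⟩
  · exact (hH.smooth.comp contDiff_neg).neg
  · simp [hH.h_zero]
  · rw [hd, neg_zero]; exact hH.slope_zero
  · rw [neg_neg]; linarith [hH.zero_p]
  · rw [neg_neg]; linarith [hH.zero_m]
  · intro ξ h1 h2 h3
    have := hH.ratio (-ξ) (by linarith) (by linarith) (neg_ne_zero.2 h3)
    rwa [div_neg, ← neg_div] at this
  · intro ξ h1 h2
    rw [hd]
    exact hH.deriv_pos _ (fun e => h2 (by linarith)) (fun e => h1 (by linarith))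


/-- stability of `u⁺` and `u⁻` under perturbation of the equation:
solutions of the perturbed equations pinned between `κ⁻` and `κ⁺` on `(-∞,0]` whose
infimum (resp. supremum) tends to `0` converge to `u⁺` (resp. `u⁻`) uniformly on
compact subsets of `(-∞,0]`. -/
theorem stmt_7 (a b ξm ξp : ℝ) (h : ℝ → ℝ) (hH : CondH a b ξm ξp h)
    (κp κm : ℝ) (hκp : κp ∈ Ioo 0 ξp) (hκm : κm ∈ Ioo ξm 0)
    (uplus uminus : ℝ → ℝ)
    (hup : IsSolH a b h uplus ∧ (∀ t : ℝ, t ≤ 0 → uplus t ∈ Icc 0 κp) ∧ uplus 0 = κp)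
    (hum : IsSolH a b h uminus ∧ (∀ t : ℝ, t ≤ 0 → uminus t ∈ Icc κm 0) ∧ uminus 0 = κm)
    (an bn : ℕ → ℝ) (han : ∀ n, 0 < an n) (hbn : ∀ n, 0 < bn n)
    (hal : Tendsto an atTop (nhds a)) (hbl : Tendsto bn atTop (nhds b))
    (hn : ℕ → ℝ → ℝ) (hhn : ∀ n, ContDiff ℝ 1 (hn n))
    (hconv : ∀ ε : ℝ, 0 < ε → ∃ N : ℕ, ∀ n ≥ N, ∀ ξ ∈ Icc κm κp,
        |hn n ξ - h ξ| + |deriv (hn n) ξ - deriv h ξ| < ε) :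
    (∀ un : ℕ → ℝ → ℝ,
      (∀ n, IsSolHIic (an n) (bn n) (hn n) (un n)) →
      (∀ n, ∀ t : ℝ, t ≤ 0 → κm ≤ un n t ∧ un n t ≤ un n 0) →
      (∀ n, un n 0 = κp) →
      (∀ ε : ℝ, 0 < ε → ∃ N : ℕ, ∀ n ≥ N,
          (∀ t : ℝ, t ≤ 0 → -ε < un n t) ∧ ∃ t : ℝ, t ≤ 0 ∧ un n t < ε) →
      ∀ K : Set ℝ, IsCompact K → K ⊆ Iic 0 →
        TendstoUniformlyOn (fun n => un n) uplus atTop K) ∧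
    (∀ un : ℕ → ℝ → ℝ,
      (∀ n, IsSolHIic (an n) (bn n) (hn n) (un n)) →
      (∀ n, ∀ t : ℝ, t ≤ 0 → un n 0 ≤ un n t ∧ un n t ≤ κp) →
      (∀ n, un n 0 = κm) →
      (∀ ε : ℝ, 0 < ε → ∃ N : ℕ, ∀ n ≥ N,
          (∀ t : ℝ, t ≤ 0 → un n t < ε) ∧ ∃ t : ℝ, t ≤ 0 ∧ -ε < un n t) →
      ∀ K : Set ℝ, IsCompact K → K ⊆ Iic 0 →
        TendstoUniformlyOn (fun n => un n) uminus atTop K) := by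
  obtain ⟨M, hM⟩ := hH.bdd
  have hconv' : ∀ ε : ℝ, 0 < ε → ∃ N : ℕ, ∀ n ≥ N, ∀ ξ ∈ Icc κm κp, |hn n ξ - h ξ| < ε := by
    intro ε hε
    obtain ⟨N, hN⟩ := hconv ε hε
    refine ⟨N, fun n hn' ξ hξ => ?_⟩
    linarith [hN n hn' ξ hξ, abs_nonneg (deriv (hn n) ξ - deriv h ξ)]
  constructor
  · intro un hs hr hk hi K hK hK0
    refine main7 a b κp κm M h (hyp7_of a b ξm ξp h hH κp hκp) hκm.2 uplus
      ⟨fun x _ => (hup.1 x).continuousAt.continuousWithinAt, fun t _ => hup.1 t, hup.2.1, hup.2.2⟩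
      an bn hal hbl hn hM hconv' un hs (fun n t ht => ?_) hk (fun ε hε => ?_) K hK hK0
    · have := hr n t ht
      rwa [hk n] at this
    · obtain ⟨N, hN⟩ := hi ε hε
      exact ⟨N, fun n hn' => (hN n hn').1⟩
  · intro un hs hr hk hi K hK hK0
    have hH' := condH_neg a b ξm ξp h hH
    have := main7 a b (-κm) (-κp) M (fun x => -h (-x))
      (hyp7_of a b (-ξp) (-ξm) _ hH' (-κm) ⟨by linarith [hκm.2], by linarith [hκm.1]⟩)
      (by linarith [hκp.1]) (fun t => -uminus t)
      ⟨fun x _ => (hum.1 x).continuousAt.neg.continuousWithinAt,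
        fun t _ => (hum.1 t).neg.congr_deriv (by rw [neg_neg]; ring),
        fun t ht => ⟨by linarith [(hum.2.1 t ht).2], by linarith [(hum.2.1 t ht).1]⟩,
        by rw [hum.2.2]⟩
      an bn hal hbl (fun n x => -hn n (-x)) (fun ξ => by rw [abs_neg]; exact hM _)
      (fun ε hε => by
        obtain ⟨N, hN⟩ := hconv' ε hε
        refine ⟨N, fun n hn' ξ hξ => ?_⟩
        have := hN n hn' (-ξ) ⟨by linarith [hξ.2], by linarith [hξ.1]⟩
        rw [← abs_neg] at this
        convert this using 2
        ring)
      (fun n t => -un n t)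
      (fun n => ⟨(hs n).1.neg, fun t ht => ((hs n).2 t ht).neg.congr_deriv
        (by simp only [neg_neg]; ring)⟩)
      (fun n t ht => by
        have := hr n t ht
        rw [hk n] at this
        constructor <;> linarith [this.1, this.2])
      (fun n => by rw [hk n])
      (fun ε hε => by
        obtain ⟨N, hN⟩ := hi ε hε
        exact ⟨N, fun n hn' t ht => neg_lt_neg ((hN n hn').1 t ht)⟩)
      K hK hK0
    rw [Metric.tendstoUniformlyOn_iff] at this ⊢
    intro ε hε
    filter_upwards [this ε hε] with n h1 x hx
    have := h1 x hx
    rwa [dist_neg_neg] at this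
end
end

section
/- Assume condition (C_g)(a) and let d > c > 0, with ξ₁ ∈ (0,1) the unique positive zero of ξ ↦ −c·ξ + d·g(ξ) in (0,1]. Fix κ⁺ ∈ (0, 1−ξ₁) and κ⁻ ∈ (−ξ₁, 0). Then there exist unique solutions x⁻, x⁺ : ℝ → ℝ of (E_g) on ℝ with the following properties. (i) x⁺(0) = ξ₁ + κ⁺ < 1; there is a unique t₁ > 0 with x⁺(t₁) = 1; x⁺ is strictly increasing on (−∞, t₁+1]; lim_{t→−∞} x⁺(t) = ξ₁; with t₂ := t₁ + 1 + (1/c)·ln x⁺(t₁+1) one has x⁺(t₂) = 1, x⁺(t) > 1 for all t ∈ (t₁, t₂), and x⁺(t) = x⁺(t₁+1)·e^{−c(t−t₁−1)} for all t ∈ [t₁+1, t₂+1]; moreover x⁺(t) ∈ (0, d/c) for all t ∈ ℝ. (ii) x⁻ is strictly decreasing, x⁻(ℝ) = (0, ξ₁), x⁻(0) = ξ₁ + κ⁻, x⁻(t) → ξ₁ as t → −∞ and x⁻(t) → 0 as t → ∞. -/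
open Real Set Filter Topology MeasureTheory

noncomputable section

/-- The defining properties of `x⁺` in Proposition (leading unstable set of `(E_g)`),
part (i). Here `t₂ = t₁ + 1 + (1/c)·ln x⁺(t₁+1)`. -/
def XPlusSpec (c d ξ₁ κp : ℝ) (g x : ℝ → ℝ) : Prop :=
  IsSolR c d g x ∧ x 0 = ξ₁ + κp ∧ ξ₁ + κp < 1 ∧
  Tendsto x atBot (nhds ξ₁) ∧ (∀ t : ℝ, x t ∈ Ioo 0 (d / c)) ∧
  ∃ t₁ : ℝ, 0 < t₁ ∧ x t₁ = 1 ∧ StrictMonoOn x (Iic (t₁ + 1)) ∧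
    (∀ t' : ℝ, 0 < t' → x t' = 1 → StrictMonoOn x (Iic (t' + 1)) → t' = t₁) ∧
    x (t₁ + 1 + (1 / c) * Real.log (x (t₁ + 1))) = 1 ∧
    (∀ t ∈ Ioo t₁ (t₁ + 1 + (1 / c) * Real.log (x (t₁ + 1))), 1 < x t) ∧
    (∀ t ∈ Icc (t₁ + 1) (t₁ + 1 + (1 / c) * Real.log (x (t₁ + 1)) + 1),
      x t = x (t₁ + 1) * Real.exp (-c * (t - t₁ - 1)))

/-- The defining properties of `x⁻`, part (ii). -/
def XMinusSpec (c d ξ₁ κm : ℝ) (g x : ℝ → ℝ) : Prop :=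
  IsSolR c d g x ∧ StrictAnti x ∧ Set.range x = Ioo 0 ξ₁ ∧ x 0 = ξ₁ + κm ∧
  Tendsto x atBot (nhds ξ₁) ∧ Tendsto x atTop (nhds 0)


lemma dde_deriv_exp {c : ℝ} {w : ℝ → ℝ} {t q : ℝ} (h : HasDerivAt w (-c * w t + q) t) :
    HasDerivAt (fun t => Real.exp (c * t) * w t) (Real.exp (c * t) * q) t := by
  have h1 : HasDerivAt (fun t => Real.exp (c * t)) (Real.exp (c * t) * (c * 1)) t :=
    ((hasDerivAt_id t).const_mul c).exp
  exact (h1.mul h).congr_deriv (by ring)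

lemma dde_cmp {c : ℝ} {w q : ℝ → ℝ} {s T : ℝ} (hw : Continuous w)
    (h0 : ∀ t, s - 1 ≤ t → t ≤ s → 0 ≤ w t)
    (hd : ∀ t, s < t → t < T → HasDerivAt w (-c * w t + q t) t)
    (hq : ∀ t, s < t → t < T → 0 ≤ w (t - 1) → 0 ≤ q t) :
    ∀ t, s - 1 ≤ t → t ≤ T → 0 ≤ w t := by
  have key : ∀ n : ℕ, ∀ t, s - 1 ≤ t → t ≤ T → t ≤ s + n → 0 ≤ w t := by
    intro n
    induction n with
    | zero => intro t h1 _ h3; exact h0 t h1 (by simpa using h3)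
    | succ n ih =>
      intro t h1 h2 h3
      push_cast at h3
      rcases le_or_gt t s with h | h
      · exact h0 t h1 h
      have hm : MonotoneOn (fun t => Real.exp (c * t) * w t) (Icc s t) := by
        apply monotoneOn_of_deriv_nonneg (convex_Icc s t)
        · exact Continuous.continuousOn (by fun_prop)
        · intro r hr
          rw [interior_Icc] at hr
          exact (dde_deriv_exp (hd r hr.1 (by linarith [hr.2]))).differentiableAt.differentiableWithinAt
        · intro r hr
          rw [interior_Icc] at hr
          rw [(dde_deriv_exp (hd r hr.1 (by linarith [hr.2]))).deriv]
          have := hq r hr.1 (by linarith [hr.2]) (ih _ (by linarith [hr.1]) (by linarith [hr.2]) (by linarith [hr.2]))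
          positivity
      have h4 := hm (left_mem_Icc.2 h.le) (right_mem_Icc.2 h.le) h.le
      have h5 : 0 ≤ w s := h0 s (by linarith) le_rfl
      have h6 : 0 ≤ Real.exp (c * t) * w t := le_trans (by positivity) h4
      exact nonneg_of_mul_nonneg_right h6 (Real.exp_pos _)
  intro t h1 h2
  obtain ⟨n, hn⟩ := exists_nat_ge (t - s)
  exact key n t h1 h2 (by linarith)

/-- integral form gives derivative -/
lemma dde_hasDeriv {c : ℝ} {x q : ℝ → ℝ} {τ t : ℝ} (hq : Continuous q)
    (h : ∀ᶠ r in 𝓝 t, Real.exp (c * r) * x r = Real.exp (c * τ) * x τ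
        + ∫ s in τ..r, Real.exp (c * s) * q s) :
    HasDerivAt x (-c * x t + q t) t := by
  have h1 : HasDerivAt (fun r => ∫ s in τ..r, Real.exp (c * s) * q s) (Real.exp (c * t) * q t) t :=
    intervalIntegral.integral_hasDerivAt_right (Continuous.intervalIntegrable (by fun_prop) _ _)
      (Continuous.stronglyMeasurableAtFilter (by fun_prop) _ _) (Continuous.continuousAt (by fun_prop))
  have h2 : HasDerivAt (fun r => Real.exp (-c * r)) (Real.exp (-c * t) * (-c * 1)) t :=
    ((hasDerivAt_id t).const_mul (-c)).exp
  have h3 := h2.mul (h1.const_add (Real.exp (c * τ) * x τ))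
  have ee : ∀ r, Real.exp (-c * r) * Real.exp (c * r) = 1 := by
    intro r; rw [← Real.exp_add]; simp
  have hev : ∀ᶠ r in 𝓝 t, x r = Real.exp (-c * r) * (Real.exp (c * τ) * x τ
        + ∫ s in τ..r, Real.exp (c * s) * q s) := by
    filter_upwards [h] with r hr
    rw [← hr, ← mul_assoc, ee, one_mul]
  refine (h3.congr_of_eventuallyEq hev).congr_deriv ?_
  have h4 := h.self_of_nhds
  rw [← h4]
  linear_combination (-c * x t + q t) * ee t

lemma dde_integral {c : ℝ} {x q : ℝ → ℝ} {τ t : ℝ} (hτ : τ ≤ t) (hx : Continuous x)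
    (hq : Continuous q)
    (h : ∀ r, τ < r → r < t → HasDerivAt x (-c * x r + q r) r) :
    Real.exp (c * t) * x t = Real.exp (c * τ) * x τ
        + ∫ s in τ..t, Real.exp (c * s) * q s := by
  have := intervalIntegral.integral_eq_sub_of_hasDerivAt_of_le hτ
    (f := fun t => Real.exp (c * t) * x t) (f' := fun s => Real.exp (c * s) * q s)
    (Continuous.continuousOn (by fun_prop)) (fun r hr => dde_deriv_exp (h r hr.1 hr.2))
    (Continuous.intervalIntegrable (by fun_prop) _ _)
  rw [this]; ring

/-- forward existence by steps -/
lemma dde_forward (c d T : ℝ) (F φ : ℝ → ℝ) (hF : Measurable F) (M : ℝ) (hM : ∀ u, |F u| ≤ M)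
    (hφ : Continuous φ) :
    ∃ x : ℝ → ℝ, Continuous x ∧ (∀ t ≤ T, x t = φ t) ∧
      ∀ τ t, T ≤ τ → τ ≤ t →
        IntervalIntegrable (fun s => Real.exp (c * s) * F (x (s - 1))) volume τ t ∧
        Real.exp (c * t) * x t = Real.exp (c * τ) * x τ
          + d * ∫ s in τ..t, Real.exp (c * s) * F (x (s - 1)) := by
  have hint : ∀ x : ℝ → ℝ, Continuous x → ∀ a b,
      IntervalIntegrable (fun s => Real.exp (c * s) * F (x (s - 1))) volume a b := by
    intro x hx a b
    have h1 : IntervalIntegrable (fun s => F (x (s - 1))) volume a b := by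
      refine (intervalIntegrable_const (c := M)).mono_fun ?_ ?_
      · exact (hF.comp (hx.measurable.comp (measurable_id.sub_const 1))).aestronglyMeasurable
      · refine Eventually.of_forall fun s => ?_
        simp only [Real.norm_eq_abs]
        exact (hM _).trans (le_abs_self M)
    exact h1.continuousOn_mul (Continuous.continuousOn (by fun_prop))
  let P : (ℝ → ℝ) → ℝ → ℝ := fun x t => φ (min t T) - φ T + Real.exp (-c * (max t T)) *
    (Real.exp (c * T) * φ T + d * ∫ s in T..(max t T), Real.exp (c * s) * F (x (s - 1)))
  have ee : ∀ r, Real.exp (-c * r) * Real.exp (c * r) = 1 := by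
    intro r; rw [← Real.exp_add]; simp
  have hPc : ∀ x, Continuous x → Continuous (P x) := by
    intro x hx
    have h1 : Continuous fun r => ∫ s in T..r, Real.exp (c * s) * F (x (s - 1)) :=
      intervalIntegral.continuous_primitive (hint x hx) T
    have h2 : Continuous fun t => ∫ s in T..(max t T), Real.exp (c * s) * F (x (s - 1)) :=
      h1.comp (continuous_id.max continuous_const)
    simp only [P]
    fun_prop
  have hPl : ∀ x, ∀ t ≤ T, P x t = φ t := by
    intro x t ht
    simp only [P, min_eq_left ht, max_eq_right ht, intervalIntegral.integral_same]
    linear_combination (φ T) * ee T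
  have hPe : ∀ x y : ℝ → ℝ, ∀ r, (∀ t ≤ r, x t = y t) → ∀ t ≤ r + 1, P x t = P y t := by
    intro x y r hxy t ht
    rcases le_or_gt t T with h | h
    · rw [hPl x t h, hPl y t h]
    simp only [P, max_eq_left h.le]
    congr 4
    apply intervalIntegral.integral_congr
    intro s hs
    rw [uIcc_of_le h.le] at hs
    simp only
    rw [hxy (s - 1) (by linarith [hs.2])]
  let X : ℕ → ℝ → ℝ := fun n => P^[n] φ
  have hXs : ∀ n, X (n + 1) = P (X n) := fun n => Function.iterate_succ_apply' P n φ
  have hXc : ∀ n, Continuous (X n) := by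
    intro n
    induction n with
    | zero => exact hφ
    | succ n ih => rw [hXs]; exact hPc _ ih
  have hX1 : ∀ n : ℕ, ∀ t ≤ T + n, X (n + 1) t = X n t := by
    intro n
    induction n with
    | zero => intro t ht; rw [hXs]; exact hPl _ t (by simpa using ht)
    | succ n ih =>
      intro t ht
      rw [hXs (n + 1), hXs n]
      rw [hXs n] at ih
      have := hPe _ _ _ ih t (by push_cast at ht; linarith)
      exact this
  have hX2 : ∀ n m : ℕ, ∀ t ≤ T + n, X (n + m) t = X n t := by
    intro n m
    induction m with
    | zero => intro t _; rfl
    | succ m ih =>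
      intro t ht
      rw [← ih t ht]
      exact hX1 (n + m) t (by push_cast; have : (0:ℝ) ≤ m := by positivity
                              linarith)
  let x : ℝ → ℝ := fun t => X ⌈t - T⌉₊ t
  have hx : ∀ n : ℕ, ∀ t ≤ T + n, x t = X n t := by
    intro n t ht
    have h1 : ⌈t - T⌉₊ ≤ n := Nat.ceil_le.2 (by linarith)
    obtain ⟨m, rfl⟩ := Nat.exists_eq_add_of_le h1
    exact (hX2 _ m t (by linarith [Nat.le_ceil (t - T)])).symm
  have hxc : Continuous x := by
    rw [continuous_iff_continuousAt]
    intro t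
    obtain ⟨n, hn⟩ := exists_nat_gt (t - T)
    refine ((hXc n).continuousAt (x := t)).congr ?_
    filter_upwards [Iio_mem_nhds (show t < T + n by linarith)] with r hr
    exact (hx n r (le_of_lt hr)).symm
  have hxP : ∀ t, x t = P x t := by
    intro t
    obtain ⟨n, hn⟩ := exists_nat_gt (t - T)
    rw [hx (n + 1) t (by push_cast; linarith), hXs]
    refine (hPe _ _ (T + n) (fun r hr => hx n r hr) t (by linarith)).symm
  refine ⟨x, hxc, fun t ht => by rw [hxP, hPl x t ht], ?_⟩
  have hf : ∀ t, T ≤ t → Real.exp (c * t) * x t = Real.exp (c * T) * φ T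
      + d * ∫ s in T..t, Real.exp (c * s) * F (x (s - 1)) := by
    intro t ht
    rw [hxP]
    simp only [P, min_eq_right ht, max_eq_left ht]
    linear_combination (Real.exp (c * T) * φ T
      + d * ∫ s in T..t, Real.exp (c * s) * F (x (s - 1))) * ee t
  intro τ t h1 h2
  refine ⟨hint x hxc _ _, ?_⟩
  rw [hf t (h1.trans h2), hf τ h1, ← intervalIntegral.integral_add_adjacent_intervals
    (hint x hxc T τ) (hint x hxc τ t)]
  ring


/-- limits are equilibria -/
lemma dde_equil {c : ℝ} {H y : ℝ → ℝ} {l : Filter ℝ} [l.NeBot] {L : ℝ} (hH : Continuous H)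
    (hl : ∀ a : ℝ, Tendsto (fun t => t + a) l l)
    (hl' : ∀ ξ : ℝ → ℝ, (∀ᶠ t in l, t ≤ ξ t ∧ ξ t ≤ t + 1) → Tendsto ξ l l)
    (hd : ∀ᶠ t in l, ∀ r, t ≤ r → r ≤ t + 1 → HasDerivAt y (-c * y r + H (y (r - 1))) r)
    (hy : Tendsto y l (𝓝 L)) : H L = c * L := by
  have h1 : ∀ t, ∃ ξ, (∀ r, t ≤ r → r ≤ t + 1 → HasDerivAt y (-c * y r + H (y (r - 1))) r) →
      (t ≤ ξ ∧ ξ ≤ t + 1 ∧ y (t + 1) - y t = -c * y ξ + H (y (ξ - 1))) := by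
    intro t
    by_cases h : (∀ r, t ≤ r → r ≤ t + 1 → HasDerivAt y (-c * y r + H (y (r - 1))) r)
    · obtain ⟨ξ, hξ, he⟩ := exists_hasDerivAt_eq_slope y (fun r => -c * y r + H (y (r - 1)))
        (show t < t + 1 by linarith)
        (fun r hr => (h r hr.1 hr.2).continuousAt.continuousWithinAt)
        (fun r hr => h r hr.1.le hr.2.le)
      refine ⟨ξ, fun _ => ⟨hξ.1.le, hξ.2.le, ?_⟩⟩
      rw [he]; ring
    · exact ⟨0, fun h' => absurd h' h⟩
  choose ξ hξ using h1
  have h2 : Tendsto ξ l l := hl' ξ (hd.mono fun t ht => ⟨(hξ t ht).1, (hξ t ht).2.1⟩)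
  have h3 : Tendsto (fun t => y (t + 1) - y t) l (𝓝 (L - L)) := (hy.comp (hl 1)).sub hy
  have h4 : Tendsto (fun t => -c * y (ξ t) + H (y (ξ t - 1))) l (𝓝 (-c * L + H L)) := by
    refine ((hy.comp h2).const_mul (-c)).add ((hH.tendsto L).comp ?_)
    exact hy.comp ((hl (-1)).comp h2)
  have h5 := h4.congr' (f₂ := fun t => y (t + 1) - y t) (hd.mono fun t ht => ((hξ t ht).2.2).symm)
  have := tendsto_nhds_unique h3 h5
  linarith

lemma dde_equil_top {c : ℝ} {H y : ℝ → ℝ} {L T : ℝ} (hH : Continuous H)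
    (hd : ∀ t, T < t → HasDerivAt y (-c * y t + H (y (t - 1))) t)
    (hy : Tendsto y atTop (𝓝 L)) : H L = c * L := by
  refine dde_equil hH (fun a => tendsto_atTop_add_const_right _ a tendsto_id) ?_ ?_ hy
  · intro ξ h
    exact tendsto_atTop_mono' _ (h.mono fun t ht => ht.1) tendsto_id
  · filter_upwards [eventually_gt_atTop T] with t ht r h1 _
    exact hd r (by linarith)

lemma dde_equil_bot {c : ℝ} {H y : ℝ → ℝ} {L T : ℝ} (hH : Continuous H)
    (hd : ∀ t, t < T → HasDerivAt y (-c * y t + H (y (t - 1))) t)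
    (hy : Tendsto y atBot (𝓝 L)) : H L = c * L := by
  refine dde_equil hH (fun a => tendsto_atBot_add_const_right _ a tendsto_id) ?_ ?_ hy
  · intro ξ h
    exact tendsto_atBot_mono' _ (h.mono fun t ht => ht.2)
      (tendsto_atBot_add_const_right _ 1 tendsto_id)
  · filter_upwards [eventually_lt_atBot (T - 1)] with t ht r _ h2
    exact hd r (by linarith)

/-- approximate solutions -/
lemma dde_approx {c κ K B : ℝ} {H : ℝ → ℝ} (hc : 0 < c) (hκ : 0 < κ)
    (hK : 0 ≤ K) (hLip : ∀ u v, |H u - H v| ≤ K * |u - v|) (hmono : Monotone H)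
    (hneg : ∀ u ≤ 0, H u = 0) (hpos : ∀ u, 0 < u → u ≤ κ → c * u < H u)
    (hB : ∀ u, H u ≤ c * B) (hκB : κ ≤ B) (N : ℝ) (hN : 0 ≤ N) :
    ∃ y : ℝ → ℝ, Continuous y ∧ Monotone y ∧ y 0 = κ ∧ (∀ t, 0 ≤ y t ∧ y t ≤ B) ∧
      ∀ t, -N < t → HasDerivAt y (-c * y t + H (y (t - 1))) t := by
  have hHc : Continuous H := by
    refine (LipschitzWith.of_dist_le_mul (K := ⟨K, hK⟩) ?_).continuous
    intro u v; rw [Real.dist_eq, Real.dist_eq]; exact hLip u v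
  have hH0 : ∀ u, 0 ≤ H u := by
    intro u
    rcases le_total u 0 with h | h
    · rw [hneg u h]
    · rw [← hneg 0 le_rfl]; exact hmono h
  set ε : ℝ := κ * Real.exp (-(K * (N + 1))) / 2 with hε
  have he1 : Real.exp (-(K * (N + 1))) ≤ 1 := Real.exp_le_one_iff.2 (by nlinarith)
  have hεp : 0 < ε := by positivity
  have hεκ : ε < κ := by rw [hε]; nlinarith [Real.exp_pos (-(K * (N + 1)))]
  obtain ⟨y, hyc, hy0, hyI⟩ := dde_forward c 1 0 H (fun _ => ε) hHc.measurable (c * B)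
    (fun u => by rw [abs_of_nonneg (hH0 u)]; exact hB u) continuous_const
  have hyd : ∀ t, 0 < t → HasDerivAt y (-c * y t + H (y (t - 1))) t := by
    intro t ht
    refine dde_hasDeriv (τ := 0) (q := fun t => H (y (t - 1))) (by fun_prop) ?_
    filter_upwards [Ioi_mem_nhds ht] with r hr
    simpa using (hyI 0 r le_rfl (le_of_lt hr)).2
  have hyε : ∀ t, ε ≤ y t := by
    intro t
    rcases le_or_gt t 0 with h | h
    · rw [hy0 t h]
    have := dde_cmp (c := c) (w := fun t => y t - ε) (q := fun t => H (y (t - 1)) - c * ε) (s := 0) (T := t)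
      (by fun_prop) (fun r _ hr => by simp [hy0 r hr])
      (fun r hr _ => ((hyd r hr).sub_const ε).congr_deriv (by ring))
      (fun r _ _ h1 => by
        have := hmono (sub_nonneg.1 h1)
        have := hpos ε hεp hεκ.le
        linarith) t (by linarith) le_rfl
    simpa using this
  have hyB : ∀ t, y t ≤ B := by
    intro t
    rcases le_or_gt t 0 with h | h
    · rw [hy0 t h]; linarith
    have := dde_cmp (c := c) (w := fun t => B - y t) (q := fun t => c * B - H (y (t - 1))) (s := 0) (T := t)
      (by fun_prop) (fun r _ hr => by simp only [hy0 r hr]; linarith)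
      (fun r hr _ => ((hyd r hr).const_sub B).congr_deriv (by ring))
      (fun r _ _ h1 => by linarith [hB (y (r - 1))]) t (by linarith) le_rfl
    simpa using this
  have hym : Monotone y := by
    intro a b hab
    rcases hab.eq_or_lt with rfl | hab
    · exact le_rfl
    rcases le_or_gt a 0 with h | h
    · rw [hy0 a h]; exact hyε b
    have := dde_cmp (c := c) (w := fun t => y (t + (b - a)) - y t)
      (q := fun t => H (y (t + (b - a) - 1)) - H (y (t - 1))) (s := 0) (T := a)
      (by fun_prop) (fun r _ hr => by simp only [hy0 r hr]; linarith [hyε (r + (b - a))])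
      (fun r hr _ => by
        have h1 : HasDerivAt (fun t => y (t + (b - a))) _ r :=
          (hyd (r + (b - a)) (by linarith)).comp_add_const r (b - a)
        exact (h1.sub (hyd r hr)).congr_deriv (by ring))
      (fun r _ _ h1 => by
        have h2 : y (r - 1) ≤ y (r + (b - a) - 1) := by
          rw [show r + (b - a) - 1 = r - 1 + (b - a) by ring]; linarith
        linarith [hmono h2]) a (by linarith) le_rfl
    have h3 : a + (b - a) = b := by ring
    simp only [h3] at this
    linarith
  have hyN : y N < κ := by
    rcases hN.eq_or_lt with rfl | hN'
    · rw [hy0 0 le_rfl]; exact hεκ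
    have := dde_cmp (c := c) (w := fun t => ε * Real.exp (K * (t + 1)) - y t)
      (q := fun t => (K + c) * (ε * Real.exp (K * (t + 1))) - H (y (t - 1))) (s := 0) (T := N)
      (by fun_prop) (fun r h1 hr => by
        simp only [hy0 r hr]
        have : 1 ≤ Real.exp (K * (r + 1)) := Real.one_le_exp (by apply mul_nonneg hK; linarith)
        nlinarith)
      (fun r hr _ => by
        have h1 : HasDerivAt (fun t => Real.exp (K * (t + 1))) (Real.exp (K * (r + 1)) * (K * 1)) r :=
          (((hasDerivAt_id r).add_const 1).const_mul K).exp
        exact ((h1.const_mul ε).sub (hyd r hr)).congr_deriv (by ring))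
      (fun r _ _ h1 => by
        have h2 := hLip (y (r - 1)) 0
        rw [hneg 0 le_rfl, sub_zero, sub_zero, abs_of_nonneg (hH0 _),
          abs_of_nonneg (hεp.le.trans (hyε _))] at h2
        have h3 : Real.exp (K * (r - 1 + 1)) ≤ Real.exp (K * (r + 1)) :=
          Real.exp_le_exp.2 (by nlinarith)
        have h4 : y (r - 1) ≤ ε * Real.exp (K * (r + 1)) := by nlinarith
        have h5 : 0 ≤ c * (ε * Real.exp (K * (r + 1))) := by positivity
        nlinarith [mul_le_mul_of_nonneg_left h4 hK]) N (by linarith) le_rfl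
    have h2 : ε * Real.exp (K * (N + 1)) = κ / 2 := by
      rw [hε]
      have : Real.exp (-(K * (N + 1))) * Real.exp (K * (N + 1)) = 1 := by
        rw [← Real.exp_add]; simp
      linear_combination κ / 2 * this
    linarith
  have hreach : ∃ t, κ ≤ y t := by
    by_contra! hcon
    have hbd : BddAbove (range y) := ⟨κ, by rintro _ ⟨t, rfl⟩; exact (hcon t).le⟩
    have hlim := tendsto_atTop_ciSup hym hbd
    have h1 := dde_equil_top hHc hyd hlim
    have h2 : ε ≤ ⨆ i, y i := (hyε 0).trans (le_ciSup hbd 0)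
    have h3 : ⨆ i, y i ≤ κ := ciSup_le fun t => (hcon t).le
    linarith [hpos _ (hεp.trans_le h2) h3]
  obtain ⟨t1, ht1⟩ := hreach
  obtain ⟨T, hT⟩ : ∃ T, y T = κ := by
    have := mem_range_of_exists_le_of_exists_ge hyc ⟨0, by rw [hy0 0 le_rfl]; exact hεκ.le⟩ ⟨t1, ht1⟩
    exact this
  have hTN : N ≤ T := by
    by_contra! h
    have := hym h.le
    linarith
  refine ⟨fun t => y (t + T), by fun_prop, fun a b hab => hym (by linarith), by simpa using hT,
    fun t => ⟨hεp.le.trans (hyε _), hyB _⟩, ?_⟩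
  intro t ht
  have h1 := (hyd (t + T) (by linarith)).comp_add_const t T
  rw [show t + T - 1 = t - 1 + T by ring] at h1
  exact h1

/-- entire solution -/
lemma dde_entire {c κ K B : ℝ} {H : ℝ → ℝ} (hc : 0 < c) (hκ : 0 < κ)
    (hK : 0 ≤ K) (hLip : ∀ u v, |H u - H v| ≤ K * |u - v|) (hmono : Monotone H)
    (hneg : ∀ u ≤ 0, H u = 0) (hpos : ∀ u, 0 < u → u ≤ κ → c * u < H u)
    (hB : ∀ u, H u ≤ c * B) (hκB : κ ≤ B) :
    ∃ y : ℝ → ℝ, Continuous y ∧ StrictMono y ∧ y 0 = κ ∧ (∀ t, 0 < y t ∧ y t < B) ∧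
      Tendsto y atBot (𝓝 0) ∧
      ∀ t, HasDerivAt y (-c * y t + H (y (t - 1))) t := by
  have hHc : Continuous H := by
    refine (LipschitzWith.of_dist_le_mul (K := ⟨K, hK⟩) ?_).continuous
    intro u v; rw [Real.dist_eq, Real.dist_eq]; exact hLip u v
  have hH0 : ∀ u, 0 ≤ H u := by
    intro u
    rcases le_total u 0 with h | h
    · rw [hneg u h]
    · rw [← hneg 0 le_rfl]; exact hmono h
  have hB0 : 0 ≤ c * B := (hH0 0).trans (hB 0)
  choose Y hYc hYm hY0 hYb hYd using fun n : ℕ =>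
    dde_approx hc hκ hK hLip hmono hneg hpos hB hκB (n : ℝ) (Nat.cast_nonneg n)
  have hlim : ∀ t, ∃ v ∈ Icc 0 B, Tendsto (fun n => Y n t) (hyperfilter ℕ : Filter ℕ) (𝓝 v) := by
    intro t
    obtain ⟨v, hv, h⟩ := isCompact_Icc.ultrafilter_le_nhds ((hyperfilter ℕ).map (fun n => Y n t))
      (s := Icc 0 B) (by
        rw [le_principal_iff]
        exact Filter.mem_map.2 (univ_mem' fun n => (hYb n t)))
    exact ⟨v, hv, h⟩
  choose y hyb hyl using hlim
  have hym : Monotone y := fun a b hab =>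
    le_of_tendsto_of_tendsto' (hyl a) (hyl b) (fun n => hYm n hab)
  have hy0 : y 0 = κ := tendsto_nhds_unique (hyl 0) (by simp only [hY0]; exact tendsto_const_nhds)
  -- derivative bounds
  have hev : ∀ N : ℝ, ∀ᶠ n : ℕ in (hyperfilter ℕ : Filter ℕ), N < (n : ℝ) := fun N =>
    (Nat.hyperfilter_le_atTop) (tendsto_natCast_atTop_atTop.eventually_gt_atTop N)
  set D : ℝ := c * B with hD
  have hder : ∀ (n : ℕ) t, -(n:ℝ) < t → |(-c * Y n t + H (Y n (t - 1)))| ≤ D := by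
    intro n t _
    have h1 := hYb n t
    have h2 := hH0 (Y n (t - 1))
    have h3 := hB (Y n (t - 1))
    rw [abs_le]
    constructor <;> nlinarith
  have hlipY : ∀ (n : ℕ) a b, -(n:ℝ) < a → -(n:ℝ) < b → |Y n b - Y n a| ≤ D * |b - a| := by
    intro n a b ha hb
    have := (convex_Ioi (-(n:ℝ))).norm_image_sub_le_of_norm_hasDerivWithin_le
      (f := Y n) (f' := fun t => (-c * Y n t + H (Y n (t - 1)))) (C := D)
      (fun t ht => (hYd n t ht).hasDerivWithinAt) (fun t ht => hder n t ht) ha hb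
    simpa [Real.norm_eq_abs] using this
  set C : ℝ := (c + K) * D with hC
  have hquad : ∀ (n : ℕ) a b, -(n:ℝ) + 1 < a → -(n:ℝ) + 1 < b →
      |Y n b - Y n a - (b - a) * (-c * Y n a + H (Y n (a - 1)))| ≤ C * |b - a| * |b - a| := by
    intro n a b ha hb
    have := (convex_uIcc a b).norm_image_sub_le_of_norm_hasDerivWithin_le
      (f := fun t => Y n t - t * (-c * Y n a + H (Y n (a - 1))))
      (f' := fun t => (-c * Y n t + H (Y n (t - 1))) - 1 * (-c * Y n a + H (Y n (a - 1))))
      (C := C * |b - a|) (x := a) (y := b)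
      (fun t ht => by
        have ht' : -(n:ℝ) + 1 < t := by
          rcases le_total a b with h | h
          · rw [uIcc_of_le h] at ht; linarith [ht.1]
          · rw [uIcc_of_ge h] at ht; linarith [ht.1]
        exact ((hYd n t (by linarith)).sub ((hasDerivAt_id t).mul_const _)).hasDerivWithinAt)
      (fun t ht => by
        have ht' : -(n:ℝ) + 1 < t := by
          rcases le_total a b with h | h
          · rw [uIcc_of_le h] at ht; linarith [ht.1]
          · rw [uIcc_of_ge h] at ht; linarith [ht.1]
        have hta : |t - a| ≤ |b - a| := abs_sub_left_of_mem_uIcc ht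
        have h1 := hlipY n a t (by linarith) (by linarith)
        have h2 := hlipY n (a - 1) (t - 1) (by linarith) (by linarith)
        have h3 := hLip (Y n (t - 1)) (Y n (a - 1))
        rw [show t - 1 - (a - 1) = t - a by ring] at h2
        rw [Real.norm_eq_abs]
        calc _ = |-c * (Y n t - Y n a) + (H (Y n (t - 1)) - H (Y n (a - 1)))| := by
              congr 1; ring
          _ ≤ |-c * (Y n t - Y n a)| + |(H (Y n (t - 1)) - H (Y n (a - 1)))| := abs_add_le _ _
          _ ≤ c * (D * |t - a|) + K * (D * |t - a|) := by
              rw [abs_mul, abs_neg, abs_of_pos hc]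
              exact add_le_add (mul_le_mul_of_nonneg_left h1 hc.le)
                (h3.trans (mul_le_mul_of_nonneg_left h2 hK))
          _ = C * |t - a| := by rw [hC]; ring
          _ ≤ C * |b - a| := mul_le_mul_of_nonneg_left hta (by positivity))
      left_mem_uIcc right_mem_uIcc
    rw [Real.norm_eq_abs, Real.norm_eq_abs] at this
    convert this using 2
    ring
  have hquadL : ∀ a b, |y b - y a - (b - a) * (-c * y a + H (y (a - 1)))| ≤ C * |b - a| * |b - a| := by
    intro a b
    have h1 : Tendsto (fun n => |Y n b - Y n a - (b - a) * (-c * Y n a + H (Y n (a - 1)))|)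
        (hyperfilter ℕ : Filter ℕ) (𝓝 |y b - y a - (b - a) * (-c * y a + H (y (a - 1)))|) := by
      refine Tendsto.abs ?_
      refine ((hyl b).sub (hyl a)).sub (Tendsto.const_mul _ ?_)
      exact ((hyl a).const_mul _).add ((hHc.tendsto _).comp (hyl (a - 1)))
    refine le_of_tendsto h1 ?_
    filter_upwards [hev (1 - a), hev (1 - b)] with n hn1 hn2
    exact hquad n a b (by linarith) (by linarith)
  have hyd : ∀ t, HasDerivAt y (-c * y t + H (y (t - 1))) t := by
    intro t
    rw [hasDerivAt_iff_isLittleO]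
    have h1 : (fun b => y b - y t - (b - t) • (-c * y t + H (y (t - 1)))) =O[𝓝 t]
        fun b => (b - t) * (b - t) := by
      refine Asymptotics.IsBigO.of_bound C (Eventually.of_forall fun b => ?_)
      simp only [smul_eq_mul, Real.norm_eq_abs, abs_mul]
      have := hquadL t b
      linarith
    refine h1.trans_isLittleO ?_
    have h2 : (fun b : ℝ => b - t) =o[𝓝 t] fun _ => (1:ℝ) := by
      rw [Asymptotics.isLittleO_one_iff]
      have : Tendsto (fun b : ℝ => b - t) (𝓝 t) (𝓝 (t - t)) := Continuous.tendsto (by fun_prop) t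
      simpa using this
    simpa using h2.mul_isBigO (Asymptotics.isBigO_refl (fun b : ℝ => b - t) (𝓝 t))
  have hyc : Continuous y := continuous_iff_continuousAt.2 fun t => (hyd t).continuousAt
  have hbd : BddBelow (range y) := ⟨0, by rintro _ ⟨t, rfl⟩; exact (hyb t).1⟩
  have hlim0 := tendsto_atBot_ciInf hym hbd
  have hinf : ⨅ i, y i = 0 := by
    have h1 := dde_equil_bot (T := 0) hHc (fun t _ => hyd t) hlim0
    have h2 : 0 ≤ ⨅ i, y i := le_ciInf fun t => (hyb t).1
    have h3 : ⨅ i, y i ≤ κ := hy0 ▸ ciInf_le hbd 0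
    rcases h2.eq_or_lt with h | h
    · exact h.symm
    · linarith [hpos _ h h3]
  rw [hinf] at hlim0
  have hyp : ∀ t, 0 < y t := by
    intro t
    by_contra! ht
    have h0 : t < 0 := by
      by_contra! h
      have := hym h
      linarith
    have := dde_cmp (c := c) (w := fun t => - y t) (q := fun r => - H (y (r - 1))) (s := t) (T := 0)
      (by fun_prop) (fun r _ hr => by linarith [hym hr])
      (fun r _ _ => (hyd r).neg.congr_deriv (by ring))
      (fun r _ _ h1 => by rw [hneg _ (by linarith)]; simp) 0 (by linarith) le_rfl
    linarith
  have hys : StrictMono y := by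
    intro a b hab
    refine lt_of_le_of_ne (hym hab.le) fun heq => ?_
    -- w s = y (s + δ) - y s vanishes for s ≤ a
    have hw : ∀ s ≤ a, y (s + (b - a)) = y s := by
      intro s hs
      have hm : MonotoneOn (fun t => Real.exp (c * t) * (y (t + (b - a)) - y t)) (Icc s a) := by
        have hdw : ∀ r, HasDerivAt (fun t => Real.exp (c * t) * (y (t + (b - a)) - y t))
            (Real.exp (c * r) * (H (y (r + (b - a) - 1)) - H (y (r - 1)))) r := by
          intro r
          have h1 := (hyd (r + (b - a))).comp_add_const r (b - a)
          exact dde_deriv_exp (w := fun t => y (t + (b - a)) - y t)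
            ((h1.sub (hyd r)).congr_deriv (by ring))
        apply monotoneOn_of_deriv_nonneg (convex_Icc s a)
        · exact Continuous.continuousOn (by fun_prop)
        · intro r _
          exact (hdw r).differentiableAt.differentiableWithinAt
        · intro r _
          rw [(hdw r).deriv]
          have : 0 ≤ H (y (r + (b - a) - 1)) - H (y (r - 1)) :=
            sub_nonneg.2 (hmono (hym (by linarith)))
          positivity
      have h4 := hm (left_mem_Icc.2 hs) (right_mem_Icc.2 hs) hs
      simp only [show a + (b - a) = b by ring, heq, sub_self, mul_zero] at h4
      have h5 : y (s + (b - a)) - y s ≤ 0 := by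
        by_contra! h
        have : 0 < Real.exp (c * s) * (y (s + (b - a)) - y s) := by positivity
        linarith
      linarith [hym (show s ≤ s + (b - a) by linarith)]
    have hn : ∀ n : ℕ, y (a - n * (b - a)) = y a := by
      intro n
      induction n with
      | zero => simp
      | succ n ih =>
        rw [← ih, ← hw (a - (n + 1 : ℕ) * (b - a)) (by
          have : 0 ≤ ((n + 1 : ℕ) : ℝ) * (b - a) := mul_nonneg (Nat.cast_nonneg _) (by linarith)
          linarith)]
        congr 1; push_cast; ring
    have ht : Tendsto (fun n : ℕ => a - n * (b - a)) atTop atBot := by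
      have : Tendsto (fun n : ℕ => (n : ℝ) * (b - a)) atTop atTop :=
        tendsto_natCast_atTop_atTop.atTop_mul_const (by linarith)
      simpa [sub_eq_add_neg] using tendsto_atBot_add_const_left _ a (tendsto_neg_atTop_atBot.comp this)
    have h6 := hlim0.comp ht
    have h7 : Tendsto (fun _ : ℕ => y a) atTop (𝓝 0) := h6.congr fun n => hn n
    have := tendsto_nhds_unique h7 tendsto_const_nhds
    linarith [hyp a]
  exact ⟨y, hyc, hys, hy0, fun t => ⟨hyp t, (hys (show t < t + 1 by linarith)).trans_le (hyb _).2⟩,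
    hlim0, hyd⟩


lemma dde_window {v v' : ℝ → ℝ} {W A : ℝ} (hA : 0 ≤ A) (hd : ∀ t < 0, HasDerivAt v (v' t) t)
    (h1 : ∀ ε > 0, ∀ᶠ t in atBot, W - ε ≤ v t ∧ -A * (v t - (W - ε)) ≤ v' t)
    (h2 : ∀ ε > 0, ∃ᶠ t in atBot, v t < W + ε) :
    ∀ ε > 0, ∃ᶠ t in atBot, ∀ s, t - 1 ≤ s → s ≤ t → |v s - W| < ε := by
  intro ε hε
  set e : ℝ := ε / (4 * Real.exp A) with he
  have hep : 0 < e := by positivity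
  have hA1 : 1 ≤ Real.exp A := Real.one_le_exp hA
  have hee : Real.exp A * (4 * e) = ε := by rw [he]; field_simp
  have heε : e < ε := by nlinarith
  obtain ⟨T, hT⟩ := eventually_atBot.1 (h1 e hep)
  refine ((h2 e hep).and_eventually (eventually_lt_atBot (min T 0))).mono ?_
  rintro t ⟨hvt, htT⟩ s hs1 hs2
  have htT1 : t < T := htT.trans_le (min_le_left _ _)
  have ht0 : t < 0 := htT.trans_le (min_le_right _ _)
  have hdw : ∀ r, r ≤ t → HasDerivAt (fun r => Real.exp (A * r) * (v r - (W - e)))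
      (Real.exp (A * r) * (v' r + A * (v r - (W - e)))) r := by
    intro r hr
    refine dde_deriv_exp (w := fun r => v r - (W - e)) ?_
    exact ((hd r (by linarith)).sub_const _).congr_deriv (by ring)
  have hm : MonotoneOn (fun r => Real.exp (A * r) * (v r - (W - e))) (Icc s t) := by
    apply monotoneOn_of_deriv_nonneg (convex_Icc s t)
    · intro r hr
      exact (hdw r hr.2).continuousAt.continuousWithinAt
    · intro r hr
      rw [interior_Icc] at hr
      exact (hdw r hr.2.le).differentiableAt.differentiableWithinAt
    · intro r hr
      rw [interior_Icc] at hr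
      rw [(hdw r hr.2.le).deriv]
      have := (hT r (by linarith [hr.2])).2
      have h3 : 0 ≤ v' r + A * (v r - (W - e)) := by linarith
      positivity
  have h4 := hm (left_mem_Icc.2 hs2) (right_mem_Icc.2 hs2) hs2
  simp only at h4
  have h5 : v s - (W - e) ≤ Real.exp (A * (t - s)) * (v t - (W - e)) := by
    have e1 : Real.exp (A * t) = Real.exp (A * s) * Real.exp (A * (t - s)) := by
      rw [← Real.exp_add]; congr 1; ring
    rw [e1, mul_assoc] at h4
    exact le_of_mul_le_mul_left h4 (Real.exp_pos _)
  have h6 : Real.exp (A * (t - s)) ≤ Real.exp A := Real.exp_le_exp.2 (by nlinarith)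
  have h7 := (hT t htT1.le).1
  have h8 := (hT s (by linarith)).1
  have h9 : Real.exp (A * (t - s)) * (v t - (W - e)) ≤ Real.exp A * (2 * e) :=
    mul_le_mul h6 (by linarith) (by linarith) (by positivity)
  rw [abs_lt]
  constructor <;> linarith

lemma dde_rate {c b K κ₀ : ℝ} {H H' y : ℝ → ℝ} (hc : 0 < c)
    (hK : 0 ≤ K) (hLip : ∀ u v, |H u - H v| ≤ K * |u - v|) (hb : 0 < b)
    (hneg : ∀ u ≤ 0, H u = 0) (hpos : ∀ u, 0 < u → u < κ₀ → c * u < H u)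
    (hHd : ∀ u, 0 < u → u < κ₀ → HasDerivAt H (H' u) u)
    (hH'b : Tendsto H' (𝓝[>] 0) (𝓝 b)) (hHb : Tendsto (fun u => H u / u) (𝓝[>] 0) (𝓝 b))
    (hyb : ∀ t ≤ 0, 0 < y t ∧ y t < κ₀) (hym : MonotoneOn y (Iic 0))
    (hy0 : Tendsto y atBot (𝓝 0))
    (hyd : ∀ t < 0, HasDerivAt y (-c * y t + H (y (t - 1))) t) :
    ∃ l, l + c = b * Real.exp (-l) ∧
      Tendsto (fun t => (-c * y t + H (y (t - 1))) / y t) atBot (𝓝 l) := by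
  set u : ℝ → ℝ := fun t => (-c * y t + H (y (t - 1))) / y t with hu
  have hyp : ∀ t < 0, HasDerivAt y (y t * u t) t := by
    intro t ht
    refine (hyd t ht).congr_deriv ?_
    have := (hyb t ht.le).1
    rw [hu]; field_simp
  have huc : ∀ t < 0, u t + c = H (y (t - 1)) / y t := by
    intro t ht
    have := (hyb t ht.le).1
    simp only [hu]; field_simp; ring
  have hu0 : ∀ t < 0, 0 ≤ u t := by
    intro t ht
    have h1 := hym.derivWithin_nonneg (x := t)
    rw [derivWithin_of_mem_nhds (Iic_mem_nhds ht), (hyp t ht).deriv] at h1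
    exact nonneg_of_mul_nonneg_right h1 (hyb t ht.le).1
  have huK : ∀ t < 0, u t + c ≤ K := by
    intro t ht
    rw [huc t ht, div_le_iff₀ (hyb t ht.le).1]
    have h1 := hLip (y (t - 1)) 0
    rw [hneg 0 le_rfl, sub_zero, sub_zero, abs_of_pos (hyb (t - 1) (by linarith)).1] at h1
    have h2 : y (t - 1) ≤ y t := hym (mem_Iic.2 (by linarith)) (mem_Iic.2 ht.le) (by linarith)
    calc _ ≤ _ := le_abs_self _
      _ ≤ _ := h1
      _ ≤ _ := mul_le_mul_of_nonneg_left h2 hK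
  have hyw : Tendsto (fun t => y (t - 1)) atBot (𝓝[>] 0) := by
    refine tendsto_nhdsWithin_iff.2 ⟨hy0.comp (tendsto_atBot_add_const_right _ (-1) tendsto_id), ?_⟩
    filter_upwards [eventually_lt_atBot (0:ℝ)] with t ht
    exact (hyb (t - 1) (by linarith)).1
  set η : ℝ → ℝ := fun t => H' (y (t - 1)) / (H (y (t - 1)) / y (t - 1)) with hη
  have hη1 : Tendsto η atBot (𝓝 1) := by
    have := (hH'b.comp hyw).div (hHb.comp hyw) hb.ne'
    rw [div_self hb.ne'] at this
    exact this
  have hud : ∀ t < 0, HasDerivAt u ((u t + c) * (η t * u (t - 1) - u t)) t := by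
    intro t ht
    have hy1 := hyb t ht.le
    have hy2 := hyb (t - 1) (by linarith)
    have hH2 := hpos _ hy2.1 hy2.2
    have hH3 : 0 < H (y (t - 1)) := lt_trans (mul_pos hc hy2.1) hH2
    have h1 : HasDerivAt (fun t => y (t - 1)) (y (t - 1) * u (t - 1)) t :=
      (hyp (t - 1) (by linarith)).comp_sub_const t 1
    have h2 : HasDerivAt (fun t => H (y (t - 1))) (H' (y (t - 1)) * (y (t - 1) * u (t - 1))) t :=
      (hHd _ hy2.1 hy2.2).comp t h1
    have h3 := (h2.div (hyp t ht) hy1.1.ne').sub_const c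
    have h4 : u =ᶠ[𝓝 t] fun t => H (y (t - 1)) / y t - c := by
      filter_upwards [Iio_mem_nhds ht] with r hr
      rw [← huc r hr]; ring
    refine (h3.congr_of_eventuallyEq h4).congr_deriv ?_
    rw [huc t ht]
    simp only [hη]
    field_simp
  have hev0 : ∀ᶠ t : ℝ in atBot, t < 0 := eventually_lt_atBot 0
  have hbl : IsBoundedUnder (· ≥ ·) atBot u := ⟨0, by
    rw [eventually_map]; exact hev0.mono fun t ht => hu0 t ht⟩
  have hbu : IsBoundedUnder (· ≤ ·) atBot u := ⟨K, by
    rw [eventually_map]; exact hev0.mono fun t ht => by linarith [huK t ht]⟩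
  have hsh : Tendsto (fun t : ℝ => t - 1) atBot atBot :=
    tendsto_atBot_add_const_right _ (-1) tendsto_id
  have hηe : ∀ ε > 0, ∀ᶠ t in atBot, |η t * u (t - 1) - u (t - 1)| ≤ ε := by
    intro ε hε
    have h1 : Tendsto (fun t => |η t - 1| * K) atBot (𝓝 (|1 - 1| * K)) :=
      ((hη1.sub_const 1).abs).mul_const K
    rw [sub_self, abs_zero, zero_mul] at h1
    filter_upwards [h1.eventually_lt_const hε, hev0] with t h2 h3
    have h4 := hu0 (t - 1) (by linarith)
    have h5 := huK (t - 1) (by linarith)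
    rw [show η t * u (t - 1) - u (t - 1) = (η t - 1) * u (t - 1) by ring, abs_mul, abs_of_nonneg h4]
    exact (mul_le_mul_of_nonneg_left (by linarith) (abs_nonneg _)).trans h2.le
  have hmvt : ∀ t < 0, ∃ s, t - 1 ≤ s ∧ s ≤ t ∧
      u t + c = H (y (t - 1)) / y (t - 1) * Real.exp (-(u s)) := by
    intro t ht
    obtain ⟨s, hs, hse⟩ := exists_hasDerivAt_eq_slope (fun r => Real.log (y r)) u
      (show t - 1 < t by linarith)
      (fun r hr => ((hyp r (by linarith [hr.2])).log (hyb r (by linarith [hr.2])).1.ne').continuousAt.continuousWithinAt)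
      (fun r hr => ((hyp r (by linarith [hr.2])).log (hyb r (by linarith [hr.2])).1.ne').congr_deriv (by
        have := (hyb r (by linarith [hr.2])).1
        field_simp))
    refine ⟨s, hs.1.le, hs.2.le, ?_⟩
    have hy1 := (hyb t ht.le).1
    have hy2 := (hyb (t - 1) (by linarith)).1
    have h1 : -(u s) = Real.log (y (t - 1)) - Real.log (y t) := by
      rw [hse]; ring
    rw [h1, Real.exp_sub, Real.exp_log hy1, Real.exp_log hy2, huc t ht]
    field_simp
  have pin : ∀ W, (∀ ε > 0, ∃ᶠ t in atBot, ∀ s, t - 1 ≤ s → s ≤ t → |u s - W| < ε) →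
      W + c = b * Real.exp (-W) := by
    intro W hW
    have h1 : ∀ n : ℕ, ∃ p q k : ℝ, |p - W| < 1 / ((n:ℝ) + 1) ∧ |q - W| < 1 / ((n:ℝ) + 1) ∧
        |k - b| < 1 / ((n:ℝ) + 1) ∧ p + c = k * Real.exp (-q) := by
      intro n
      have hn : 0 < 1 / ((n:ℝ) + 1) := by positivity
      have hk : ∀ᶠ t in atBot, |H (y (t - 1)) / y (t - 1) - b| < 1 / ((n:ℝ) + 1) := by
        have := (hHb.comp hyw).eventually (Metric.ball_mem_nhds b hn)
        simpa [Metric.mem_ball, Real.dist_eq] using this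
      obtain ⟨t, h2, h3, h4⟩ := ((hW _ hn).and_eventually (hk.and hev0)).exists
      obtain ⟨s, hs1, hs2, hs3⟩ := hmvt t h4
      exact ⟨u t, u s, _, h2 t (by linarith) le_rfl, h2 s hs1 hs2, h3, hs3⟩
    choose p q k hp hq hk he using h1
    have lim : ∀ (f : ℕ → ℝ) (a : ℝ), (∀ n : ℕ, |f n - a| < 1 / ((n:ℝ) + 1)) →
        Tendsto f atTop (𝓝 a) := by
      intro f a hf
      rw [tendsto_iff_dist_tendsto_zero]
      exact squeeze_zero (fun _ => dist_nonneg) (fun n => (hf n).le)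
        tendsto_one_div_add_atTop_nhds_zero_nat
    have h3 := (lim p W hp).add_const c
    have h4 : Tendsto (fun n => k n * Real.exp (-(q n))) atTop (𝓝 (b * Real.exp (-W))) :=
      (lim k b hk).mul ((Real.continuous_exp.tendsto _).comp (lim q W hq).neg)
    exact tendsto_nhds_unique h3 (h4.congr fun n => (he n).symm)
  have hV := pin (liminf u atBot) (dde_window hK hud (by
      intro ε hε
      have h1 := eventually_lt_of_lt_liminf (show liminf u atBot - ε / 2 < liminf u atBot by linarith) hbl
      filter_upwards [h1, hsh.eventually h1, hηe (ε / 2) (by linarith), hev0] with t h1 h2 h3 h4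
      refine ⟨by linarith, ?_⟩
      have h5 := (abs_le.1 h3).1
      have h6 : -(u t - (liminf u atBot - ε)) ≤ η t * u (t - 1) - u t := by linarith
      have h7 := huK t h4
      have h8 := hu0 t h4
      nlinarith [mul_le_mul_of_nonneg_left h6 (show 0 ≤ u t + c by linarith)])
    (fun ε hε => frequently_lt_of_liminf_lt hbu.isCoboundedUnder_ge (by linarith)))
  have hU := pin (limsup u atBot) (by
    have := dde_window (v := fun t => - u t) (W := - limsup u atBot) hK (fun t ht => (hud t ht).neg) (by
      intro ε hε
      have h1 := eventually_lt_of_limsup_lt (show limsup u atBot < limsup u atBot + ε / 2 by linarith) hbu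
      filter_upwards [h1, hsh.eventually h1, hηe (ε / 2) (by linarith), hev0] with t h1 h2 h3 h4
      refine ⟨by linarith, ?_⟩
      have h5 := (abs_le.1 h3).2
      have h6 : (u t - (limsup u atBot + ε)) ≤ u t - η t * u (t - 1) := by linarith
      have h7 := huK t h4
      have h8 := hu0 t h4
      nlinarith [mul_le_mul_of_nonneg_left h6 (show 0 ≤ u t + c by linarith)])
      (fun ε hε => (frequently_lt_of_lt_limsup hbl.isCoboundedUnder_le
        (show limsup u atBot - ε < limsup u atBot by linarith)).mono fun t ht => by linarith)
    intro ε hε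
    refine (this ε hε).mono fun t ht s h1 h2 => ?_
    have := ht s h1 h2
    rw [show u s - limsup u atBot = -(-u s - -limsup u atBot) by ring, abs_neg]
    exact this)
  have hroot : ∀ a a' : ℝ, a < a' → a + c = b * Real.exp (-a) → a' + c = b * Real.exp (-a') → False := by
    intro a a' haa h1 h2
    have : Real.exp (-a') < Real.exp (-a) := Real.exp_lt_exp.2 (by linarith)
    nlinarith
  have hVU : limsup u atBot = liminf u atBot := by
    rcases lt_trichotomy (limsup u atBot) (liminf u atBot) with h | h | h
    · exact (hroot _ _ h hU hV).elim
    · exact h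
    · exact (hroot _ _ h hV hU).elim
  exact ⟨_, hV, tendsto_of_liminf_eq_limsup rfl hVU hbu hbl⟩

lemma dde_logslope {y u : ℝ → ℝ} {l δ T0 : ℝ} (hδ : 0 < δ) 
    (hyp : ∀ t ≤ T0, 0 < y t) (hyd : ∀ t ≤ T0, HasDerivAt y (y t * u t) t)
    (hu : ∀ t ≤ T0, |u t - l| < δ) (a b : ℝ) (ha : a ≤ T0) (hb : b ≤ T0) :
    ∃ m, |m - l| < δ ∧ Real.log (y b) - Real.log (y a) = (b - a) * m := by
  have key : ∀ a b, a < b → b ≤ T0 →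
      ∃ m, |m - l| < δ ∧ Real.log (y b) - Real.log (y a) = (b - a) * m := by
    intro a b hab hb
    have hl : ∀ r ≤ T0, HasDerivAt (fun r => Real.log (y r)) (u r) r := fun r hr =>
      ((hyd r hr).log (hyp r hr).ne').congr_deriv (by have := hyp r hr; field_simp)
    obtain ⟨s, hs, hse⟩ := exists_hasDerivAt_eq_slope (fun r => Real.log (y r)) u hab
      (fun r hr => (hl r (by linarith [hr.2])).continuousAt.continuousWithinAt)
      (fun r hr => hl r (by linarith [hr.2]))
    refine ⟨u s, hu s (by linarith [hs.2]), ?_⟩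
    have : b - a ≠ 0 := by linarith
    rw [hse]; field_simp
  rcases lt_trichotomy a b with h | h | h
  · exact key a b h hb
  · subst h; exact ⟨l, by simpa using hδ, by simp⟩
  · obtain ⟨m, h1, h2⟩ := key b a h ha
    exact ⟨m, h1, by linarith⟩

lemma dde_unique_le {c b K κ₀ : ℝ} {H H' y z : ℝ → ℝ} (hc : 0 < c)
    (hK : 0 ≤ K) (hLip : ∀ u v, |H u - H v| ≤ K * |u - v|) (hmono : Monotone H) (hb : c < b)
    (hneg : ∀ u ≤ 0, H u = 0) (hpos : ∀ u, 0 < u → u < κ₀ → c * u < H u)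
    (hHd : ∀ u, 0 < u → u < κ₀ → HasDerivAt H (H' u) u)
    (hH'b : Tendsto H' (𝓝[>] 0) (𝓝 b)) (hHb : Tendsto (fun u => H u / u) (𝓝[>] 0) (𝓝 b))
    (hyc : Continuous y) (hzc : Continuous z)
    (hyb : ∀ t ≤ 0, 0 < y t ∧ y t < κ₀) (hym : StrictMonoOn y (Iic 0))
    (hy0 : Tendsto y atBot (𝓝 0))
    (hyd : ∀ t < 0, HasDerivAt y (-c * y t + H (y (t - 1))) t)
    (hzb : ∀ t ≤ 0, 0 < z t ∧ z t < κ₀) (hzm : StrictMonoOn z (Iic 0))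
    (hz0 : Tendsto z atBot (𝓝 0))
    (hzd : ∀ t < 0, HasDerivAt z (-c * z t + H (z (t - 1))) t)
    (hyz : y 0 = z 0) : ∀ t ≤ 0, y t ≤ z t := by
  have hb0 : 0 < b := hc.trans hb
  obtain ⟨l, hl, hul⟩ := dde_rate hc hK hLip hb0 hneg hpos hHd hH'b hHb hyb hym.monotoneOn hy0 hyd
  obtain ⟨l', hl', hul'⟩ := dde_rate hc hK hLip hb0 hneg hpos hHd hH'b hHb hzb hzm.monotoneOn hz0 hzd
  have hroot : ∀ a a' : ℝ, a < a' → a + c = b * Real.exp (-a) → a' + c = b * Real.exp (-a') → False := by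
    intro a a' haa h1 h2
    have : Real.exp (-a') < Real.exp (-a) := Real.exp_lt_exp.2 (by linarith)
    nlinarith
  have hll : l' = l := by
    rcases lt_trichotomy l' l with h | h | h
    · exact (hroot _ _ h hl' hl).elim
    · exact h
    · exact (hroot _ _ h hl hl').elim
  subst hll
  have hlp : 0 < l' := by
    by_contra! h
    have : 1 ≤ Real.exp (-l') := Real.one_le_exp (by linarith)
    nlinarith
  -- comparison with shift
  have shift1 : ∀ α s, s ≤ 0 → (∀ t, s - 1 ≤ t → t ≤ s → y (t + α) ≤ z t) →
      ∀ t, s ≤ t → t ≤ 0 → t + α ≤ 0 → y (t + α) ≤ z t := by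
    intro α s hs h0 t h1 h2 h3
    have := dde_cmp (c := c) (w := fun t => z t - y (t + α))
      (q := fun t => H (z (t - 1)) - H (y (t + α - 1))) (s := s) (T := t)
      (by fun_prop) (fun r h4 h5 => by linarith [h0 r h4 h5])
      (fun r h4 h5 => ((hzd r (by linarith)).sub
        ((hyd (r + α) (by linarith)).comp_add_const r α)).congr_deriv (by ring))
      (fun r _ _ h4 => by
        have h5 : y (r + α - 1) ≤ z (r - 1) := by
          rw [show r + α - 1 = r - 1 + α by ring]; linarith
        linarith [hmono h5]) t (by linarith) le_rfl
    linarith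
  have shift2 : ∀ α s, s ≤ 0 → (∀ t, s - 1 ≤ t → t ≤ s → z t ≤ y (t + α)) →
      ∀ t, s ≤ t → t ≤ 0 → t + α ≤ 0 → z t ≤ y (t + α) := by
    intro α s hs h0 t h1 h2 h3
    have := dde_cmp (c := c) (w := fun t => y (t + α) - z t)
      (q := fun t => H (y (t + α - 1)) - H (z (t - 1))) (s := s) (T := t)
      (by fun_prop) (fun r h4 h5 => by linarith [h0 r h4 h5])
      (fun r h4 h5 => (((hyd (r + α) (by linarith)).comp_add_const r α).sub
        (hzd r (by linarith))).congr_deriv (by ring))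
      (fun r _ _ h4 => by
        have h5 : z (r - 1) ≤ y (r + α - 1) := by
          rw [show r + α - 1 = r - 1 + α by ring]; linarith
        linarith [hmono h5]) t (by linarith) le_rfl
    linarith
  have main : ∀ ε > 0, ∀ t ≤ 0, y (t - 2 * ε) ≤ z t := by
    intro ε hε t ht
    set δ : ℝ := ε * l' / (2 + ε) with hδ
    have hδp : 0 < δ := by positivity
    have hδe : δ * (2 + ε) = ε * l' := by rw [hδ]; field_simp
    have e1 := hul.eventually (Metric.ball_mem_nhds l' hδp)
    have e2 := hul'.eventually (Metric.ball_mem_nhds l' hδp)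
    obtain ⟨T1, hT1⟩ := eventually_atBot.1 (e1.and e2)
    set T0 : ℝ := min T1 (-1) with hT0
    have hT0' : T0 ≤ -1 := min_le_right _ _
    have hyp' : ∀ t < 0, HasDerivAt y (y t * ((-c * y t + H (y (t - 1))) / y t)) t := by
      intro t ht
      refine (hyd t ht).congr_deriv ?_
      have := (hyb t ht.le).1
      field_simp
    have hzp' : ∀ t < 0, HasDerivAt z (z t * ((-c * z t + H (z (t - 1))) / z t)) t := by
      intro t ht
      refine (hzd t ht).congr_deriv ?_
      have := (hzb t ht.le).1
      field_simp
    have slopeY := dde_logslope (T0 := T0) (l := l') hδp (fun t ht => (hyb t (by linarith)).1)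
      (fun t ht => hyp' t (by linarith)) (fun t ht => by
        have := (hT1 t (ht.trans (min_le_left _ _))).1
        simpa [Real.dist_eq] using this)
    have slopeZ := dde_logslope (T0 := T0) (l := l') hδp (fun t ht => (hzb t (by linarith)).1)
      (fun t ht => hzp' t (by linarith)) (fun t ht => by
        have := (hT1 t (ht.trans (min_le_left _ _))).2
        simpa [Real.dist_eq] using this)
    -- choose s
    have hyT : 0 < y (T0 - ε) := (hyb _ (by linarith)).1
    obtain ⟨s, hs1, hs2⟩ := ((hz0.eventually_lt_const hyT).and
      (eventually_le_atBot (min T0 t))).exists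
    have hsT : s ≤ T0 := hs2.trans (min_le_left _ _)
    have hst : s ≤ t := hs2.trans (min_le_right _ _)
    have hzs := (hzb s (by linarith)).1
    obtain ⟨a, ha⟩ := (hy0.eventually_lt_const hzs).exists
    obtain ⟨r, hr⟩ : ∃ r, r ≤ T0 - ε ∧ y r = z s := by
      rcases le_total a (T0 - ε) with h | h
      · obtain ⟨r, hr, hr'⟩ := intermediate_value_Icc h hyc.continuousOn ⟨ha.le, hs1.le⟩
        exact ⟨r, hr.2, hr'⟩
      · obtain ⟨a', ha', ha''⟩ := ((hy0.eventually_lt_const hzs).and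
          (eventually_le_atBot (T0 - ε))).exists
        obtain ⟨r, hr, hr'⟩ := intermediate_value_Icc ha'' hyc.continuousOn ⟨ha'.le, hs1.le⟩
        exact ⟨r, hr.2, hr'⟩
    obtain ⟨hr1, hr2⟩ := hr
    have hlog : Real.log (y r) = Real.log (z s) := by rw [hr2]
    have hup : ∀ t, s - 1 ≤ t → t ≤ s → z t ≤ y (t + (r - s + ε)) := by
      intro t h1 h2
      obtain ⟨m, hm, hm'⟩ := slopeY r (t + (r - s + ε)) (by linarith) (by linarith)
      obtain ⟨m', hn, hn'⟩ := slopeZ s t hsT (by linarith)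
      have hm := abs_lt.1 hm
      have hn := abs_lt.1 hn
      have h3 : Real.log (z t) ≤ Real.log (y (t + (r - s + ε))) := by
        nlinarith [mul_nonneg (show 0 ≤ s - t by linarith) (show 0 ≤ 2 * δ - (m - m') by linarith)]
      exact (Real.log_le_log_iff (hzb t (by linarith)).1 (hyb _ (by linarith)).1).1 h3
    have hdn : ∀ t, s - 1 ≤ t → t ≤ s → y (t + (r - s - ε)) ≤ z t := by
      intro t h1 h2
      obtain ⟨m, hm, hm'⟩ := slopeY r (t + (r - s - ε)) (by linarith) (by linarith)
      obtain ⟨m', hn, hn'⟩ := slopeZ s t hsT (by linarith)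
      have hm := abs_lt.1 hm
      have hn := abs_lt.1 hn
      have h3 : Real.log (y (t + (r - s - ε))) ≤ Real.log (z t) := by
        nlinarith [mul_nonneg (show 0 ≤ s - t by linarith) (show 0 ≤ 2 * δ + (m - m') by linarith)]
      exact (Real.log_le_log_iff (hyb _ (by linarith)).1 (hzb t (by linarith)).1).1 h3
    have hσ1 : 0 ≤ r - s + ε := by
      by_contra! h
      have h1 := shift2 _ s (by linarith) hup 0 (by linarith) le_rfl (by linarith)
      rw [zero_add] at h1
      have h2 := hym (mem_Iic.2 h.le) (mem_Iic.2 (le_refl (0:ℝ))) h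
      linarith
    have hσ2 : r - s - ε ≤ 0 := by
      by_contra! h
      rcases le_or_gt s (-(r - s - ε)) with h' | h'
      · have h1 := shift1 _ s (by linarith) hdn (-(r - s - ε)) h' (by linarith) (by linarith)
        rw [neg_add_cancel] at h1
        have h2 := hzm (mem_Iic.2 (show -(r - s - ε) ≤ 0 by linarith)) (mem_Iic.2 (le_refl (0:ℝ)))
          (by linarith)
        linarith
      · linarith
    have h1 := shift1 _ s (by linarith) hdn t hst ht (by linarith)
    refine le_trans (hym.monotoneOn (mem_Iic.2 (by linarith)) (mem_Iic.2 (by linarith)) ?_) h1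
    linarith
  intro t ht
  have h1 : Tendsto (fun ε : ℝ => y (t - 2 * ε)) (𝓝[>] 0) (𝓝 (y t)) := by
    have : Tendsto (fun ε : ℝ => y (t - 2 * ε)) (𝓝 0) (𝓝 (y (t - 2 * 0))) :=
      Continuous.tendsto (by fun_prop) 0
    simp only [mul_zero, sub_zero] at this
    exact this.mono_left nhdsWithin_le_nhds
  exact le_of_tendsto h1 (eventually_nhdsWithin_of_forall fun ε hε => main ε hε t ht)


structure DdeH (c b K κ₀ : ℝ) (H H' : ℝ → ℝ) : Prop where
  hK : 0 ≤ K
  hLip : ∀ u v, |H u - H v| ≤ K * |u - v|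
  hmono : Monotone H
  hb : c < b
  hneg : ∀ u ≤ 0, H u = 0
  hpos : ∀ u, 0 < u → u < κ₀ → c * u < H u
  hHd : ∀ u, 0 < u → u < κ₀ → HasDerivAt H (H' u) u
  hH'b : Tendsto H' (𝓝[>] 0) (𝓝 b)
  hHb : Tendsto (fun u => H u / u) (𝓝[>] 0) (𝓝 b)

lemma DdeH.cont {c b K κ₀ : ℝ} {H H' : ℝ → ℝ} (h : DdeH c b K κ₀ H H') : Continuous H := by
  refine (LipschitzWith.of_dist_le_mul (K := ⟨K, h.hK⟩) ?_).continuous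
  intro u v; rw [Real.dist_eq, Real.dist_eq]; exact h.hLip u v

lemma CgA.hasDerivAt {g g' : ℝ → ℝ} (hg : CgA g g') {ξ : ℝ} (h0 : 0 < ξ) (h1 : ξ < 1) :
    HasDerivAt g (g' ξ) ξ :=
  (hg.hasDeriv ξ ⟨h0.le, h1.le⟩).hasDerivAt (Icc_mem_nhds h0 h1)

lemma CgA.contOn {g g' : ℝ → ℝ} (hg : CgA g g') : ContinuousOn g (Icc 0 1) :=
  fun ξ hξ => (hg.hasDeriv ξ hξ).continuousWithinAt

lemma CgA.mono {g g' : ℝ → ℝ} (hg : CgA g g') : MonotoneOn g (Icc 0 1) := by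
  apply monotoneOn_of_deriv_nonneg (convex_Icc 0 1) hg.contOn
  · intro r hr
    rw [interior_Icc] at hr
    exact (hg.hasDerivAt hr.1 hr.2).differentiableAt.differentiableWithinAt
  · intro r hr
    rw [interior_Icc] at hr
    rw [(hg.hasDerivAt hr.1 hr.2).deriv]
    exact (div_nonneg (hg.maps_to r hr.1.le).1 hr.1.le).trans (hg.slope r hr.1 hr.2.le).le

lemma CgA.ratio {g g' : ℝ → ℝ} (hg : CgA g g') : StrictMonoOn (fun ξ => g ξ / ξ) (Ioc 0 1) := by
  apply strictMonoOn_of_deriv_pos (convex_Ioc 0 1)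
  · exact (hg.contOn.mono Ioc_subset_Icc_self).div continuousOn_id fun r hr => hr.1.ne'
  · intro r hr
    rw [interior_Ioc] at hr
    have h1 := (hg.hasDerivAt hr.1 hr.2).div (hasDerivAt_id r) hr.1.ne'
    have h2 := hg.slope r hr.1 hr.2.le
    rw [div_lt_iff₀ hr.1] at h2
    have h3 : deriv (fun ξ => g ξ / ξ) r = _ := h1.deriv
    rw [h3]
    apply div_pos
    · simp only [id]; linarith
    · have := hr.1
      simp only [id]; positivity

lemma CgA.lip {g g' : ℝ → ℝ} (hg : CgA g g') :
    ∃ K, 0 ≤ K ∧ ∀ a ∈ Icc (0:ℝ) 1, ∀ b ∈ Icc (0:ℝ) 1, |g a - g b| ≤ K * |a - b| := by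
  obtain ⟨K, hK⟩ := isCompact_Icc.exists_bound_of_continuousOn hg.derivCont
  refine ⟨K, (norm_nonneg _).trans (hK 0 (by simp)), fun a ha b hb => ?_⟩
  exact (convex_Icc (0:ℝ) 1).norm_image_sub_le_of_norm_hasDerivWithin_le hg.hasDeriv hK hb ha

def ddeClamp (κ u : ℝ) : ℝ := max 0 (min u κ)

def ddeH (d ξ₁ σ κ : ℝ) (g : ℝ → ℝ) (u : ℝ) : ℝ :=
  σ * d * (g (ξ₁ + σ * ddeClamp κ u) - g ξ₁)

lemma ddeClamp_id {κ u : ℝ} (h0 : 0 ≤ u) (h1 : u ≤ κ) : ddeClamp κ u = u := by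
  rw [ddeClamp, min_eq_left h1, max_eq_right h0]

lemma ddeClamp_lip (κ u v : ℝ) : |ddeClamp κ u - ddeClamp κ v| ≤ |u - v| := by
  unfold ddeClamp
  rw [max_comm 0, max_comm 0]
  refine (abs_max_sub_max_le_abs _ _ _).trans ?_
  refine (abs_min_sub_min_le_max _ _ _ _).trans ?_
  simp

lemma ddeH_spec {c d : ℝ} {g g' : ℝ → ℝ} (hg : CgA g g') (hc : 0 < c) (hcd : c < d)
    {ξ₁ : ℝ} (hξ₁ : ξ₁ ∈ Ioo (0:ℝ) 1) (hzero : -c * ξ₁ + d * g ξ₁ = 0)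
    {σ κ : ℝ} (hσ : σ = 1 ∨ σ = -1) (hκ : 0 < κ) (hσκ : ξ₁ + σ * κ ∈ Icc (0:ℝ) 1) :
    ∃ K, DdeH c (d * g' ξ₁) K κ (ddeH d ξ₁ σ κ g) (fun u => d * g' (ξ₁ + σ * u)) := by
  obtain ⟨K, hK, hL⟩ := hg.lip
  have hd : 0 < d := hc.trans hcd
  have hσσ : σ * σ = 1 := by rcases hσ with rfl | rfl <;> norm_num
  have hσa : |σ| = 1 := by rcases hσ with rfl | rfl <;> norm_num
  have hcl : ∀ u, 0 ≤ ddeClamp κ u ∧ ddeClamp κ u ≤ κ := fun u =>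
    ⟨le_max_left _ _, max_le hκ.le (min_le_right _ _)⟩
  have hmem' : ∀ v, 0 ≤ v → v ≤ κ → ξ₁ + σ * v ∈ Icc (0:ℝ) 1 := by
    intro v h0 h1
    rcases hσ with rfl | rfl
    · exact ⟨by linarith [hξ₁.1], by linarith [hσκ.2]⟩
    · exact ⟨by linarith [hσκ.1], by linarith [hξ₁.2]⟩
  have hmem : ∀ u, ξ₁ + σ * ddeClamp κ u ∈ Icc (0:ℝ) 1 := fun u => hmem' _ (hcl u).1 (hcl u).2
  have hmemo : ∀ v, 0 < v → v < κ → ξ₁ + σ * v ∈ Ioo (0:ℝ) 1 := by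
    intro v h0 h1
    rcases hσ with rfl | rfl
    · exact ⟨by linarith [hξ₁.1], by linarith [hσκ.2]⟩
    · exact ⟨by linarith [hσκ.1], by linarith [hξ₁.2]⟩
  have hgd : ∀ u, ξ₁ + σ * u ∈ Ioo (0:ℝ) 1 →
      HasDerivAt (fun u => σ * d * (g (ξ₁ + σ * u) - g ξ₁)) (d * g' (ξ₁ + σ * u)) u := by
    intro u hu
    have h1 : HasDerivAt (fun u => ξ₁ + σ * u) (σ * 1) u :=
      ((hasDerivAt_id u).const_mul σ).const_add ξ₁
    have h2 := (((hg.hasDerivAt hu.1 hu.2).comp u h1).sub_const (g ξ₁)).const_mul (σ * d)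
    refine h2.congr_deriv ?_
    linear_combination d * g' (ξ₁ + σ * u) * hσσ
  refine ⟨d * K, by positivity, ?_, ?_, ?_, ?_, ?_, ?_, ?_, ?_⟩
  · intro u v
    have h1 := hL _ (hmem u) _ (hmem v)
    rw [show ξ₁ + σ * ddeClamp κ u - (ξ₁ + σ * ddeClamp κ v) =
      σ * (ddeClamp κ u - ddeClamp κ v) by ring, abs_mul, hσa, one_mul] at h1
    have h2 := ddeClamp_lip κ u v
    unfold ddeH
    rw [show σ * d * (g (ξ₁ + σ * ddeClamp κ u) - g ξ₁) - σ * d * (g (ξ₁ + σ * ddeClamp κ v) - g ξ₁)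
      = σ * d * (g (ξ₁ + σ * ddeClamp κ u) - g (ξ₁ + σ * ddeClamp κ v)) by ring, abs_mul, abs_mul,
      hσa, one_mul, abs_of_pos hd, mul_assoc]
    exact mul_le_mul_of_nonneg_left (h1.trans (mul_le_mul_of_nonneg_left h2 hK)) hd.le
  · intro u v huv
    have hcm : ddeClamp κ u ≤ ddeClamp κ v := max_le_max le_rfl (min_le_min huv le_rfl)
    unfold ddeH
    rcases hσ with rfl | rfl
    · have := hg.mono (hmem u) (hmem v) (by linarith)
      nlinarith
    · have := hg.mono (hmem v) (hmem u) (by linarith)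
      nlinarith
  · have := hg.slope ξ₁ hξ₁.1 hξ₁.2.le
    have h2 : g ξ₁ / ξ₁ = c / d := by
      have := hξ₁.1
      field_simp; linarith
    rw [h2, div_lt_iff₀ hd] at this
    linarith
  · intro u hu
    have : ddeClamp κ u = 0 := max_eq_left ((min_le_left _ _).trans hu)
    simp [ddeH, this]
  · intro u h0 h1
    have hm := hmemo u h0 h1
    have hr := hg.ratio
    have h2 : g ξ₁ / ξ₁ = c / d := by
      have := hξ₁.1
      field_simp; linarith
    unfold ddeH
    rw [ddeClamp_id h0.le h1.le]
    rcases hσ with rfl | rfl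
    · have h3 := hr ⟨hξ₁.1, hξ₁.2.le⟩ ⟨hm.1, hm.2.le⟩ (by linarith)
      simp only at h3
      rw [h2, div_lt_div_iff₀ hd hm.1] at h3
      linarith
    · have h3 := hr ⟨hm.1, hm.2.le⟩ ⟨hξ₁.1, hξ₁.2.le⟩ (by linarith)
      simp only at h3
      rw [h2, div_lt_div_iff₀ hm.1 hd] at h3
      linarith
  · intro u h0 h1
    refine (hgd u (hmemo u h0 h1)).congr_of_eventuallyEq ?_
    filter_upwards [Ioo_mem_nhds h0 h1] with v hv
    rw [ddeH, ddeClamp_id hv.1.le hv.2.le]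
  · have h1 : ContinuousAt g' ξ₁ := hg.derivCont.continuousAt (Icc_mem_nhds hξ₁.1 hξ₁.2)
    have h2 : Tendsto (fun u : ℝ => ξ₁ + σ * u) (𝓝[>] 0) (𝓝 ξ₁) := by
      have : Tendsto (fun u : ℝ => ξ₁ + σ * u) (𝓝 0) (𝓝 (ξ₁ + σ * 0)) :=
        Continuous.tendsto (by fun_prop) 0
      simp only [mul_zero, add_zero] at this
      exact this.mono_left nhdsWithin_le_nhds
    exact (h1.tendsto.comp h2).const_mul d
  · have h1 := hgd 0 (by simpa using hξ₁)
    rw [hasDerivAt_iff_tendsto_slope_zero] at h1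
    simp only [mul_zero, add_zero, zero_add, sub_self, sub_zero, smul_eq_mul] at h1
    have h2 := h1.mono_left (nhdsWithin_mono 0 (show Ioi (0:ℝ) ⊆ {0}ᶜ from fun u hu => ne_of_gt hu))
    refine h2.congr' ?_
    filter_upwards [Ioo_mem_nhdsGT hκ] with v hv
    rw [ddeH, ddeClamp_id hv.1.le hv.2.le]
    ring

/-- conversion of the integral formula -/
lemma dde_conv {a b τ t : ℝ} {x p : ℝ → ℝ} :
    (IntervalIntegrable (fun s => Real.exp (-a * (t - s)) * p s) volume τ t ∧
      x t = Real.exp (-a * (t - τ)) * x τ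
          + b * ∫ s in τ..t, Real.exp (-a * (t - s)) * p s) ↔
    (IntervalIntegrable (fun s => Real.exp (a * s) * p s) volume τ t ∧
      Real.exp (a * t) * x t = Real.exp (a * τ) * x τ
          + b * ∫ s in τ..t, Real.exp (a * s) * p s) := by
  have e1 : ∀ s, Real.exp (a * t) * Real.exp (-a * (t - s)) = Real.exp (a * s) := by
    intro s; rw [← Real.exp_add]; congr 1; ring
  have e2 : Real.exp (-a * t) * Real.exp (a * t) = 1 := by rw [← Real.exp_add]; simp
  have f1 : (fun s => Real.exp (a * s) * p s) =
      fun s => Real.exp (a * t) * (Real.exp (-a * (t - s)) * p s) := by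
    funext s; rw [← mul_assoc, e1]
  have f2 : (fun s => Real.exp (-a * (t - s)) * p s) =
      fun s => Real.exp (-a * t) * (Real.exp (a * s) * p s) := by
    funext s
    rw [← e1 s]
    linear_combination (-(Real.exp (-a * (t - s)) * p s)) * e2
  constructor
  · rintro ⟨h1, h2⟩
    constructor
    · rw [f1]; exact h1.const_mul _
    · rw [f1, intervalIntegral.integral_const_mul, ← e1 τ]
      linear_combination Real.exp (a * t) * h2
  · rintro ⟨h1, h2⟩
    constructor
    · rw [f2]; exact h1.const_mul _
    · rw [f2, intervalIntegral.integral_const_mul]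
      rw [← e1 τ] at h2
      linear_combination Real.exp (-a * t) * h2 + (Real.exp (-a * (t - τ)) * x τ - x t) * e2

lemma dde_sol_deriv {c d T t : ℝ} {g x q : ℝ → ℝ} (hx : IsSolR c d g x) (hq : Continuous q)
    (hqe : ∀ s < T, d * g (x (s - 1)) = q s) (ht : t < T) :
    HasDerivAt x (-c * x t + q t) t := by
  refine dde_hasDeriv (τ := t - 1) hq ?_
  filter_upwards [Ioo_mem_nhds (show t - 1 < t by linarith) ht] with r hr
  have := (dde_conv.1 (hx.2.2 (t - 1) r hr.1)).2
  rw [this, ← intervalIntegral.integral_const_mul]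
  congr 1
  apply intervalIntegral.integral_congr
  intro s hs
  rw [uIcc_of_le hr.1.le] at hs
  simp only
  rw [← hqe s (by linarith [hs.2, hr.2])]
  ring

lemma dde_sol_of_deriv {c d τ t : ℝ} {g x q : ℝ → ℝ} (hd : d ≠ 0) (hx : Continuous x)
    (hq : Continuous q) (hτ : τ ≤ t)
    (hqe : ∀ s ≤ t, d * g (x (s - 1)) = q s)
    (hxd : ∀ r, r < t → HasDerivAt x (-c * x r + q r) r) :
    (IntervalIntegrable (fun s => Real.exp (c * s) * g (x (s - 1))) volume τ t ∧
      Real.exp (c * t) * x t = Real.exp (c * τ) * x τ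
          + d * ∫ s in τ..t, Real.exp (c * s) * g (x (s - 1))) := by
  have h1 := dde_integral hτ hx hq (fun r _ h => hxd r h)
  have hE : ∀ s ∈ uIcc τ t, Real.exp (c * s) * g (x (s - 1)) = Real.exp (c * s) * (q s / d) := by
    intro s hs
    rw [uIcc_of_le hτ] at hs
    rw [← hqe s hs.2, mul_div_cancel_left₀ _ hd]
  constructor
  · have : IntervalIntegrable (fun s => Real.exp (c * s) * (q s / d)) volume τ t :=
      Continuous.intervalIntegrable (by fun_prop) _ _
    refine this.congr ?_
    intro s hs
    exact (hE s (uIoc_subset_uIcc hs)).symm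
  · rw [intervalIntegral.integral_congr hE, ← intervalIntegral.integral_const_mul, h1]
    congr 1
    apply intervalIntegral.integral_congr
    intro s _
    simp only
    field_simp

lemma dde_sol_unique {c d : ℝ} {g x z : ℝ → ℝ} (hx : IsSolR c d g x) (hz : IsSolR c d g z)
    (h : ∀ t ≤ 0, x t = z t) : x = z := by
  have key : ∀ n : ℕ, ∀ t ≤ (n:ℝ), x t = z t := by
    intro n
    induction n with
    | zero => simpa using h
    | succ n ih =>
      intro t ht
      push_cast at ht
      rcases le_or_gt t n with h1 | h1
      · exact ih t h1
      rw [(hx.2.2 n t h1).2, (hz.2.2 n t h1).2, ih n le_rfl]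
      congr 2
      apply intervalIntegral.integral_congr
      intro s hs
      rw [uIcc_of_le h1.le] at hs
      simp only
      rw [ih (s - 1) (by linarith [hs.2])]
  funext t
  obtain ⟨n, hn⟩ := exists_nat_ge t
  exact key n t hn

/-- uniqueness in terms of H -/
lemma dde_spec_unique {c d b K κ₀ ξ₁ σ : ℝ} {g H H' x z : ℝ → ℝ} (hc : 0 < c)
    (hH : DdeH c b K κ₀ H H') (hσ : σ * σ = 1)
    (hHg : ∀ u, 0 < u → u < κ₀ → d * g (ξ₁ + σ * u) = c * ξ₁ + σ * H u)
    (hx : IsSolR c d g x) (hz : IsSolR c d g z)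
    (hxm : StrictMonoOn (fun t => σ * (x t - ξ₁)) (Iic 0))
    (hzm : StrictMonoOn (fun t => σ * (z t - ξ₁)) (Iic 0))
    (hxb : ∀ t ≤ 0, 0 < σ * (x t - ξ₁) ∧ σ * (x t - ξ₁) < κ₀)
    (hzb : ∀ t ≤ 0, 0 < σ * (z t - ξ₁) ∧ σ * (z t - ξ₁) < κ₀)
    (hxl : Tendsto x atBot (𝓝 ξ₁)) (hzl : Tendsto z atBot (𝓝 ξ₁)) (h0 : x 0 = z 0) : x = z := by
  have dv : ∀ x, IsSolR c d g x → (∀ t ≤ 0, 0 < σ * (x t - ξ₁) ∧ σ * (x t - ξ₁) < κ₀) →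
      ∀ t < 0, HasDerivAt (fun t => σ * (x t - ξ₁)) (-c * (σ * (x t - ξ₁)) + H (σ * (x (t - 1) - ξ₁))) t := by
    intro x hx hxb t ht
    have hHc := hH.cont
    have hxc := hx.1
    have h1 := dde_sol_deriv (T := 0) (q := fun s => c * ξ₁ + σ * H (σ * (x (s - 1) - ξ₁))) hx
      (by fun_prop) (fun s hs => by
        have h2 := hxb (s - 1) (by linarith)
        have h3 := hHg _ h2.1 h2.2
        rw [← h3]
        congr 2
        linear_combination (ξ₁ - x (s - 1)) * hσ) ht
    refine ((h1.sub_const ξ₁).const_mul σ).congr_deriv ?_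
    linear_combination H (σ * (x (t - 1) - ξ₁)) * hσ
  have lm : ∀ x : ℝ → ℝ, Tendsto x atBot (𝓝 ξ₁) → Tendsto (fun t => σ * (x t - ξ₁)) atBot (𝓝 0) := by
    intro x hxl
    simpa using (hxl.sub_const ξ₁).const_mul σ
  have hxc := hx.1
  have hzc := hz.1
  refine dde_sol_unique hx hz fun t ht => ?_
  have h1 := dde_unique_le hc hH.hK hH.hLip hH.hmono hH.hb hH.hneg hH.hpos hH.hHd hH.hH'b hH.hHb
    (by fun_prop) (by fun_prop) hxb hxm (lm x hxl) (dv x hx hxb) hzb hzm (lm z hzl) (dv z hz hzb)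
    (by simp only [h0]) t ht
  have h2 := dde_unique_le hc hH.hK hH.hLip hH.hmono hH.hb hH.hneg hH.hpos hH.hHd hH.hH'b hH.hHb
    (by fun_prop) (by fun_prop) hzb hzm (lm z hzl) (dv z hz hzb) hxb hxm (lm x hxl) (dv x hx hxb)
    (by simp only [h0]) t ht
  have h3 : σ * (x t - ξ₁) = σ * (z t - ξ₁) := le_antisymm h1 h2
  linear_combination σ * h3 + (z t - x t) * hσ


lemma ddeH_le {c d : ℝ} {g g' : ℝ → ℝ} (hg : CgA g g') (hd : 0 < d)
    {ξ₁ : ℝ} (hξ₁ : ξ₁ ∈ Ioo (0:ℝ) 1) (hzero : -c * ξ₁ + d * g ξ₁ = 0) (u : ℝ) :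
    ddeH d ξ₁ (-1) ξ₁ g u ≤ c * ξ₁ := by
  have hcl : ddeClamp ξ₁ u ≤ ξ₁ := max_le hξ₁.1.le (min_le_right _ _)
  have := (hg.maps_to (ξ₁ + -1 * ddeClamp ξ₁ u) (by linarith)).1
  unfold ddeH
  nlinarith

lemma ddeH_le' {c d : ℝ} {g g' : ℝ → ℝ} (hg : CgA g g') (hd : 0 < d)
    {ξ₁ : ℝ} (hξ₁ : ξ₁ ∈ Ioo (0:ℝ) 1) (hzero : -c * ξ₁ + d * g ξ₁ = 0) (u : ℝ) :
    ddeH d ξ₁ 1 (1 - ξ₁) g u ≤ d - c * ξ₁ := by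
  have hcl : 0 ≤ ddeClamp (1 - ξ₁) u := le_max_left _ _
  have := (hg.maps_to (ξ₁ + 1 * ddeClamp (1 - ξ₁) u) (by linarith [hξ₁.1])).2
  unfold ddeH
  nlinarith

lemma dde_minus {c d : ℝ} {g g' : ℝ → ℝ} (hg : CgA g g') (hc : 0 < c) (hcd : c < d)
    {ξ₁ : ℝ} (hξ₁ : ξ₁ ∈ Ioo (0:ℝ) 1) (hzero : -c * ξ₁ + d * g ξ₁ = 0)
    {κm : ℝ} (hκm : κm ∈ Ioo (-ξ₁) 0) :
    ∃ xm : ℝ → ℝ, XMinusSpec c d ξ₁ κm g xm ∧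
      ∀ xm' : ℝ → ℝ, XMinusSpec c d ξ₁ κm g xm' → xm' = xm := by
  have hd : 0 < d := hc.trans hcd
  obtain ⟨K, hH⟩ := ddeH_spec hg hc hcd hξ₁ hzero (σ := -1) (κ := ξ₁) (Or.inr rfl) hξ₁.1
    (by simp)
  set H := ddeH d ξ₁ (-1) ξ₁ g with hHdef
  have hHg : ∀ u, 0 < u → u < ξ₁ → d * g (ξ₁ + (-1) * u) = c * ξ₁ + (-1) * H u := by
    intro u h0 h1
    rw [hHdef, ddeH, ddeClamp_id h0.le h1.le]
    linear_combination hzero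
  have hHc := hH.cont
  obtain ⟨y, hyc, hym, hy0, hyb, hyl, hyd⟩ := dde_entire hc (κ := -κm) (B := ξ₁) (by linarith [hκm.2])
    hH.hK hH.hLip hH.hmono hH.hneg (fun u h0 h1 => hH.hpos u h0 (by linarith [hκm.1]))
    (fun u => ddeH_le hg hd hξ₁ hzero u) (by linarith [hκm.1])
  have hyt : Tendsto y atTop (𝓝 ξ₁) := by
    have hbdd : BddAbove (range y) := ⟨ξ₁, by rintro _ ⟨t, rfl⟩; exact (hyb t).2.le⟩
    have h1 := tendsto_atTop_ciSup hym.monotone hbdd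
    have h2 := dde_equil_top (T := 0) hHc (fun t _ => hyd t) h1
    have h3 : (⨆ i, y i) ≤ ξ₁ := ciSup_le fun t => (hyb t).2.le
    have h4 : 0 < ⨆ i, y i := (hyb 0).1.trans_le (le_ciSup hbdd 0)
    rcases h3.lt_or_eq with h5 | h5
    · exact absurd h2 (hH.hpos _ h4 h5).ne'
    · rwa [h5] at h1
  have hxc : Continuous fun t => ξ₁ - y t := by fun_prop
  have hsol : IsSolR c d g (fun t => ξ₁ - y t) := by
    refine ⟨hxc, fun t => by linarith [(hyb t).2], fun τ t hτ => ?_⟩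
    refine (dde_conv (x := fun t => ξ₁ - y t) (p := fun s => g (ξ₁ - y (s - 1)))).2 ?_
    refine dde_sol_of_deriv (x := fun t => ξ₁ - y t) (q := fun s => c * ξ₁ - H (y (s - 1))) hd.ne' hxc
      (by fun_prop) hτ.le ?_ ?_
    · intro s _
      have := hHg _ (hyb (s - 1)).1 (hyb (s - 1)).2
      rw [show ξ₁ - y (s - 1) = ξ₁ + -1 * y (s - 1) by ring, this]; ring
    · intro r _
      refine ((hyd r).const_sub ξ₁).congr_deriv ?_
      ring
  have hspec : XMinusSpec c d ξ₁ κm g (fun t => ξ₁ - y t) := by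
    refine ⟨hsol, fun a b hab => ?_, ?_, ?_, ?_, ?_⟩
    · have := hym hab
      simp only; linarith
    · ext v
      constructor
      · rintro ⟨t, rfl⟩
        exact ⟨by simp only; linarith [(hyb t).2], by simp only; linarith [(hyb t).1]⟩
      · intro hv
        have e1 : ∃ a, ξ₁ - y a ≤ v := by
          obtain ⟨a, ha⟩ := (hyt.eventually (lt_mem_nhds (show ξ₁ - v < ξ₁ by linarith [hv.1]))).exists
          exact ⟨a, by linarith⟩
        have e2 : ∃ a, v ≤ ξ₁ - y a := by
          obtain ⟨a, ha⟩ := (hyl.eventually (gt_mem_nhds (show 0 < ξ₁ - v by linarith [hv.2]))).exists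
          exact ⟨a, by linarith⟩
        exact mem_range_of_exists_le_of_exists_ge hxc e1 e2
    · simp only; rw [hy0]; ring
    · simpa using hyl.const_sub ξ₁
    · simpa using hyt.const_sub ξ₁
  refine ⟨_, hspec, fun x' hx' => ?_⟩
  have gen : ∀ x, XMinusSpec c d ξ₁ κm g x → StrictMonoOn (fun t => (-1) * (x t - ξ₁)) (Iic 0) ∧
      ∀ t ≤ 0, 0 < (-1) * (x t - ξ₁) ∧ (-1) * (x t - ξ₁) < ξ₁ := by
    intro x hx
    constructor
    · intro a _ b _ hab
      have := hx.2.1 hab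
      simp only; linarith
    · intro t _
      have : x t ∈ Ioo 0 ξ₁ := hx.2.2.1 ▸ mem_range_self t
      exact ⟨by linarith [this.2], by linarith [this.1]⟩
  exact dde_spec_unique hc hH (by norm_num) hHg hx'.1 hsol (gen _ hx').1 (gen _ hspec).1
    (gen _ hx').2 (gen _ hspec).2 hx'.2.2.2.2.1 hspec.2.2.2.2.1
    (hx'.2.2.2.1.trans hspec.2.2.2.1.symm)


lemma dde_plus {c d : ℝ} {g g' : ℝ → ℝ} (hg : CgA g g') (hc : 0 < c) (hcd : c < d)
    {ξ₁ : ℝ} (hξ₁ : ξ₁ ∈ Ioo (0:ℝ) 1) (hzero : -c * ξ₁ + d * g ξ₁ = 0)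
    {κp : ℝ} (hκp : κp ∈ Ioo 0 (1 - ξ₁)) :
    ∃ xp : ℝ → ℝ, XPlusSpec c d ξ₁ κp g xp ∧
      ∀ xp' : ℝ → ℝ, XPlusSpec c d ξ₁ κp g xp' → xp' = xp := by
  have hd : 0 < d := hc.trans hcd
  obtain ⟨K, hH⟩ := ddeH_spec hg hc hcd hξ₁ hzero (σ := 1) (κ := 1 - ξ₁) (Or.inl rfl)
    (by linarith [hξ₁.2]) (by simp)
  set H := ddeH d ξ₁ 1 (1 - ξ₁) g with hHdef
  have hHg : ∀ u, 0 < u → u ≤ 1 - ξ₁ → d * g (ξ₁ + 1 * u) = c * ξ₁ + 1 * H u := by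
    intro u h0 h1
    rw [hHdef, ddeH, ddeClamp_id h0.le h1]
    linear_combination hzero
  have hHc := hH.cont
  have hdc1 : 1 < d / c := by rw [lt_div_iff₀ hc]; linarith
  have hcdc : c * (d / c) = d := mul_div_cancel₀ d hc.ne'
  have hpos' : ∀ u, 0 < u → u ≤ 1 - ξ₁ → c * u < H u := by
    intro u h0 h1
    rcases h1.lt_or_eq with h2 | h2
    · exact hH.hpos u h0 h2
    · have h3 := hHg u h0 h1
      rw [h2, show ξ₁ + 1 * (1 - ξ₁) = 1 by ring, hg.g_one] at h3
      rw [h2]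
      nlinarith
  obtain ⟨y, hyc, hym, hy0, hyb, hyl, hyd⟩ := dde_entire hc (κ := κp) (B := d / c - ξ₁) hκp.1
    hH.hK hH.hLip hH.hmono hH.hneg (fun u h0 h1 => hH.hpos u h0 (by linarith [hκp.2]))
    (fun u => by
      have := ddeH_le' hg hd hξ₁ hzero u
      rw [mul_sub, hcdc]; exact this) (by linarith [hκp.2])
  have hreach : ∃ t, 1 - ξ₁ ≤ y t := by
    by_contra! hcon
    have hbdd : BddAbove (range y) := ⟨1 - ξ₁, by rintro _ ⟨t, rfl⟩; exact (hcon t).le⟩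
    have h1 := tendsto_atTop_ciSup hym.monotone hbdd
    have h2 := dde_equil_top (T := 0) hHc (fun t _ => hyd t) h1
    have h3 : (⨆ i, y i) ≤ 1 - ξ₁ := ciSup_le fun t => (hcon t).le
    have h4 : 0 < ⨆ i, y i := (hyb 0).1.trans_le (le_ciSup hbdd 0)
    exact absurd h2 (hpos' _ h4 h3).ne'
  obtain ⟨t₁, ht₁⟩ : ∃ t₁, y t₁ = 1 - ξ₁ :=
    mem_range_of_exists_le_of_exists_ge hyc ⟨0, by rw [hy0]; exact hκp.2.le⟩ hreach
  have ht₁p : 0 < t₁ := by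
    rw [← hym.lt_iff_lt, hy0, ht₁]; exact hκp.2
  -- the forward continuation
  set gm : ℝ → ℝ := fun ξ => if ξ ≤ 1 then g (max 0 (min ξ 1)) else 0 with hgm
  have hclm : ∀ ξ : ℝ, max 0 (min ξ 1) ∈ Icc (0:ℝ) 1 := fun ξ =>
    ⟨le_max_left _ _, max_le zero_le_one (min_le_right _ _)⟩
  have hgmm : Measurable gm := by
    have h1 : Continuous fun ξ : ℝ => g (max 0 (min ξ 1)) :=
      hg.contOn.comp_continuous (by fun_prop) hclm
    exact Measurable.ite measurableSet_Iic h1.measurable measurable_const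
  have hgm01 : ∀ ξ, 0 ≤ gm ξ ∧ gm ξ ≤ 1 := by
    intro ξ
    simp only [hgm]
    split_ifs
    · exact hg.maps_to _ (hclm ξ).1
    · simp
  have hgme : ∀ ξ, 0 ≤ ξ → gm ξ = g ξ := by
    intro ξ h0
    simp only [hgm]
    split_ifs with h
    · rw [min_eq_left h, max_eq_right h0]
    · rw [hg.eq_zero ξ (not_le.1 h)]
  have hgm1 : ∀ ξ, 1 < ξ → gm ξ = 0 := by
    intro ξ h
    rw [hgme ξ (by linarith), hg.eq_zero ξ h]
  set T := t₁ + 1 with hT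
  obtain ⟨x, hxc, hxT, hxf⟩ := dde_forward c d T gm (fun t => ξ₁ + y t) hgmm 1
    (fun u => by rw [abs_of_nonneg (hgm01 u).1]; exact (hgm01 u).2) (by fun_prop)
  have hxm : StrictMonoOn x (Iic T) := by
    intro a ha b hb hab
    rw [hxT a ha, hxT b hb]
    linarith [hym hab]
  have hx1 : x t₁ = 1 := by rw [hxT t₁ (by linarith), ht₁]; ring
  have hxTT : 1 < x T := by
    rw [← hx1]; exact hxm (show t₁ ≤ T by linarith) (show T ≤ T from le_rfl) (by linarith)
  have hxTd : x T < d / c := by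
    rw [hxT T le_rfl]; linarith [(hyb T).2]
  have hxb : ∀ t, 0 < x t ∧ x t < d / c := by
    intro t
    rcases le_total t T with h | h
    · rw [hxT t h]
      exact ⟨by linarith [(hyb t).1, hξ₁.1], by linarith [(hyb t).2]⟩
    · obtain ⟨hi, he⟩ := hxf T t le_rfl h
      have eT := Real.exp_pos (c * T)
      have et := Real.exp_pos (c * t)
      have i1 : 0 ≤ ∫ s in T..t, Real.exp (c * s) * gm (x (s - 1)) :=
        intervalIntegral.integral_nonneg h fun s _ =>
          mul_nonneg (Real.exp_pos _).le (hgm01 _).1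
      have i2 : (∫ s in T..t, Real.exp (c * s) * gm (x (s - 1))) ≤
          c⁻¹ * (Real.exp (c * t) - Real.exp (c * T)) := by
        have : (∫ s in T..t, Real.exp (c * s)) = c⁻¹ * (Real.exp (c * t) - Real.exp (c * T)) := by
          rw [intervalIntegral.integral_comp_mul_left (fun s => Real.exp s) hc.ne', integral_exp,
            smul_eq_mul]
        rw [← this]
        refine intervalIntegral.integral_mono_on h hi
          (Continuous.intervalIntegrable (by fun_prop) _ _) fun s _ => ?_
        exact mul_le_of_le_one_right (Real.exp_pos _).le (hgm01 _).2
      constructor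
      · have h1 : 0 < Real.exp (c * t) * x t := by
          rw [he]
          have : 0 < Real.exp (c * T) * x T := mul_pos eT (by linarith)
          have := mul_nonneg hd.le i1
          linarith
        exact (pos_iff_pos_of_mul_pos h1).1 et
      · have h1 := mul_le_mul_of_nonneg_left i2 hd.le
        have h2 : d * (c⁻¹ * (Real.exp (c * t) - Real.exp (c * T))) =
          d / c * Real.exp (c * t) - d / c * Real.exp (c * T) := by
          rw [div_eq_mul_inv]; ring
        have h3 : Real.exp (c * T) * x T < Real.exp (c * T) * (d / c) :=
          mul_lt_mul_of_pos_left hxTd eT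
        have h4 : Real.exp (c * t) * x t < Real.exp (c * t) * (d / c) := by
          rw [he]; linarith
        exact lt_of_mul_lt_mul_left h4 et.le
  have hgx : ∀ t, gm (x t) = g (x t) := fun t => hgme _ (hxb t).1.le
  have hback : ∀ τ t, τ ≤ t → t ≤ T →
      (IntervalIntegrable (fun s => Real.exp (c * s) * g (x (s - 1))) volume τ t ∧
      Real.exp (c * t) * x t = Real.exp (c * τ) * x τ
          + d * ∫ s in τ..t, Real.exp (c * s) * g (x (s - 1))) := by
    intro τ t hτ ht
    refine dde_sol_of_deriv (q := fun s => c * ξ₁ + H (y (s - 1))) hd.ne' hxc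
      (by fun_prop) hτ ?_ ?_
    · intro s hs
      have h1 : y (s - 1) ≤ 1 - ξ₁ := by
        rw [← ht₁]; exact hym.monotone (by linarith)
      have := hHg _ (hyb (s - 1)).1 h1
      rw [hxT (s - 1) (by linarith), ← one_mul (y (s - 1)), this]
      ring
    · intro r hr
      have hrT : r < T := by linarith
      have h1 : HasDerivAt x (-c * y r + H (y (r - 1))) r := by
        refine ((hyd r).const_add ξ₁).congr_of_eventuallyEq ?_
        filter_upwards [Iio_mem_nhds hrT] with s hs
        exact hxT s (le_of_lt hs)
      refine h1.congr_deriv ?_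
      rw [hxT r hrT.le]; ring
  have hfwd : ∀ τ t, T ≤ τ → τ ≤ t →
      (IntervalIntegrable (fun s => Real.exp (c * s) * g (x (s - 1))) volume τ t ∧
      Real.exp (c * t) * x t = Real.exp (c * τ) * x τ
          + d * ∫ s in τ..t, Real.exp (c * s) * g (x (s - 1))) := by
    intro τ t h1 h2
    have := hxf τ t h1 h2
    simp only [hgx] at this
    exact this
  have hsol : IsSolR c d g x := by
    refine ⟨hxc, fun t => (hxb t).1.le, fun τ t hτ => ?_⟩
    refine (dde_conv (x := x) (p := fun s => g (x (s - 1)))).2 ?_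
    rcases le_total t T with h | h
    · exact hback τ t hτ.le h
    rcases le_total T τ with h' | h'
    · exact hfwd τ t h' hτ.le
    obtain ⟨a1, a2⟩ := hback τ T h' le_rfl
    obtain ⟨b1, b2⟩ := hfwd T t le_rfl h
    refine ⟨a1.trans b1, ?_⟩
    rw [← intervalIntegral.integral_add_adjacent_intervals a1 b1, b2, a2]
    ring
  set t₂ := T + (1 / c) * Real.log (x T) with ht₂
  have hlog : 0 < Real.log (x T) := Real.log_pos hxTT
  have hTt₂ : T < t₂ := by
    have : 0 < (1 / c) * Real.log (x T) := by positivity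
    linarith
  have hct₂ : c * (t₂ - T) = Real.log (x T) := by
    rw [ht₂, add_sub_cancel_left, ← mul_assoc, mul_one_div_cancel hc.ne', one_mul]
  have hgt : ∀ r, r < t₂ → 1 < x T * Real.exp (-c * (r - T)) := by
    intro r hr
    have h1 : x T * Real.exp (-c * (r - T)) = Real.exp (c * (t₂ - r)) := by
      have : c * (t₂ - r) = Real.log (x T) + -c * (r - T) := by rw [← hct₂]; ring
      rw [this, Real.exp_add, Real.exp_log (by linarith)]
    rw [h1, Real.one_lt_exp_iff]
    exact mul_pos hc (by linarith)
  have hform : ∀ n : ℕ, ∀ t, T ≤ t → t ≤ T + n → t ≤ t₂ + 1 →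
      x t = x T * Real.exp (-c * (t - T)) := by
    intro n
    induction n with
    | zero =>
      intro t h1 h2 _
      have : t = T := le_antisymm (by simpa using h2) h1
      rw [this]; simp
    | succ n ih =>
      intro t h1 h2 h3
      push_cast at h2
      obtain ⟨_, he⟩ := hxf T t le_rfl h1
      have hz : (∫ s in T..t, Real.exp (c * s) * gm (x (s - 1))) = ∫ s in T..t, (0:ℝ) := by
        refine intervalIntegral.integral_congr_Ioo_of_le h1 fun s hs => ?_
        have : 1 < x (s - 1) := by
          rcases le_total (s - 1) T with h | h
          · have h4 := hxm (show t₁ ≤ T by linarith) h (by linarith [hs.1])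
            rwa [hx1] at h4
          · rw [ih (s - 1) h (by linarith [hs.2]) (by linarith [hs.2])]
            exact hgt _ (by linarith [hs.2])
        simp only [hgm1 _ this, mul_zero]
      rw [hz, intervalIntegral.integral_zero, mul_zero, add_zero] at he
      have e1 : Real.exp (-c * (t - T)) = Real.exp (-(c * t)) * Real.exp (c * T) := by
        rw [← Real.exp_add]; congr 1; ring
      have e2 : Real.exp (-(c * t)) * Real.exp (c * t) = 1 := by rw [← Real.exp_add]; simp
      rw [e1]
      linear_combination Real.exp (-(c * t)) * he - x t * e2
  have hform' : ∀ t, T ≤ t → t ≤ t₂ + 1 → x t = x T * Real.exp (-c * (t - T)) := by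
    intro t h1 h2
    obtain ⟨n, hn⟩ := exists_nat_ge (t - T)
    exact hform n t h1 (by linarith) h2
  have hspec : XPlusSpec c d ξ₁ κp g x := by
    refine ⟨hsol, ?_, by linarith [hκp.2], ?_, fun t => hxb t, t₁, ht₁p, hx1, hxm, ?_, ?_, ?_, ?_⟩
    · rw [hxT 0 (by linarith), hy0]
    · have h1 : Tendsto (fun t => ξ₁ + y t) atBot (𝓝 ξ₁) := by simpa using hyl.const_add ξ₁
      refine h1.congr' ?_
      filter_upwards [eventually_le_atBot T] with t ht
      exact (hxT t ht).symm
    · intro t' _ h1 h2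
      rcases le_total t' t₁ with h | h
      · exact hxm.injOn (show t' ≤ T by linarith) (show t₁ ≤ T by linarith) (h1.trans hx1.symm)
      · exact h2.injOn (show t' ≤ t' + 1 by linarith) (show t₁ ≤ t' + 1 by linarith)
          (h1.trans hx1.symm)
    · show x t₂ = 1
      rw [hform' t₂ hTt₂.le (by linarith), neg_mul, hct₂, Real.exp_neg, Real.exp_log (by linarith)]
      exact mul_inv_cancel₀ (by linarith)
    · intro t ht
      change t ∈ Ioo t₁ t₂ at ht
      rcases le_total t T with h | h
      · rw [← hx1]
        exact hxm (show t₁ ≤ T by linarith) h ht.1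
      · rw [hform' t h (by linarith [ht.2])]
        exact hgt t ht.2
    · intro t ht
      have h1 := hform' t ht.1 ht.2
      rw [h1]
      show _ = x T * _
      rw [hT]
      congr 3; ring
  refine ⟨x, hspec, fun x' hx' => ?_⟩
  have gen : ∀ x, XPlusSpec c d ξ₁ κp g x → StrictMonoOn (fun t => 1 * (x t - ξ₁)) (Iic 0) ∧
      ∀ t ≤ 0, 0 < 1 * (x t - ξ₁) ∧ 1 * (x t - ξ₁) < 1 - ξ₁ := by
    rintro x ⟨_, k0, k1, kl, _, s, hs, _, km, _⟩
    have km' : StrictMonoOn x (Iic 0) := km.mono fun t ht => by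
      have : t ≤ 0 := ht
      show t ≤ s + 1
      linarith
    constructor
    · intro a ha b hb hab
      have := km' ha hb hab
      simp only; linarith
    · intro t ht
      have h1 : x t ≤ x 0 := km'.monotoneOn ht (show (0:ℝ) ≤ 0 from le_rfl) ht
      have h2 : ξ₁ ≤ x (t - 1) := by
        refine le_of_tendsto kl ?_
        filter_upwards [eventually_le_atBot (t - 1)] with r hr
        exact km'.monotoneOn (show r ≤ 0 by linarith) (show t - 1 ≤ 0 by linarith) hr
      have h3 : x (t - 1) < x t := km' (show t - 1 ≤ 0 by linarith) ht (by linarith)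
      exact ⟨by linarith, by linarith⟩
  exact dde_spec_unique hc hH (by norm_num) (fun u h0 h1 => hHg u h0 h1.le) hx'.1 hsol
    (gen _ hx').1 (gen _ hspec).1
    (gen _ hx').2 (gen _ hspec).2 hx'.2.2.2.1 hspec.2.2.2.1
    (hx'.2.1.trans hspec.2.1.symm)

/-- existence and uniqueness of the solutions `x⁻, x⁺` of `(E_g)` on `ℝ`
with the listed properties. -/
theorem stmt_8 (c d : ℝ) (g g' : ℝ → ℝ) (hg : CgA g g') (hc : 0 < c) (hcd : c < d)
    (ξ₁ : ℝ) (hξ₁ : ξ₁ ∈ Ioo (0:ℝ) 1) (hzero : -c * ξ₁ + d * g ξ₁ = 0)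
    (huniq : ∀ ξ ∈ Ioc (0:ℝ) 1, -c * ξ + d * g ξ = 0 → ξ = ξ₁)
    (κp κm : ℝ) (hκp : κp ∈ Ioo 0 (1 - ξ₁)) (hκm : κm ∈ Ioo (-ξ₁) 0) :
    ∃ xm xp : ℝ → ℝ,
      XMinusSpec c d ξ₁ κm g xm ∧ XPlusSpec c d ξ₁ κp g xp ∧
      (∀ xm' : ℝ → ℝ, XMinusSpec c d ξ₁ κm g xm' → xm' = xm) ∧
      (∀ xp' : ℝ → ℝ, XPlusSpec c d ξ₁ κp g xp' → xp' = xp) := by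
  obtain ⟨xm, h1, h2⟩ := dde_minus hg hc hcd hξ₁ hzero hκm
  obtain ⟨xp, h3, h4⟩ := dde_plus hg hc hcd hξ₁ hzero hκp
  exact ⟨xm, xp, h1, h3, h2, h4⟩
end
end
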